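/- Let K satisfy the kernel assumptions and let f^in be a nonnegative function in X_{0,1}. For each ε ∈ (0,1), let f^ε = (f_i^ε)_{i≥1} be a solution of the discrete RBK system with coefficients a^ε_{i,j} := ε·K(εi, εj) and initial data f_i^{0,ε} := ε^{-1} ∫_{Λ_i^ε} f^in(x) dx, and set f_ε(x,t) := Σ_{i≥1} f_i^ε(t)·1_{Λ_i^ε}(x). Then there exist a sequence ε_n → 0 in (0,1) and a nonnegative function f with f ∈ C([0,T]; L¹(0,∞)) ∩ L^∞(0,T; X_{0,1}) for every T ∈ (0,∞), such that: (i) for every T ∈ (0,∞), f_{ε_n} → f in C([0,T]; w-L¹(0,∞)), i.e. for every φ ∈ L^∞(0,∞), sup_{t∈[0,T]} |∫₀^∞ (f_{ε_n}(x,t) − f(x,t)) φ(x) dx| → 0; and (ii) f is a weak solution of the continuous RBK coagulation equation with initial datum f^in: for every t ≥ 0 and every φ ∈ L^∞(0,∞), ∫₀^∞ (f(x,t) − f^in(x)) φ(x) dx = ∫₀^t ∫₀^∞ ∫₀^x [φ(x−y) − φ(x) − φ(y)] K(x,y) f(x,s) f(y,s) dy dx ds, all integrals being absolutely convergent. -/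

import Mathlib

open MeasureTheory

/-- The cell `Λ_i^ε = [(i-1/2)ε, (i+1/2)ε)`. -/
noncomputable def cell (ε : ℝ) (i : ℕ) : Set ℝ :=
  Set.Ico (((i : ℝ) - 1/2) * ε) (((i : ℝ) + 1/2) * ε)

/-- The step function `f_ε(x) = Σ_{i≥1} g_i 1_{Λ_i^ε}(x)`. -/
noncomputable def stepFn (ε : ℝ) (g : ℕ → ℝ) (x : ℝ) : ℝ :=
  ∑' i : ℕ, g (i + 1) * (cell ε (i + 1)).indicator (fun _ => (1:ℝ)) x

/-- `g` is a solution of the discrete RBK coagulation system with coagulation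
coefficients `a` and initial data `g0`: the functions `g i` (for `i ≥ 1`) are nonnegative,
start from `g0 i`, solve the DRBK equations (gain minus loss, both series converging),
have mass bounded by the (finite) initial mass, number of particles bounded by the initial
number, and nonincreasing tail moments. -/
def IsDRBKSol (a : ℕ → ℕ → ℝ) (g0 : ℕ → ℝ) (g : ℕ → ℝ → ℝ) : Prop :=
  (∀ i : ℕ, 1 ≤ i → ∀ t : ℝ, 0 ≤ t → 0 ≤ g i t) ∧
  (∀ i : ℕ, 1 ≤ i → g i 0 = g0 i) ∧
  (∀ i : ℕ, 1 ≤ i → ∀ t : ℝ, 0 ≤ t →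
    Summable (fun j : ℕ => a (i + (j + 1)) (j + 1) * g (i + (j + 1)) t * g (j + 1) t) ∧
    Summable (fun j : ℕ => a i (j + 1) * g i t * g (j + 1) t) ∧
    HasDerivWithinAt (g i)
      ((∑' j : ℕ, a (i + (j + 1)) (j + 1) * g (i + (j + 1)) t * g (j + 1) t) -
        ∑' j : ℕ, a i (j + 1) * g i t * g (j + 1) t) (Set.Ici 0) t) ∧
  Summable (fun i : ℕ => ((i : ℝ) + 1) * g0 (i + 1)) ∧
  (∀ t : ℝ, 0 ≤ t → Summable (fun i : ℕ => ((i : ℝ) + 1) * g (i + 1) t)) ∧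
  (∀ t : ℝ, 0 ≤ t →
    ∑' i : ℕ, ((i : ℝ) + 1) * g (i + 1) t ≤ ∑' i : ℕ, ((i : ℝ) + 1) * g0 (i + 1)) ∧
  (∀ t : ℝ, 0 ≤ t → ∑' i : ℕ, g (i + 1) t ≤ ∑' i : ℕ, g0 (i + 1)) ∧
  (∀ m : ℕ, ∀ t₁ t₂ : ℝ, 0 ≤ t₁ → t₁ ≤ t₂ →
    ∑' k : ℕ, ((m + 1 + k : ℕ) : ℝ) * g (m + 1 + k) t₂ ≤
      ∑' k : ℕ, ((m + 1 + k : ℕ) : ℝ) * g (m + 1 + k) t₁)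

open MeasureTheory

/-- Distilled hypotheses on the kernel and on the family of discrete solutions. -/
structure RbkFam (K : ℝ → ℝ → ℝ) (F : ℝ → ℕ → ℝ → ℝ) (M CK R1 : ℝ) (tl : ℝ → ℝ) : Prop where
  K_cont : ContinuousOn (fun p : ℝ × ℝ => K p.1 p.2) (Set.Ioi 0 ×ˢ Set.Ioi 0)
  K_symm : ∀ x y : ℝ, 0 < x → 0 < y → K x y = K y x
  K_nonneg : ∀ x y : ℝ, 0 < x → 0 < y → 0 ≤ K x y
  CK_nonneg : 0 ≤ CK
  R1_one : 1 ≤ R1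
  K_big : ∀ x y : ℝ, 0 < x → 0 < y → R1 ≤ x → K x y ≤ CK * ((1 + x) * (1 + y))
  F_zero : ∀ ε t, F ε 0 t = 0
  F_nonneg : ∀ ε, 0 < ε → ε < 1 → ∀ i t, 0 ≤ F ε i t
  F_cont : ∀ ε, 0 < ε → ε < 1 → ∀ i, Continuous (F ε i)
  F_deriv : ∀ ε, 0 < ε → ε < 1 → ∀ i : ℕ, 1 ≤ i → ∀ t, 0 ≤ t →
    HasDerivWithinAt (F ε i)
      ((∑' j : ℕ, ε * K (ε * ((i + j : ℕ) : ℝ)) (ε * (j : ℝ)) * F ε (i + j) t * F ε j t) -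
        ∑' j : ℕ, ε * K (ε * (i : ℝ)) (ε * (j : ℝ)) * F ε i t * F ε j t) (Set.Ici 0) t
  F_sum : ∀ ε, 0 < ε → ε < 1 → ∀ t, Summable (fun i : ℕ => (1 + ε * (i : ℝ)) * F ε i t)
  F_mass : ∀ ε, 0 < ε → ε < 1 → ∀ t, ε * ∑' i : ℕ, (1 + ε * (i : ℝ)) * F ε i t ≤ M
  F_tail : ∀ ε, 0 < ε → ε < 1 → ∀ t, ∀ R, 1 ≤ R →
    ε * ∑' i : ℕ, (if R < ε * (i : ℝ) then (1 + ε * (i : ℝ)) * F ε i t else 0) ≤ tl R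
  tl_lim : Filter.Tendsto tl Filter.atTop (nhds 0)
  init_UI : ∀ κ, 0 < κ → ∃ L, 0 < L ∧ ∀ ε, 0 < ε → ε < 1 → ∀ m : ℕ,
    ∑ i ∈ Finset.range m, ε * max (F ε i 0 - L) 0 ≤ κ

/-- The collision rate of sizes `ε p.1` and `ε p.2`. -/
noncomputable def rbkC (K : ℝ → ℝ → ℝ) (F : ℝ → ℕ → ℝ → ℝ) (ε : ℝ) (p : ℕ × ℕ) (t : ℝ) : ℝ :=
  ε * (ε * K (ε * (p.1 : ℝ)) (ε * (p.2 : ℝ)) * F ε p.1 t * F ε p.2 t)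

/-- Symmetrised variation of a weight in a collision (`ℕ`-subtraction, `w 0 = 0`). -/
def rbkV (w : ℕ → ℝ) (p : ℕ × ℕ) : ℝ := w (p.1 - p.2) + w (p.2 - p.1) - w p.1 - w p.2

namespace RbkFam

variable {K : ℝ → ℝ → ℝ} {F : ℝ → ℕ → ℝ → ℝ} {M CK R1 : ℝ} {tl : ℝ → ℝ}

lemma C_nonneg (H : RbkFam K F M CK R1 tl) {ε : ℝ} (h0 : 0 < ε) (h1 : ε < 1) (p : ℕ × ℕ) (t : ℝ) :
    0 ≤ rbkC K F ε p t := by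
  unfold rbkC
  rcases Nat.eq_zero_or_pos p.1 with h | h
  · simp [h, H.F_zero]
  rcases Nat.eq_zero_or_pos p.2 with h' | h'
  · simp [h', H.F_zero]
  have a1 : (0:ℝ) < ε * p.1 := by positivity
  have a2 : (0:ℝ) < ε * p.2 := by positivity
  have := H.K_nonneg _ _ a1 a2
  have := H.F_nonneg ε h0 h1 p.1 t
  have := H.F_nonneg ε h0 h1 p.2 t
  positivity

lemma C_symm (H : RbkFam K F M CK R1 tl) {ε : ℝ} (h0 : 0 < ε) (p : ℕ × ℕ) (t : ℝ) :
    rbkC K F ε p.swap t = rbkC K F ε p t := by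
  unfold rbkC
  rcases Nat.eq_zero_or_pos p.1 with h | h
  · simp [h, H.F_zero]
  rcases Nat.eq_zero_or_pos p.2 with h' | h'
  · simp [h', H.F_zero]
  have a1 : (0:ℝ) < ε * p.1 := by positivity
  have a2 : (0:ℝ) < ε * p.2 := by positivity
  simp only [Prod.fst_swap, Prod.snd_swap]
  rw [H.K_symm _ _ a1 a2]; ring

/-- weighted number in the cell -/
noncomputable def b (F : ℝ → ℕ → ℝ → ℝ) (ε t : ℝ) (i : ℕ) : ℝ := ε * ((1 + ε * (i : ℝ)) * F ε i t)

lemma b_nonneg (H : RbkFam K F M CK R1 tl) {ε : ℝ} (h0 : 0 < ε) (h1 : ε < 1) (t : ℝ) (i : ℕ) :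
    0 ≤ b F ε t i := by
  have := H.F_nonneg ε h0 h1 i t
  unfold b; positivity

lemma b_sum (H : RbkFam K F M CK R1 tl) {ε : ℝ} (h0 : 0 < ε) (h1 : ε < 1) (t : ℝ) :
    Summable (b F ε t) := (H.F_sum ε h0 h1 t).mul_left ε

lemma b_tsum (H : RbkFam K F M CK R1 tl) {ε : ℝ} (h0 : 0 < ε) (h1 : ε < 1) (t : ℝ) :
    ∑' i, b F ε t i ≤ M := by
  unfold b; rw [tsum_mul_left]; exact H.F_mass ε h0 h1 t

lemma M_nonneg (H : RbkFam K F M CK R1 tl) : 0 ≤ M :=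
  le_trans (tsum_nonneg (H.b_nonneg (by norm_num : (0:ℝ) < 1/2) (by norm_num) 0))
    (H.b_tsum (by norm_num : (0:ℝ) < 1/2) (by norm_num) 0)

lemma F_le_b (H : RbkFam K F M CK R1 tl) {ε : ℝ} (h0 : 0 < ε) (h1 : ε < 1) (t : ℝ) (i : ℕ) :
    ε * F ε i t ≤ b F ε t i := by
  have := H.F_nonneg ε h0 h1 i t
  unfold b
  have h : 0 ≤ ε * (i : ℝ) := by positivity
  gcongr
  nlinarith

lemma K_loc (H : RbkFam K F M CK R1 tl) {h R : ℝ} (h0 : 0 < h) :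
    ∃ C, 0 ≤ C ∧ ∀ x y, h ≤ x → x ≤ R → h ≤ y → y ≤ R → K x y ≤ C := by
  have hc : IsCompact (Set.Icc h R ×ˢ Set.Icc h R) := isCompact_Icc.prod isCompact_Icc
  have hco : ContinuousOn (fun p : ℝ × ℝ => K p.1 p.2) (Set.Icc h R ×ˢ Set.Icc h R) := by
    apply H.K_cont.mono
    rintro ⟨x, y⟩ ⟨hx, hy⟩
    exact ⟨lt_of_lt_of_le h0 hx.1, lt_of_lt_of_le h0 hy.1⟩
  obtain ⟨C, hC⟩ := hc.exists_bound_of_continuousOn hco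
  refine ⟨max C 0, le_max_right _ _, fun x y a b c d => ?_⟩
  exact le_trans (le_trans (le_abs_self _) (hC (x, y) ⟨⟨a, b⟩, ⟨c, d⟩⟩)) (le_max_left _ _)

lemma K_big' (H : RbkFam K F M CK R1 tl) (x y : ℝ) (hx : 0 < x) (hy : 0 < y) (h : R1 ≤ x ∨ R1 ≤ y) :
    K x y ≤ CK * ((1 + x) * (1 + y)) := by
  rcases h with h | h
  · exact H.K_big x y hx hy h
  · rw [H.K_symm x y hx hy, mul_comm (1 + x)]; exact H.K_big y x hy hx h

lemma C_le (H : RbkFam K F M CK R1 tl) {ε : ℝ} (h0 : 0 < ε) (h1 : ε < 1) {C : ℝ} {p : ℕ × ℕ} {t : ℝ}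
    (hK : 0 < p.1 → 0 < p.2 →
      K (ε * p.1) (ε * p.2) ≤ C * ((1 + ε * p.1) * (1 + ε * p.2))) (hC : 0 ≤ C) :
    rbkC K F ε p t ≤ C * (b F ε t p.1 * b F ε t p.2) := by
  have n1 := H.F_nonneg ε h0 h1 p.1 t
  have n2 := H.F_nonneg ε h0 h1 p.2 t
  have := H.b_nonneg h0 h1 t p.1
  have := H.b_nonneg h0 h1 t p.2
  rcases Nat.eq_zero_or_pos p.1 with h | h
  · have : rbkC K F ε p t = 0 := by simp [rbkC, h, H.F_zero]
    rw [this]; positivity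
  rcases Nat.eq_zero_or_pos p.2 with h' | h'
  · have : rbkC K F ε p t = 0 := by simp [rbkC, h', H.F_zero]
    rw [this]; positivity
  have := hK h h'
  unfold rbkC b
  calc ε * (ε * K (ε * (p.1 : ℝ)) (ε * (p.2 : ℝ)) * F ε p.1 t * F ε p.2 t)
      ≤ ε * (ε * (C * ((1 + ε * p.1) * (1 + ε * p.2))) * F ε p.1 t * F ε p.2 t) := by gcongr
    _ = _ := by ring

lemma exists_C_le (H : RbkFam K F M CK R1 tl) {ε : ℝ} (h0 : 0 < ε) (h1 : ε < 1) :
    ∃ C, 0 ≤ C ∧ ∀ p t, rbkC K F ε p t ≤ C * (b F ε t p.1 * b F ε t p.2) := by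
  obtain ⟨C, hC, hK⟩ := H.K_loc (R := R1) h0
  refine ⟨max C CK, le_trans hC (le_max_left _ _), fun p t => ?_⟩
  refine H.C_le h0 h1 (fun q1 q2 => ?_) (le_trans hC (le_max_left _ _))
  have a1 : (1:ℝ) ≤ p.1 := by exact_mod_cast q1
  have a2 : (1:ℝ) ≤ p.2 := by exact_mod_cast q2
  have b1 : ε ≤ ε * p.1 := by nlinarith
  have b2 : ε ≤ ε * p.2 := by nlinarith
  by_cases hb : R1 ≤ ε * p.1 ∨ R1 ≤ ε * p.2
  · refine le_trans (H.K_big' _ _ (by linarith) (by linarith) hb) ?_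
    have : 0 ≤ (1 + ε * (p.1:ℝ)) * (1 + ε * p.2) := by positivity
    gcongr; exact le_max_right _ _
  · push Not at hb
    refine le_trans (hK _ _ b1 hb.1.le b2 hb.2.le) ?_
    have e1 : 1 ≤ (1 + ε * (p.1:ℝ)) * (1 + ε * p.2) := by nlinarith
    nlinarith [le_max_left C CK]

lemma bb_sum (H : RbkFam K F M CK R1 tl) {ε : ℝ} (h0 : 0 < ε) (h1 : ε < 1) (t : ℝ) :
    Summable (fun p : ℕ × ℕ => b F ε t p.1 * b F ε t p.2) :=
  (H.b_sum h0 h1 t).mul_of_nonneg (H.b_sum h0 h1 t) (H.b_nonneg h0 h1 t) (H.b_nonneg h0 h1 t)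

lemma C_sum (H : RbkFam K F M CK R1 tl) {ε : ℝ} (h0 : 0 < ε) (h1 : ε < 1) (t : ℝ) :
    Summable (fun p => rbkC K F ε p t) := by
  obtain ⟨C, hC, h⟩ := H.exists_C_le h0 h1
  exact Summable.of_nonneg_of_le (fun p => H.C_nonneg h0 h1 p t) (fun p => h p t)
    ((H.bb_sum h0 h1 t).mul_left C)

lemma prod_tsum_le {x y : ℕ → ℝ} (hx : Summable x) (hy : Summable y) (x0 : ∀ i, 0 ≤ x i)
    (y0 : ∀ i, 0 ≤ y i) {X Y : ℝ} (hX : ∑' i, x i ≤ X) (hY : ∑' i, y i ≤ Y) :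
    ∑' p : ℕ × ℕ, x p.1 * y p.2 ≤ X * Y := by
  rw [← hx.tsum_mul_tsum hy (hx.mul_of_nonneg hy x0 y0)]
  have a1 : 0 ≤ ∑' i, x i := tsum_nonneg x0
  have a2 : 0 ≤ ∑' i, y i := tsum_nonneg y0
  gcongr
  exact a1.trans hX

lemma C_tsum_bdd (H : RbkFam K F M CK R1 tl) {ε : ℝ} (h0 : 0 < ε) (h1 : ε < 1) :
    ∃ B, 0 ≤ B ∧ ∀ t, ∑' p, rbkC K F ε p t ≤ B := by
  obtain ⟨C, hC, h⟩ := H.exists_C_le h0 h1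
  have hM := H.M_nonneg
  refine ⟨C * (M * M), by positivity, fun t => ?_⟩
  refine le_trans ((H.C_sum h0 h1 t).tsum_le_tsum (fun p => h p t)
    ((H.bb_sum h0 h1 t).mul_left C)) ?_
  rw [tsum_mul_left]
  exact mul_le_mul_of_nonneg_left (prod_tsum_le (H.b_sum h0 h1 t) (H.b_sum h0 h1 t)
    (H.b_nonneg h0 h1 t) (H.b_nonneg h0 h1 t) (H.b_tsum h0 h1 t) (H.b_tsum h0 h1 t)) hC

lemma CV_sum (H : RbkFam K F M CK R1 tl) {ε : ℝ} (h0 : 0 < ε) (h1 : ε < 1) (t : ℝ)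
    (g : ℕ × ℕ → ℝ) {B : ℝ} (hg : ∀ p, |g p| ≤ B) :
    Summable (fun p => rbkC K F ε p t * g p) := by
  refine Summable.of_norm_bounded ((H.C_sum h0 h1 t).mul_right B) (fun p => ?_)
  rw [norm_mul, Real.norm_eq_abs, Real.norm_eq_abs, abs_of_nonneg (H.C_nonneg h0 h1 p t)]
  exact mul_le_mul_of_nonneg_left (hg p) (H.C_nonneg h0 h1 p t)

/-- The pointwise discrete weak formulation. -/
lemma weak_pt (H : RbkFam K F M CK R1 tl) {ε : ℝ} (h0 : 0 < ε) (h1 : ε < 1) (t : ℝ)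
    (w : ℕ → ℝ) (m : ℕ) {B : ℝ} (hB : ∀ i, |w i| ≤ B) (w0 : w 0 = 0) (hm : ∀ i, m < i → w i = 0) :
    ∑ i ∈ Finset.range (m + 1), w i * (ε *
      ((∑' j : ℕ, ε * K (ε * ((i + j : ℕ) : ℝ)) (ε * (j : ℝ)) * F ε (i + j) t * F ε j t) -
        ∑' j : ℕ, ε * K (ε * (i : ℝ)) (ε * (j : ℝ)) * F ε i t * F ε j t))
    = (1/2) * ∑' p, rbkC K F ε p t * rbkV w p := by
  set c := fun p => rbkC K F ε p t with hc
  have hcs : Summable c := H.C_sum h0 h1 t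
  have hinj : Function.Injective (fun q : ℕ × ℕ => ((q.1 + q.2, q.2) : ℕ × ℕ)) := by
    rintro ⟨a, b⟩ ⟨a', b'⟩ hh
    simp only [Prod.mk.injEq] at hh ⊢
    omega
  have e1 : ∀ i : ℕ, ε * (∑' j : ℕ, ε * K (ε * ((i + j : ℕ) : ℝ)) (ε * (j : ℝ)) * F ε (i + j) t * F ε j t)
      = ∑' j, c (i + j, j) := fun i => by rw [← tsum_mul_left]; rfl
  have e2 : ∀ i : ℕ, ε * (∑' j : ℕ, ε * K (ε * (i : ℝ)) (ε * (j : ℝ)) * F ε i t * F ε j t)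
      = ∑' j, c (i, j) := fun i => by rw [← tsum_mul_left]; rfl
  have s1 : Summable (fun p => c p * w (p.1 - p.2)) := H.CV_sum h0 h1 t _ (fun p => hB _)
  have s1' : Summable (fun p => c p * w (p.2 - p.1)) := H.CV_sum h0 h1 t _ (fun p => hB _)
  have s2 : Summable (fun p => c p * w p.1) := H.CV_sum h0 h1 t _ (fun p => hB _)
  have s2' : Summable (fun p => c p * w p.2) := H.CV_sum h0 h1 t _ (fun p => hB _)
  have sg : Summable (fun q : ℕ × ℕ => c (q.1 + q.2, q.2) * w q.1) := by
    have := s1.comp_injective hinj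
    refine this.congr (fun q => ?_)
    simp [Function.comp]
  have g1 : ∑ i ∈ Finset.range (m + 1), w i * ∑' j, c (i + j, j) = ∑' p, c p * w (p.1 - p.2) := by
    rw [← hinj.tsum_eq (f := fun p => c p * w (p.1 - p.2))]
    · rw [sg.congr (fun q => by simp) |>.tsum_prod]
      rw [tsum_eq_sum (s := Finset.range (m + 1))]
      · refine Finset.sum_congr rfl (fun i _ => ?_)
        rw [← tsum_mul_left]
        refine tsum_congr (fun j => ?_)
        simp [mul_comm]
      · intro i hi
        have : m < i := by simpa using hi
        simp [hm i this]
    · intro p hp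
      rw [Function.mem_support] at hp
      have : p.1 - p.2 ≠ 0 := by
        intro h; apply hp; simp [h, w0]
      exact ⟨(p.1 - p.2, p.2), by ext <;> simp; omega⟩
  have g2 : ∑ i ∈ Finset.range (m + 1), w i * ∑' j, c (i, j) = ∑' p, c p * w p.1 := by
    rw [s2.tsum_prod, tsum_eq_sum (s := Finset.range (m + 1))]
    · refine Finset.sum_congr rfl (fun i _ => ?_)
      rw [← tsum_mul_left]
      exact tsum_congr (fun j => mul_comm _ _)
    · intro i hi
      have : m < i := by simpa using hi
      simp [hm i this]
  have y1 : ∑' p, c p * w (p.2 - p.1) = ∑' p, c p * w (p.1 - p.2) := by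
    rw [← (Equiv.prodComm ℕ ℕ).tsum_eq]
    refine tsum_congr (fun p => ?_)
    have : c p.swap = c p := H.C_symm h0 p t
    simp [this]
  have y2 : ∑' p, c p * w p.2 = ∑' p, c p * w p.1 := by
    rw [← (Equiv.prodComm ℕ ℕ).tsum_eq]
    refine tsum_congr (fun p => ?_)
    have : c p.swap = c p := H.C_symm h0 p t
    simp [this]
  have tot : ∑' p, c p * rbkV w p = ∑' p, c p * w (p.1 - p.2) + ∑' p, c p * w (p.2 - p.1)
      - ∑' p, c p * w p.1 - ∑' p, c p * w p.2 := by
    rw [← s1.tsum_add s1', ← (s1.add s1').tsum_sub s2, ← ((s1.add s1').sub s2).tsum_sub s2']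
    refine tsum_congr (fun p => ?_)
    unfold rbkV; ring
  rw [tot, y1, y2, ← g1, ← g2]
  simp_rw [mul_sub ε, e1, e2, mul_sub]
  rw [Finset.sum_sub_distrib]; ring

end RbkFam
open MeasureTheory

namespace RbkFam

variable {K : ℝ → ℝ → ℝ} {F : ℝ → ℕ → ℝ → ℝ} {M CK R1 : ℝ} {tl : ℝ → ℝ}

lemma C_meas (H : RbkFam K F M CK R1 tl) {ε : ℝ} (h0 : 0 < ε) (h1 : ε < 1) (p : ℕ × ℕ) :
    Measurable (rbkC K F ε p) := by
  have a := (H.F_cont ε h0 h1 p.1).measurable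
  have b := (H.F_cont ε h0 h1 p.2).measurable
  unfold rbkC
  fun_prop

lemma CV_abs (H : RbkFam K F M CK R1 tl) {ε : ℝ} (h0 : 0 < ε) (h1 : ε < 1) (t : ℝ)
    (g : ℕ × ℕ → ℝ) {B : ℝ} (hg : ∀ p, |g p| ≤ B) :
    |∑' p, rbkC K F ε p t * g p| ≤ (∑' p, rbkC K F ε p t) * B := by
  rw [← tsum_mul_right]
  rw [← Real.norm_eq_abs]
  refine tsum_of_norm_bounded ((H.C_sum h0 h1 t).mul_right B).hasSum (fun p => ?_)
  rw [norm_mul, Real.norm_eq_abs, Real.norm_eq_abs, abs_of_nonneg (H.C_nonneg h0 h1 p t)]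
  exact mul_le_mul_of_nonneg_left (hg p) (H.C_nonneg h0 h1 p t)

lemma CV_int (H : RbkFam K F M CK R1 tl) {ε : ℝ} (h0 : 0 < ε) (h1 : ε < 1)
    (g : ℕ × ℕ → ℝ → ℝ) {B : ℝ} (hg : ∀ p τ, |g p τ| ≤ B) (hm : ∀ p, Measurable (g p)) (s t : ℝ) :
    IntervalIntegrable (fun τ => ∑' p, rbkC K F ε p τ * g p τ) volume s t := by
  obtain ⟨D, hD, hCD⟩ := H.C_tsum_bdd h0 h1
  have hB : 0 ≤ B := le_trans (abs_nonneg _) (hg (0, 0) 0)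
  have hmeas : Measurable (fun τ => ∑' p, rbkC K F ε p τ * g p τ) :=
    Measurable.tsum (fun p => (H.C_meas h0 h1 p).mul (hm p))
  refine (intervalIntegrable_const (c := D * B)).mono_fun hmeas.aestronglyMeasurable ?_
  refine Filter.Eventually.of_forall (fun τ => ?_)
  beta_reduce
  rw [Real.norm_eq_abs, Real.norm_eq_abs, abs_of_nonneg (by positivity : 0 ≤ D * B)]
  exact le_trans (H.CV_abs h0 h1 τ _ (fun p => hg p τ)) (mul_le_mul_of_nonneg_right (hCD τ) hB)

/-- Integrated weak formulation with (nonlinear) weights. -/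
lemma weak_form (H : RbkFam K F M CK R1 tl) {ε : ℝ} (h0 : 0 < ε) (h1 : ε < 1)
    (m : ℕ) (Ψ ψ : ℕ → ℝ → ℝ) (hΨ : ∀ i u, HasDerivAt (Ψ i) (ψ i u) u)
    (hψ : ∀ i, Measurable (ψ i)) {B : ℝ} (hB : ∀ i u, |ψ i u| ≤ B) (w0 : ∀ u, ψ 0 u = 0)
    (hm : ∀ i, m < i → ∀ u, ψ i u = 0) {s t : ℝ} (hs : 0 ≤ s) (hst : s ≤ t) :
    ∑ i ∈ Finset.range (m + 1), ε * (Ψ i (F ε i t) - Ψ i (F ε i s)) =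
      ∫ τ in s..t, (1/2) * ∑' p, rbkC K F ε p τ * rbkV (fun i => ψ i (F ε i τ)) p := by
  have hVb : ∀ p τ, |rbkV (fun i => ψ i (F ε i τ)) p| ≤ 4 * B := by
    intro p τ
    unfold rbkV
    have a1 := abs_le.1 (hB (p.1 - p.2) (F ε (p.1 - p.2) τ))
    have a2 := abs_le.1 (hB (p.2 - p.1) (F ε (p.2 - p.1) τ))
    have a3 := abs_le.1 (hB (p.1) (F ε (p.1) τ))
    have a4 := abs_le.1 (hB (p.2) (F ε (p.2) τ))
    rw [abs_le]; constructor <;> linarith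
  have hwm : ∀ i, Measurable (fun τ => ψ i (F ε i τ)) := fun i =>
    (hψ i).comp (H.F_cont ε h0 h1 i).measurable
  have hVm : ∀ p : ℕ × ℕ, Measurable (fun τ => rbkV (fun i => ψ i (F ε i τ)) p) := by
    intro p
    unfold rbkV
    exact (((hwm _).add (hwm _)).sub (hwm _)).sub (hwm _)
  rw [intervalIntegral.integral_eq_sub_of_hasDeriv_right_of_le hst
    (f := fun τ => ∑ i ∈ Finset.range (m + 1), ε * Ψ i (F ε i τ))]
  · rw [← Finset.sum_sub_distrib]
    exact Finset.sum_congr rfl (fun i _ => by ring)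
  · refine Continuous.continuousOn (continuous_finsetSum _ (fun i _ => ?_))
    have : Continuous (Ψ i) := continuous_iff_continuousAt.2 (fun u => (hΨ i u).continuousAt)
    exact continuous_const.mul (this.comp (H.F_cont ε h0 h1 i))
  · intro τ hτ
    have hτ0 : 0 < τ := lt_of_le_of_lt hs hτ.1
    rw [← H.weak_pt h0 h1 τ (fun i => ψ i (F ε i τ)) m (fun i => hB _ _) (w0 _)
      (fun i hi => hm i hi _)]
    have key : ∀ i ∈ Finset.range (m + 1), HasDerivWithinAt (fun τ => ε * Ψ i (F ε i τ))
        (ψ i (F ε i τ) * (ε *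
      ((∑' j : ℕ, ε * K (ε * ((i + j : ℕ) : ℝ)) (ε * (j : ℝ)) * F ε (i + j) τ * F ε j τ) -
        ∑' j : ℕ, ε * K (ε * (i : ℝ)) (ε * (j : ℝ)) * F ε i τ * F ε j τ))) (Set.Ioi τ) τ := by
      intro i _
      rcases Nat.eq_zero_or_pos i with h | h
      · subst h
        simp only [H.F_zero, w0, zero_mul]
        exact hasDerivWithinAt_const _ _ _
      · have d := (H.F_deriv ε h0 h1 i h τ hτ0.le).mono
          (fun x (hx : τ < x) => (hτ0.trans hx).le : Set.Ioi τ ⊆ Set.Ici 0)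
        have := ((hΨ i (F ε i τ)).comp_hasDerivWithinAt τ d).const_mul ε
        refine this.congr_deriv ?_
        ring
    have := HasDerivWithinAt.fun_sum key
    exact this
  · exact (H.CV_int h0 h1 _ hVb hVm s t).const_mul _

/-- indicator as a real number -/
noncomputable def ind (P : Prop) : ℝ := by classical exact if P then 1 else 0

lemma ind_pos {P : Prop} (h : P) : ind P = 1 := by simp [ind, h]
lemma ind_neg {P : Prop} (h : ¬ P) : ind P = 0 := by simp [ind, h]
lemma ind_nonneg (P : Prop) : 0 ≤ ind P := by unfold ind; split_ifs <;> norm_num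
lemma ind_le (P : Prop) : ind P ≤ 1 := by unfold ind; split_ifs <;> norm_num
lemma ind_abs (P : Prop) : |ind P| ≤ 1 := by rw [abs_of_nonneg (ind_nonneg P)]; exact ind_le P

lemma bt_tsum (H : RbkFam K F M CK R1 tl) {ε : ℝ} (h0 : 0 < ε) (h1 : ε < 1) (t : ℝ) {R : ℝ}
    (hR : 1 ≤ R) : Summable (fun i : ℕ => b F ε t i * ind (R < ε * i)) ∧
      ∑' i : ℕ, b F ε t i * ind (R < ε * i) ≤ tl R := by
  constructor
  · refine Summable.of_nonneg_of_le (fun i => mul_nonneg (H.b_nonneg h0 h1 t i) (ind_nonneg _))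
      (fun i => mul_le_of_le_one_right (H.b_nonneg h0 h1 t i) (ind_le _)) (H.b_sum h0 h1 t)
  · refine le_trans (le_of_eq ?_) (H.F_tail ε h0 h1 t R hR)
    rw [← tsum_mul_left]
    refine tsum_congr (fun i => ?_)
    unfold b
    by_cases h : R < ε * i
    · simp [h, ind]
    · simp [h, ind]

lemma tl_nonneg (H : RbkFam K F M CK R1 tl) {R : ℝ} (hR : 1 ≤ R) : 0 ≤ tl R := by
  have h0 : (0:ℝ) < 1/2 := by norm_num
  have h1 : (1/2:ℝ) < 1 := by norm_num
  exact le_trans (tsum_nonneg (fun i => mul_nonneg (H.b_nonneg h0 h1 0 i) (ind_nonneg _)))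
    (H.bt_tsum h0 h1 0 hR).2

/-- Rate of collisions involving a particle larger than `R`. -/
lemma far_rate (H : RbkFam K F M CK R1 tl) {ε : ℝ} (h0 : 0 < ε) (h1 : ε < 1) (t : ℝ) {R : ℝ}
    (hR : R1 ≤ R) :
    ∑' p : ℕ × ℕ, rbkC K F ε p t * ind (R < ε * p.1 ∨ R < ε * p.2) ≤ 2 * CK * M * tl R := by
  have hR' : 1 ≤ R := H.R1_one.trans hR
  obtain ⟨s1, l1⟩ := H.bt_tsum h0 h1 t hR'
  have bn := H.b_nonneg h0 h1 t
  have bs := H.b_sum h0 h1 t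
  have btn : ∀ i : ℕ, 0 ≤ b F ε t i * ind (R < ε * i) := fun i => mul_nonneg (bn i) (ind_nonneg _)
  have sA := s1.mul_of_nonneg bs btn bn
  have sB := bs.mul_of_nonneg s1 bn btn
  have lA := prod_tsum_le s1 bs btn bn l1 (H.b_tsum h0 h1 t)
  have lB := prod_tsum_le bs s1 bn btn (H.b_tsum h0 h1 t) l1
  have hCK := H.CK_nonneg
  have key : ∀ p : ℕ × ℕ, rbkC K F ε p t * ind (R < ε * p.1 ∨ R < ε * p.2) ≤
      CK * (b F ε t p.1 * ind (R < ε * p.1) * b F ε t p.2 +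
      b F ε t p.1 * (b F ε t p.2 * ind (R < ε * p.2))) := by
    intro p
    by_cases hp : R < ε * p.1 ∨ R < ε * p.2
    · simp only [ind_pos hp, mul_one]
      refine (H.C_le h0 h1 (C := CK) (fun q1 q2 => ?_) hCK).trans ?_
      · refine H.K_big' _ _ (by positivity) (by positivity) ?_
        rcases hp with hp | hp
        · exact Or.inl (hR.trans hp.le)
        · exact Or.inr (hR.trans hp.le)
      · gcongr
        have := mul_nonneg (bn p.1) (bn p.2)
        have i1 := ind_nonneg (R < ε * p.1)
        have i2 := ind_nonneg (R < ε * p.2)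
        rcases hp with hp | hp
        · rw [ind_pos hp]; nlinarith
        · rw [ind_pos hp]; nlinarith
    · simp only [ind_neg hp, mul_zero]
      have := mul_nonneg (btn p.1) (bn p.2)
      have := mul_nonneg (bn p.1) (btn p.2)
      positivity
  have sL := H.CV_sum h0 h1 t (fun p => ind (R < ε * p.1 ∨ R < ε * p.2)) (fun p => ind_abs _)
  refine (Summable.tsum_le_tsum key sL ((sA.add sB).mul_left CK)).trans ?_
  rw [tsum_mul_left, Summable.tsum_add sA sB]
  have := mul_le_mul_of_nonneg_left (add_le_add lA lB) hCK
  refine this.trans (le_of_eq ?_)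
  ring

/-- Rate of collisions in a region where the kernel is bounded. -/
lemma reg_rate (H : RbkFam K F M CK R1 tl) {ε : ℝ} (h0 : 0 < ε) (h1 : ε < 1) (t : ℝ) {C : ℝ}
    (hC : 0 ≤ C) (P : ℕ × ℕ → Prop)
    (hP : ∀ p : ℕ × ℕ, P p → 0 < p.1 → 0 < p.2 → K (ε * p.1) (ε * p.2) ≤ C) :
    ∑' p : ℕ × ℕ, rbkC K F ε p t * ind (P p) ≤ C * (M * M) := by
  have lA := prod_tsum_le (H.b_sum h0 h1 t) (H.b_sum h0 h1 t)
      (H.b_nonneg h0 h1 t) (H.b_nonneg h0 h1 t) (H.b_tsum h0 h1 t) (H.b_tsum h0 h1 t)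
  have key : ∀ p : ℕ × ℕ, rbkC K F ε p t * ind (P p) ≤ C * (b F ε t p.1 * b F ε t p.2) := by
    intro p
    by_cases hp : P p
    · rw [ind_pos hp, mul_one]
      refine H.C_le h0 h1 (fun q1 q2 => (hP p hp q1 q2).trans ?_) hC
      have : 1 ≤ (1 + ε * (p.1:ℝ)) * (1 + ε * p.2) := by
        have : 0 ≤ ε * (p.1:ℝ) := by positivity
        have : 0 ≤ ε * (p.2:ℝ) := by positivity
        nlinarith
      nlinarith
    · rw [ind_neg hp, mul_zero]
      have := mul_nonneg (H.b_nonneg h0 h1 t p.1) (H.b_nonneg h0 h1 t p.2)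
      positivity
  have sL := H.CV_sum h0 h1 t (fun p => ind (P p)) (fun p => ind_abs _)
  refine (Summable.tsum_le_tsum key sL ((H.bb_sum h0 h1 t).mul_left C)).trans ?_
  rw [tsum_mul_left]
  exact mul_le_mul_of_nonneg_left lA hC

lemma num_le (H : RbkFam K F M CK R1 tl) {ε : ℝ} (h0 : 0 < ε) (h1 : ε < 1) (t : ℝ) (s : Finset ℕ) :
    ∑ i ∈ s, ε * F ε i t ≤ M := by
  refine le_trans (Finset.sum_le_sum (fun i _ => H.F_le_b h0 h1 t i)) ?_
  exact le_trans ((H.b_sum h0 h1 t).sum_le_tsum _ (fun i _ => H.b_nonneg h0 h1 t i)) (H.b_tsum h0 h1 t)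

/-- The total number of collisions on `[0,T]` is bounded uniformly in `ε`. -/
lemma dissip (H : RbkFam K F M CK R1 tl) {T : ℝ} (hT : 0 ≤ T) :
    ∃ D, 0 ≤ D ∧ ∀ ε, 0 < ε → ε < 1 → ∫ τ in (0:ℝ)..T, ∑' p, rbkC K F ε p τ ≤ D := by
  have hM := H.M_nonneg
  have hCK := H.CK_nonneg
  have htl := H.tl_nonneg H.R1_one
  refine ⟨2 * M + 2 * (T * (2 * CK * M * tl R1)), by positivity, fun ε h0 h1 => ?_⟩
  set m := ⌊R1 / ε⌋₊ with hm
  have hmi : ∀ i : ℕ, m < i ↔ R1 < ε * i := by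
    intro i
    rw [hm, Nat.floor_lt (by have := H.R1_one; positivity), div_lt_iff₀ h0, mul_comm]
  let ψ : ℕ → ℝ → ℝ := fun i _ => ind (1 ≤ i ∧ i ≤ m)
  have wf := H.weak_form h0 h1 m (fun i u => ind (1 ≤ i ∧ i ≤ m) * u) ψ
    (fun i u => by simpa [ψ] using (hasDerivAt_id u).const_mul (ind (1 ≤ i ∧ i ≤ m)))
    (fun i => measurable_const) (B := 1) (fun i u => ind_abs _) (fun u => ind_neg (by omega))
    (fun i hi u => ind_neg (by omega)) le_rfl hT
  have lhs : - M ≤ ∑ i ∈ Finset.range (m + 1), ε * (ind (1 ≤ i ∧ i ≤ m) * F ε i T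
      - ind (1 ≤ i ∧ i ≤ m) * F ε i 0) := by
    have := H.num_le h0 h1 0 (Finset.range (m+1))
    have h2 : ∑ i ∈ Finset.range (m + 1), (- (ε * F ε i 0)) ≤
      ∑ i ∈ Finset.range (m + 1), ε * (ind (1 ≤ i ∧ i ≤ m) * F ε i T
      - ind (1 ≤ i ∧ i ≤ m) * F ε i 0) := by
      refine Finset.sum_le_sum (fun i _ => ?_)
      have a1 := H.F_nonneg ε h0 h1 i T
      have a2 := H.F_nonneg ε h0 h1 i 0
      have a3 := ind_nonneg (1 ≤ i ∧ i ≤ m)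
      have a4 := ind_le (1 ≤ i ∧ i ≤ m)
      have : - (F ε i 0) ≤ ind (1 ≤ i ∧ i ≤ m) * F ε i T - ind (1 ≤ i ∧ i ≤ m) * F ε i 0 := by
        nlinarith [mul_nonneg a3 a1]
      nlinarith
    rw [Finset.sum_neg_distrib] at h2
    linarith
  have I1 : IntervalIntegrable (fun τ => ∑' p, rbkC K F ε p τ) volume 0 T := by
    have := H.CV_int h0 h1 (fun _ _ => 1) (B := 1) (fun _ _ => by simp) (fun _ => measurable_const) 0 T
    simpa using this
  have I2 : IntervalIntegrable (fun τ => ∑' p : ℕ × ℕ, rbkC K F ε p τ * ind (R1 < ε * p.1 ∨ R1 < ε * p.2))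
      volume 0 T :=
    H.CV_int h0 h1 (fun p _ => ind (R1 < ε * p.1 ∨ R1 < ε * p.2)) (B := 1)
      (fun _ _ => ind_abs _) (fun _ => measurable_const) 0 T
  have hV4 : ∀ p τ, |rbkV (fun i => ψ i (F ε i τ)) p| ≤ 4 := by
    intro p τ
    simp only [rbkV, ψ]
    have := ind_abs (1 ≤ p.1 - p.2 ∧ p.1 - p.2 ≤ m)
    have := ind_abs (1 ≤ p.2 - p.1 ∧ p.2 - p.1 ≤ m)
    have := ind_abs (1 ≤ p.1 ∧ p.1 ≤ m)
    have := ind_abs (1 ≤ p.2 ∧ p.2 ≤ m)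
    simp only [abs_le] at *
    constructor <;> linarith
  have I3 : IntervalIntegrable (fun τ => ∑' p, rbkC K F ε p τ * rbkV (fun i => ψ i (F ε i τ)) p) volume 0 T :=
    H.CV_int h0 h1 _ hV4 (fun p => (measurable_const : Measurable (fun _ : ℝ => rbkV (fun i => ind (1 ≤ i ∧ i ≤ m)) p))) 0 T
  have mono : ∫ τ in (0:ℝ)..T, (1/2) * ∑' p, rbkC K F ε p τ * rbkV (fun i => ψ i (F ε i τ)) p ≤
      ∫ τ in (0:ℝ)..T, (1/2) * (-(∑' p, rbkC K F ε p τ) + 2 * (2 * CK * M * tl R1)) := by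
    refine intervalIntegral.integral_mono_on hT (I3.const_mul _)
      ((I1.neg.add intervalIntegrable_const).const_mul _) (fun τ _ => ?_)
    have s1 := H.C_sum h0 h1 τ
    have s2 := H.CV_sum h0 h1 τ (fun p => ind (R1 < ε * p.1 ∨ R1 < ε * p.2)) (fun p => ind_abs _)
    have s3 := H.CV_sum h0 h1 τ _ (fun p => hV4 p τ)
    have := s3.tsum_le_tsum (g := fun p => - rbkC K F ε p τ + 2 * (rbkC K F ε p τ * ind (R1 < ε * p.1 ∨ R1 < ε * p.2)))
      (fun p => ?_) (s1.neg.add (s2.mul_left 2))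
    · rw [s1.neg.tsum_add (s2.mul_left 2), tsum_neg, tsum_mul_left] at this
      have := H.far_rate h0 h1 τ (le_refl R1)
      linarith
    · have cn := H.C_nonneg h0 h1 p τ
      rcases Nat.eq_zero_or_pos p.1 with h | h
      · simp [rbkC, h, H.F_zero]
      rcases Nat.eq_zero_or_pos p.2 with h' | h'
      · simp [rbkC, h', H.F_zero]
      have e1 : ind (1 ≤ p.1 - p.2 ∧ p.1 - p.2 ≤ m) + ind (1 ≤ p.2 - p.1 ∧ p.2 - p.1 ≤ m) ≤ 1 := by
        by_cases hq : p.1 ≤ p.2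
        · rw [ind_neg (P := 1 ≤ p.1 - p.2 ∧ p.1 - p.2 ≤ m) (by omega)]
          simpa using ind_le _
        · rw [ind_neg (P := 1 ≤ p.2 - p.1 ∧ p.2 - p.1 ≤ m) (by omega)]
          simpa using ind_le _
      by_cases hf : R1 < ε * p.1 ∨ R1 < ε * p.2
      · rw [ind_pos hf]
        have : rbkV (fun i => ψ i (F ε i τ)) p ≤ 1 := by
          simp only [rbkV, ψ]
          have := ind_nonneg (1 ≤ p.1 ∧ p.1 ≤ m)
          have := ind_nonneg (1 ≤ p.2 ∧ p.2 ≤ m)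
          linarith
        nlinarith
      · rw [ind_neg hf]
        rw [← hmi, ← hmi] at hf
        have : rbkV (fun i => ψ i (F ε i τ)) p ≤ -1 := by
          simp only [rbkV, ψ]
          rw [ind_pos (P := 1 ≤ p.1 ∧ p.1 ≤ m) (by omega), ind_pos (P := 1 ≤ p.2 ∧ p.2 ≤ m) (by omega)]
          linarith
        nlinarith
  have I1n : IntervalIntegrable (fun τ => -∑' p, rbkC K F ε p τ) volume 0 T := I1.neg
  rw [← wf, intervalIntegral.integral_const_mul, intervalIntegral.integral_add I1n intervalIntegrable_const,
    intervalIntegral.integral_neg, intervalIntegral.integral_const] at mono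
  simp only [sub_zero, smul_eq_mul] at mono
  linarith

end RbkFam
open MeasureTheory

namespace RbkFam

variable {K : ℝ → ℝ → ℝ} {F : ℝ → ℕ → ℝ → ℝ} {M CK R1 : ℝ} {tl : ℝ → ℝ}

/-- convolution type sums -/
lemma conv_hasSum {x y : ℕ → ℝ} (hx : Summable x) (hy : Summable y) (x0 : ∀ i, 0 ≤ x i)
    (y0 : ∀ i, 0 ≤ y i) (yz : y 0 = 0) :
    HasSum (fun p : ℕ × ℕ => x p.2 * y (p.1 - p.2)) ((∑' i, x i) * ∑' i, y i) := by
  have hinj : Function.Injective (fun q : ℕ × ℕ => ((q.1 + q.2, q.2) : ℕ × ℕ)) := by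
    rintro ⟨a, b⟩ ⟨a', b'⟩ hh
    simp only [Prod.mk.injEq] at hh ⊢
    omega
  rw [← hinj.hasSum_iff]
  · have hs := hy.mul_of_nonneg hx y0 x0
    have := hs.hasSum
    rw [← hy.tsum_mul_tsum hx hs] at this
    rw [mul_comm (∑' i, x i)]
    have e : ((fun p : ℕ × ℕ => x p.2 * y (p.1 - p.2)) ∘ fun q : ℕ × ℕ => ((q.1 + q.2, q.2) : ℕ × ℕ))
        = fun p : ℕ × ℕ => y p.1 * x p.2 := by
      funext q; simp [mul_comm]
    rw [e]; exact this
  · intro p hp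
    have : p.1 - p.2 = 0 := by
      by_contra h
      exact hp ⟨(p.1 - p.2, p.2), by ext <;> simp; omega⟩
    simp [this, yz]

lemma conv_hasSum' {x y : ℕ → ℝ} (hx : Summable x) (hy : Summable y) (x0 : ∀ i, 0 ≤ x i)
    (y0 : ∀ i, 0 ≤ y i) (yz : y 0 = 0) :
    HasSum (fun p : ℕ × ℕ => x p.1 * y (p.2 - p.1)) ((∑' i, x i) * ∑' i, y i) := by
  have := conv_hasSum hx hy x0 y0 yz
  rw [← (Equiv.prodComm ℕ ℕ).hasSum_iff] at this
  exact this

/-- truncated entropy -/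
noncomputable def phi (L u : ℝ) : ℝ := ((max (u - L) 0) ^ 2 - (max (u - 2 * L) 0) ^ 2) / (2 * L)

noncomputable def dphi (L u : ℝ) : ℝ := (max (u - L) 0 - max (u - 2 * L) 0) / L

lemma hasDerivAt_sqpos (a u : ℝ) : HasDerivAt (fun u => (max (u - a) 0) ^ 2) (2 * max (u - a) 0) u := by
  rcases lt_trichotomy u a with h | h | h
  · have : (fun u => (max (u - a) 0) ^ 2) =ᶠ[nhds u] fun _ => 0 := by
      filter_upwards [gt_mem_nhds h] with v hv
      rw [max_eq_right (by linarith)]; simp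
    rw [max_eq_right (by linarith), mul_zero]
    exact (hasDerivAt_const u (0:ℝ)).congr_of_eventuallyEq this
  · subst h
    simp only [sub_self, max_self, mul_zero]
    rw [hasDerivAt_iff_isLittleO]
    simp only [sub_self, max_self, smul_zero, sub_zero, ne_eq, OfNat.ofNat_ne_zero, not_false_eq_true,
      zero_pow]
    have : (fun x' => max (x' - u) 0 ^ 2) =O[nhds u] fun x' => (x' - u) ^ 2 := by
      refine Asymptotics.IsBigO.of_bound 1 (Filter.Eventually.of_forall (fun v => ?_))
      simp only [norm_pow, Real.norm_eq_abs, one_mul]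
      gcongr 1
      rcases le_total (v - u) 0 with h | h
      · rw [max_eq_right h]; simp
      · rw [max_eq_left h]
    refine this.trans_isLittleO ?_
    simpa [sq_abs] using Asymptotics.isLittleO_pow_sub_sub u (m := 2) (by norm_num)
  · have : (fun u => (max (u - a) 0) ^ 2) =ᶠ[nhds u] fun u => (u - a) ^ 2 := by
      filter_upwards [lt_mem_nhds h] with v hv
      rw [max_eq_left (by linarith)]
    rw [max_eq_left (by linarith)]
    refine HasDerivAt.congr_of_eventuallyEq ?_ this
    have := ((hasDerivAt_id u).sub_const a).fun_pow 2
    simpa using this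

lemma phi_deriv {L : ℝ} (hL : 0 < L) (u : ℝ) : HasDerivAt (phi L) (dphi L u) u := by
  have := ((hasDerivAt_sqpos L u).sub (hasDerivAt_sqpos (2 * L) u)).div_const (2 * L)
  refine this.congr_deriv ?_
  unfold dphi; field_simp

lemma dphi_nonneg {L : ℝ} (hL : 0 < L) (u : ℝ) : 0 ≤ dphi L u := by
  unfold dphi
  apply div_nonneg _ hL.le
  have : max (u - 2 * L) 0 ≤ max (u - L) 0 := max_le_max (by linarith) le_rfl
  linarith

lemma dphi_le {L : ℝ} (hL : 0 < L) (u : ℝ) : dphi L u ≤ 1 := by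
  unfold dphi
  rw [div_le_one hL]
  rcases le_total (u - L) 0 with h | h
  · rw [max_eq_right h]; linarith [le_max_right (u - 2 * L) 0]
  · rw [max_eq_left h]; linarith [le_max_left (u - 2 * L) 0]

lemma dphi_zero {L u : ℝ} (hL : 0 < L) (h : u ≤ L) : dphi L u = 0 := by
  unfold dphi
  rw [max_eq_right (by linarith), max_eq_right (by linarith)]; simp

lemma dphi_one {L u : ℝ} (hL : 0 < L) (h : 2 * L ≤ u) : dphi L u = 1 := by
  unfold dphi
  rw [max_eq_left (by linarith), max_eq_left (by linarith)]
  field_simp; ring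

lemma phi_ge {L : ℝ} (hL : 0 < L) (u : ℝ) : max (u - 2 * L) 0 ≤ phi L u := by
  unfold phi
  rw [le_div_iff₀ (by linarith)]
  rcases le_total (u - 2 * L) 0 with h | h
  · rw [max_eq_right h]; nlinarith [sq_nonneg (max (u - L) 0)]
  · rw [max_eq_left h, max_eq_left (by linarith)]; nlinarith

lemma phi_le {L : ℝ} (hL : 0 < L) (u : ℝ) : phi L u ≤ max (u - L) 0 := by
  unfold phi
  rw [div_le_iff₀ (by linarith)]
  rcases le_total (u - 2 * L) 0 with h | h
  · rw [max_eq_right h]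
    rcases le_total (u - L) 0 with h' | h'
    · rw [max_eq_right h']; simp
    · rw [max_eq_left h']; nlinarith
  · rw [max_eq_left h, max_eq_left (by linarith)]; nlinarith

lemma dphi_meas (L : ℝ) : Measurable (dphi L) := by unfold dphi; fun_prop

/-- counting cells near zero -/
lemma count_le {ε h1 : ℝ} (h0 : 0 < ε) (hh : 0 < h1) (m : ℕ) :
    ∑ i ∈ Finset.range m, ε * ind (1 ≤ i ∧ ε * (i : ℝ) < h1) ≤ h1 := by
  have e : ∀ i : ℕ, ind (1 ≤ i ∧ ε * (i : ℝ) < h1) ≤ if i ∈ Finset.Icc 1 ⌊h1 / ε⌋₊ then 1 else 0 := by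
    intro i
    by_cases h : 1 ≤ i ∧ ε * (i : ℝ) < h1
    · rw [ind_pos h, if_pos]
      rw [Finset.mem_Icc]
      refine ⟨h.1, Nat.le_floor ?_⟩
      rw [le_div_iff₀ h0]; linarith [h.2]
    · rw [ind_neg h]; split_ifs <;> norm_num
  rw [← Finset.mul_sum]
  have : ∑ i ∈ Finset.range m, ind (1 ≤ i ∧ ε * (i : ℝ) < h1) ≤ ⌊h1 / ε⌋₊ := by
    refine (Finset.sum_le_sum (fun i _ => e i)).trans ?_
    rw [Finset.sum_ite_mem]
    simp only [Finset.sum_const, mul_one, nsmul_eq_mul]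
    have := Finset.card_le_card (Finset.inter_subset_right (s₁ := Finset.range m) (s₂ := Finset.Icc 1 ⌊h1 / ε⌋₊))
    rw [Nat.card_Icc] at this
    have h2 : ⌊h1 / ε⌋₊ + 1 - 1 = ⌊h1 / ε⌋₊ := by omega
    rw [h2] at this
    exact_mod_cast this
  have h3 : (⌊h1 / ε⌋₊ : ℝ) ≤ h1 / ε := Nat.floor_le (by positivity)
  calc ε * ∑ i ∈ Finset.range m, ind (1 ≤ i ∧ ε * (i : ℝ) < h1) ≤ ε * (h1 / ε) := by
        gcongr; exact this.trans h3
    _ = h1 := by field_simp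


/-- the weight -/
noncomputable def wt (ε h1 R L : ℝ) (i : ℕ) (u : ℝ) : ℝ :=
  ind (1 ≤ i ∧ ε * (i : ℝ) < h1) + ind (h1 ≤ ε * (i : ℝ) ∧ ε * (i : ℝ) ≤ R) * dphi L u

noncomputable def Wt (ε h1 R L : ℝ) (i : ℕ) (u : ℝ) : ℝ :=
  ind (1 ≤ i ∧ ε * (i : ℝ) < h1) * u + ind (h1 ≤ ε * (i : ℝ) ∧ ε * (i : ℝ) ≤ R) * phi L u

lemma wt_near {ε h1 R L : ℝ} {i : ℕ} {u : ℝ} (hi : 1 ≤ i) (h : ε * (i : ℝ) < h1) :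
    wt ε h1 R L i u = 1 := by
  unfold wt; rw [ind_pos ⟨hi, h⟩, ind_neg (by rintro ⟨a, _⟩; linarith)]; simp

lemma wt_mid {ε h1 R L : ℝ} {i : ℕ} {u : ℝ} (h : h1 ≤ ε * (i : ℝ)) (h' : ε * (i : ℝ) ≤ R) :
    wt ε h1 R L i u = dphi L u := by
  unfold wt
  rw [ind_pos (P := h1 ≤ ε * (i : ℝ) ∧ ε * (i : ℝ) ≤ R) ⟨h, h'⟩, ind_neg (by rintro ⟨_, a⟩; linarith)]; simp

lemma wt_far {ε h1 R L : ℝ} {i : ℕ} {u : ℝ} (h' : R < ε * (i : ℝ)) (hR : h1 ≤ R) :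
    wt ε h1 R L i u = 0 := by
  unfold wt; rw [ind_neg (by rintro ⟨_, a⟩; linarith), ind_neg (by rintro ⟨_, a⟩; linarith)]; simp

lemma wt_zero {ε h1 R L : ℝ} {u : ℝ} (hh : 0 < h1) : wt ε h1 R L 0 u = 0 := by
  unfold wt; rw [ind_neg (by simp), ind_neg (by simp [hh])]; simp

lemma wt_bd {ε h1 R L : ℝ} (hL : 0 < L) (hh : 0 < h1) (hR : h1 ≤ R) (i : ℕ) (u : ℝ) :
    0 ≤ wt ε h1 R L i u ∧ wt ε h1 R L i u ≤ 1 := by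
  rcases Nat.eq_zero_or_pos i with h | h
  · subst h; rw [wt_zero hh]; simp
  rcases lt_or_ge (ε * (i : ℝ)) h1 with h' | h'
  · rw [wt_near h h']; simp
  rcases lt_or_ge R (ε * (i : ℝ)) with h'' | h''
  · rw [wt_far h'' hR]; simp
  · rw [wt_mid h' h'']; exact ⟨dphi_nonneg hL u, dphi_le hL u⟩

/-- relevant set of differences -/
noncomputable def ed (F : ℝ → ℕ → ℝ → ℝ) (ε h1 L : ℝ) (m : ℕ) (t : ℝ) (d : ℕ) : ℝ :=
  ε * ind (1 ≤ d ∧ ε * (d : ℝ) < h1) + if d ∈ Finset.range (m + 1) then ε * ind (L < F ε d t) else 0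

noncomputable def EL (F : ℝ → ℕ → ℝ → ℝ) (ε L : ℝ) (m : ℕ) (t : ℝ) : ℝ :=
  ∑ d ∈ Finset.range (m + 1), ε * ind (L < F ε d t)

lemma floor_iff {ε R : ℝ} (h0 : 0 < ε) (hR : 0 ≤ R) (i : ℕ) : ⌊R / ε⌋₊ < i ↔ R < ε * i := by
  rw [Nat.floor_lt (by positivity), div_lt_iff₀ h0, mul_comm]

lemma ed_hasSum (H : RbkFam K F M CK R1 tl) {ε : ℝ} (h0 : 0 < ε) {h1 L : ℝ} (hh : 0 < h1)
    (hL : 0 < L) (m : ℕ) (t : ℝ) : (∀ d, 0 ≤ ed F ε h1 L m t d) ∧ ed F ε h1 L m t 0 = 0 ∧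
      Summable (ed F ε h1 L m t) ∧ ∑' d, ed F ε h1 L m t d ≤ h1 + EL F ε L m t := by
  have n1 : ∀ d : ℕ, 0 ≤ ε * ind (1 ≤ d ∧ ε * (d : ℝ) < h1) := fun d => mul_nonneg h0.le (ind_nonneg _)
  have s1 : Summable (fun d : ℕ => ε * ind (1 ≤ d ∧ ε * (d : ℝ) < h1)) :=
    summable_of_sum_range_le n1 (fun m => count_le h0 hh m)
  have s2 := hasSum_sum_of_ne_finset_zero (L := SummationFilter.unconditional ℕ) (s := Finset.range (m+1))
    (f := fun d => if d ∈ Finset.range (m + 1) then ε * ind (L < F ε d t) else 0)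
    (fun d hd => if_neg hd)
  refine ⟨fun d => ?_, ?_, s1.add s2.summable, ?_⟩
  · unfold ed
    have := n1 d
    have := mul_nonneg h0.le (ind_nonneg (L < F ε d t))
    split_ifs <;> linarith
  · unfold ed
    rw [ind_neg (by simp), ind_neg (P := L < F ε 0 t) (by rw [H.F_zero]; linarith)]; simp
  · have : ∑' d, ed F ε h1 L m t d = _ := s1.tsum_add s2.summable
    rw [this, s2.tsum_eq]
    refine add_le_add (Real.tsum_le_of_sum_range_le n1 (fun m => count_le h0 hh m)) (le_of_eq ?_)
    exact Finset.sum_congr rfl (fun d hd => if_pos hd)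

/-- bound on the production of the weight functional -/
lemma UI_rate (H : RbkFam K F M CK R1 tl) {ε : ℝ} (h0 : 0 < ε) (h1 : ε < 1) (t : ℝ)
    {R h h' L C : ℝ} (hR : R1 ≤ R) (hh' : 0 < h') (hhh : h' ≤ h) (hhR : h ≤ R) (hL : 0 < L) (hC : 0 ≤ C)
    (hK : ∀ x y, h ≤ x → x ≤ R → h ≤ y → y ≤ R → K x y ≤ C) :
    ∑' p, rbkC K F ε p t * rbkV (fun i => wt ε h' R L i (F ε i t)) p ≤
      2 * CK * M * tl R +
      ∑' p : ℕ × ℕ, rbkC K F ε p t * ind (h' ≤ min (ε * (p.1:ℝ)) (ε * (p.2:ℝ)) ∧ min (ε * (p.1:ℝ)) (ε * (p.2:ℝ)) < h) +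
      4 * C * L * M * (h' + EL F ε L ⌊R / ε⌋₊ t) := by
  have hR0 : 0 ≤ R := by linarith
  have hfl := fun i => floor_iff h0 hR0 i
  set m := ⌊R / ε⌋₊ with hm
  set w := fun i => wt ε h' R L i (F ε i t) with hw
  obtain ⟨en, ez, es, el⟩ := H.ed_hasSum h0 hh' hL m t
  have wb : ∀ i, 0 ≤ w i ∧ w i ≤ 1 := fun i => wt_bd hL hh' (hhh.trans hhR) i _
  have w0 : w 0 = 0 := wt_zero hh'
  have we : ∀ i, ε * w i ≤ ed F ε h' L m t i := by
    intro i
    rcases Nat.eq_zero_or_pos i with hi | hi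
    · subst hi; rw [w0, ez]; simp
    have n1 := mul_nonneg h0.le (ind_nonneg (1 ≤ i ∧ ε * (i : ℝ) < h'))
    have n2 := mul_nonneg h0.le (ind_nonneg (L < F ε i t))
    rcases lt_or_ge (ε * (i : ℝ)) h' with hx | hx
    · simp only [hw]
      rw [wt_near hi hx]; unfold ed; rw [ind_pos ⟨hi, hx⟩]
      split_ifs <;> linarith
    rcases lt_or_ge R (ε * (i : ℝ)) with hy | hy
    · simp only [hw]
      rw [wt_far hy (hhh.trans hhR), mul_zero]; exact en i
    · simp only [hw]
      rw [wt_mid hx hy]; unfold ed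
      have : i ∈ Finset.range (m + 1) := by
        have : ¬ m < i := by rw [hfl]; linarith
        rw [Finset.mem_range]; omega
      rw [if_pos this]
      by_cases hF : L < F ε i t
      · rw [ind_pos hF]; nlinarith [dphi_le hL (F ε i t)]
      · rw [dphi_zero hL (not_lt.1 hF)]; linarith
  have Fn := fun i => H.F_nonneg ε h0 h1 i t
  have xs : Summable (fun i => ε * F ε i t) :=
    Summable.of_nonneg_of_le (fun i => mul_nonneg h0.le (Fn i)) (fun i => H.F_le_b h0 h1 t i) (H.b_sum h0 h1 t)
  have xM : ∑' i, ε * F ε i t ≤ M :=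
    (Summable.tsum_le_tsum (fun i => H.F_le_b h0 h1 t i) xs (H.b_sum h0 h1 t)).trans (H.b_tsum h0 h1 t)
  have xn : ∀ i, 0 ≤ ε * F ε i t := fun i => mul_nonneg h0.le (Fn i)
  have S1 := conv_hasSum xs es xn en ez
  have S2 := conv_hasSum' xs es xn en ez
  have hV4 : ∀ p, |rbkV w p| ≤ 4 := by
    intro p
    have a1 := wb (p.1 - p.2); have a2 := wb (p.2 - p.1); have a3 := wb p.1; have a4 := wb p.2
    unfold rbkV
    rw [abs_le]; constructor <;> linarith [a1.1, a1.2, a2.1, a2.2, a3.1, a3.2, a4.1, a4.2]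
  have sV := H.CV_sum h0 h1 t _ hV4
  have sF := H.CV_sum h0 h1 t (fun p => ind (R < ε * p.1 ∨ R < ε * p.2)) (fun p => ind_abs _)
  have sB := H.CV_sum h0 h1 t (fun p => ind (h' ≤ min (ε * (p.1:ℝ)) (ε * (p.2:ℝ)) ∧ min (ε * (p.1:ℝ)) (ε * (p.2:ℝ)) < h)) (fun p => ind_abs _)
  have sG := ((S1.add S2).mul_left (2 * C * L))
  have gen : ∀ j k : ℕ, 1 ≤ j → 1 ≤ k → h ≤ ε * j → ε * j ≤ R → h ≤ ε * k → ε * k ≤ R → j < k →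
      rbkC K F ε (j, k) t * (w (k - j) - w j - w k) ≤ 2 * C * L * (ε * F ε j t * ed F ε h' L m t (k - j)) := by
    intro j k hj hk a1 a2 a3 a4 hjk
    have rn : 0 ≤ 2 * C * L * (ε * F ε j t * ed F ε h' L m t (k - j)) := by
      have := xn j; have := en (k - j); positivity
    have cn := H.C_nonneg h0 h1 (j, k) t
    rcases le_or_gt (2 * L) (F ε k t) with hF | hF
    · have : w k = 1 := by
        simp only [hw]; rw [wt_mid (hhh.trans a3) a4, dphi_one hL hF]
      refine le_trans (mul_nonpos_of_nonneg_of_nonpos cn ?_) rn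
      linarith [(wb (k - j)).2, (wb j).1]
    · have c1 : rbkC K F ε (j, k) t ≤ ε * (ε * C * F ε j t * (2 * L)) := by
        unfold rbkC
        have := hK _ _ a1 a2 a3 a4
        have := Fn j; have := Fn k
        simp only
        gcongr
      calc rbkC K F ε (j, k) t * (w (k - j) - w j - w k) ≤ rbkC K F ε (j, k) t * w (k - j) := by
            apply mul_le_mul_of_nonneg_left _ cn
            linarith [(wb j).1, (wb k).1]
        _ ≤ ε * (ε * C * F ε j t * (2 * L)) * w (k - j) := mul_le_mul_of_nonneg_right c1 (wb _).1
        _ = 2 * C * L * (ε * F ε j t * (ε * w (k - j))) := by ring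
        _ ≤ _ := by
            have := we (k - j); have := xn j
            gcongr
  have key : ∀ p : ℕ × ℕ, rbkC K F ε p t * rbkV w p ≤
      rbkC K F ε p t * ind (R < ε * p.1 ∨ R < ε * p.2) +
      rbkC K F ε p t * ind (h' ≤ min (ε * (p.1:ℝ)) (ε * (p.2:ℝ)) ∧ min (ε * (p.1:ℝ)) (ε * (p.2:ℝ)) < h) +
      2 * C * L * (ε * F ε p.2 t * ed F ε h' L m t (p.1 - p.2) + ε * F ε p.1 t * ed F ε h' L m t (p.2 - p.1)) := by
    rintro ⟨j, k⟩
    have cn := H.C_nonneg h0 h1 (j, k) t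
    have g1 : 0 ≤ ε * F ε k t * ed F ε h' L m t (j - k) := mul_nonneg (xn k) (en _)
    have g2 : 0 ≤ ε * F ε j t * ed F ε h' L m t (k - j) := mul_nonneg (xn j) (en _)
    have g3 : 0 ≤ 2 * C * L * (ε * F ε k t * ed F ε h' L m t (j - k) + ε * F ε j t * ed F ε h' L m t (k - j)) := by
      positivity
    have i1 := mul_nonneg cn (ind_nonneg (R < ε * j ∨ R < ε * k))
    have i2 := mul_nonneg cn (ind_nonneg (h' ≤ min (ε * (j:ℝ)) (ε * (k:ℝ)) ∧ min (ε * (j:ℝ)) (ε * (k:ℝ)) < h))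
    simp only
    rcases Nat.eq_zero_or_pos j with hj | hj
    · have : rbkC K F ε (j, k) t = 0 := by simp [rbkC, hj, H.F_zero]
      rw [this]; simp; exact g3
    rcases Nat.eq_zero_or_pos k with hk | hk
    · have : rbkC K F ε (j, k) t = 0 := by simp [rbkC, hk, H.F_zero]
      rw [this]; simp; exact g3
    have d1 : w (j - k) + w (k - j) ≤ 1 := by
      rcases le_total j k with q | q
      · rw [Nat.sub_eq_zero_of_le q, w0]; linarith [(wb (k - j)).2]
      · rw [Nat.sub_eq_zero_of_le q, w0]; linarith [(wb (j - k)).2]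
    have V1 : rbkV w (j, k) ≤ 1 := by unfold rbkV; linarith [(wb j).1, (wb k).1]
    have V1' : rbkC K F ε (j, k) t * rbkV w (j, k) ≤ rbkC K F ε (j, k) t := by nlinarith
    by_cases c1 : R < ε * j ∨ R < ε * k
    · rw [ind_pos c1]; linarith
    by_cases c2 : h' ≤ min (ε * (j:ℝ)) (ε * (k:ℝ)) ∧ min (ε * (j:ℝ)) (ε * (k:ℝ)) < h
    · rw [ind_pos c2]; linarith
    push Not at c1
    by_cases c3 : min (ε * (j:ℝ)) (ε * (k:ℝ)) < h'
    · have : rbkV w (j, k) ≤ 0 := by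
        unfold rbkV
        rcases min_lt_iff.1 c3 with q | q
        · have : w j = 1 := wt_near hj q
          simp only; linarith [(wb k).1]
        · have : w k = 1 := wt_near hk q
          simp only; linarith [(wb j).1]
      linarith [mul_nonpos_of_nonneg_of_nonpos cn this]
    · have c4 : h ≤ min (ε * (j:ℝ)) (ε * (k:ℝ)) := by
        by_contra q; exact c2 ⟨not_lt.1 c3, not_le.1 q⟩
      have q1 := c4.trans (min_le_left _ _)
      have q2 := c4.trans (min_le_right _ _)
      have CL : 0 ≤ 2 * C * L := by positivity
      rcases lt_trichotomy j k with q | q | q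
      · have := gen j k hj hk q1 c1.1 q2 c1.2 q
        have e : rbkV w (j, k) = w (k - j) - w j - w k := by
          unfold rbkV; simp only [Nat.sub_eq_zero_of_le q.le, w0]; ring
        rw [e]; nlinarith
      · subst q
        have e : rbkV w (j, j) ≤ 0 := by
          unfold rbkV; simp only [Nat.sub_self, w0]; linarith [(wb j).1]
        linarith [mul_nonpos_of_nonneg_of_nonpos cn e]
      · have := gen k j hk hj q2 c1.2 q1 c1.1 q
        have e : rbkV w (j, k) = w (j - k) - w k - w j := by
          unfold rbkV; simp only [Nat.sub_eq_zero_of_le q.le, w0]; ring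
        have e2 : rbkC K F ε (j, k) t = rbkC K F ε (k, j) t := (H.C_symm h0 (j, k) t).symm
        rw [e2] at i1 i2 ⊢
        rw [e]; nlinarith
  refine (Summable.tsum_le_tsum key sV ((sF.add sB).add sG.summable)).trans ?_
  rw [Summable.tsum_add (sF.add sB) sG.summable, Summable.tsum_add sF sB, sG.tsum_eq]
  have f := H.far_rate h0 h1 t hR
  have xt : 0 ≤ ∑' d, ed F ε h' L m t d := tsum_nonneg en
  have hM := H.M_nonneg
  have : (∑' i, ε * F ε i t) * ∑' d, ed F ε h' L m t d ≤ M * (h' + EL F ε L m t) := by gcongr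
  have CL : 0 ≤ 2 * C * L := by positivity
  have := mul_le_mul_of_nonneg_left this CL
  linarith

end RbkFam
open MeasureTheory

namespace RbkFam

variable {K : ℝ → ℝ → ℝ} {F : ℝ → ℕ → ℝ → ℝ} {M CK R1 : ℝ} {tl : ℝ → ℝ}

/-- rate of collisions whose smaller partner lies in `[h', h)` -/
noncomputable def bandRate (K : ℝ → ℝ → ℝ) (F : ℝ → ℕ → ℝ → ℝ) (ε h' h t : ℝ) : ℝ :=
  ∑' p : ℕ × ℕ, rbkC K F ε p t *
    ind (h' ≤ min (ε * (p.1:ℝ)) (ε * (p.2:ℝ)) ∧ min (ε * (p.1:ℝ)) (ε * (p.2:ℝ)) < h)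

lemma band_int (H : RbkFam K F M CK R1 tl) {ε : ℝ} (h0 : 0 < ε) (h1 : ε < 1) (h' h s t : ℝ) :
    IntervalIntegrable (bandRate K F ε h' h) volume s t :=
  H.CV_int h0 h1 (fun p _ => ind (h' ≤ min (ε * (p.1:ℝ)) (ε * (p.2:ℝ)) ∧ min (ε * (p.1:ℝ)) (ε * (p.2:ℝ)) < h))
    (B := 1) (fun _ _ => ind_abs _) (fun _ => measurable_const) s t

lemma band_nonneg (H : RbkFam K F M CK R1 tl) {ε : ℝ} (h0 : 0 < ε) (h1 : ε < 1) (h' h t : ℝ) :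
    0 ≤ bandRate K F ε h' h t :=
  tsum_nonneg (fun p => mul_nonneg (H.C_nonneg h0 h1 p t) (ind_nonneg _))

lemma ind_meas {α : Type*} [MeasurableSpace α] {P : α → Prop} (h : MeasurableSet {x | P x}) :
    Measurable (fun x => ind (P x)) := by
  classical
  have : (fun x => ind (P x)) = {x | P x}.indicator (fun _ => (1:ℝ)) := by
    funext x
    by_cases hx : P x
    · rw [ind_pos hx, Set.indicator_of_mem (by exact hx)]
    · rw [ind_neg hx, Set.indicator_of_notMem (by exact hx)]
  rw [this]
  exact measurable_const.indicator h

lemma EL_meas (H : RbkFam K F M CK R1 tl) {ε : ℝ} (h0 : 0 < ε) (h1 : ε < 1) (L : ℝ) (m : ℕ) :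
    Measurable (EL F ε L m) := by
  unfold EL
  refine Finset.measurable_fun_sum _ (fun d _ => ?_)
  exact (ind_meas (measurableSet_lt measurable_const (H.F_cont ε h0 h1 d).measurable)).const_mul ε

lemma EL_nonneg {ε : ℝ} (h0 : 0 < ε) (L : ℝ) (m : ℕ) (t : ℝ) : 0 ≤ EL F ε L m t :=
  Finset.sum_nonneg (fun d _ => mul_nonneg h0.le (ind_nonneg _))

lemma EL_int (H : RbkFam K F M CK R1 tl) {ε : ℝ} (h0 : 0 < ε) (h1 : ε < 1) (L : ℝ) (m : ℕ) (s t : ℝ) :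
    IntervalIntegrable (EL F ε L m) volume s t := by
  refine (intervalIntegrable_const (c := ((m + 1 : ℕ) : ℝ) * ε)).mono_fun
    (H.EL_meas h0 h1 L m).aestronglyMeasurable ?_
  refine Filter.Eventually.of_forall (fun τ => ?_)
  beta_reduce
  rw [Real.norm_eq_abs, Real.norm_eq_abs, abs_of_nonneg (EL_nonneg h0 L m τ), abs_of_nonneg (by positivity)]
  unfold EL
  refine (Finset.sum_le_card_nsmul _ _ ε (fun d _ => ?_)).trans (by simp)
  exact mul_le_of_le_one_right h0.le (ind_le _)

lemma Wt_nonneg {ε h1 R L : ℝ} (hL : 0 < L) (i : ℕ) {u : ℝ} (hu : 0 ≤ u) : 0 ≤ Wt ε h1 R L i u := by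
  unfold Wt
  have := (le_max_right _ _).trans (phi_ge hL u)
  have := ind_nonneg (1 ≤ i ∧ ε * (i : ℝ) < h1)
  have := ind_nonneg (h1 ≤ ε * (i : ℝ) ∧ ε * (i : ℝ) ≤ R)
  positivity

lemma Wt_ge {ε h1 R L : ℝ} (hL : 0 < L) {i : ℕ} (hi : 1 ≤ i) (hx : ε * i ≤ R) {u : ℝ} (hu : 0 ≤ u) :
    max (u - 2 * L) 0 ≤ Wt ε h1 R L i u := by
  unfold Wt
  rcases lt_or_ge (ε * (i : ℝ)) h1 with h | h
  · rw [ind_pos ⟨hi, h⟩, ind_neg (by rintro ⟨a, _⟩; linarith)]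
    simp only [one_mul, zero_mul, add_zero]
    exact max_le (by linarith) hu
  · rw [ind_pos (P := h1 ≤ ε * (i : ℝ) ∧ ε * (i : ℝ) ≤ R) ⟨h, hx⟩, ind_neg (by rintro ⟨_, a⟩; linarith)]
    simpa using phi_ge hL u

lemma Wt_le {ε h1 R L L0 : ℝ} (hL : 0 < L) (hLL : L0 ≤ L) (i : ℕ) (u : ℝ) :
    Wt ε h1 R L i u ≤ max (u - L0) 0 + L0 * ind (1 ≤ i ∧ ε * (i : ℝ) < h1) := by
  unfold Wt
  by_cases h : 1 ≤ i ∧ ε * (i : ℝ) < h1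
  · rw [ind_pos h, ind_neg (by rintro ⟨a, _⟩; linarith [h.2])]
    linarith [le_max_left (u - L0) 0]
  · rw [ind_neg h]
    have := phi_le hL u
    have n := (le_max_right _ _).trans (phi_ge hL u)
    have a := ind_nonneg (h1 ≤ ε * (i : ℝ) ∧ ε * (i : ℝ) ≤ R)
    have b := ind_le (h1 ≤ ε * (i : ℝ) ∧ ε * (i : ℝ) ≤ R)
    have : max (u - L) 0 ≤ max (u - L0) 0 := max_le_max (by linarith) le_rfl
    nlinarith

lemma UI_step (H : RbkFam K F M CK R1 tl) {ε : ℝ} (h0 : 0 < ε) (h1 : ε < 1)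
    {T t R h h' L C L0 κ : ℝ} (ht : 0 ≤ t) (htT : t ≤ T)
    (hR : R1 ≤ R) (hh' : 0 < h') (hhh : h' ≤ h) (hhR : h ≤ R) (hL : 0 < L) (hC : 0 ≤ C)
    (hK : ∀ x y, h ≤ x → x ≤ R → h ≤ y → y ≤ R → K x y ≤ C) (hL0 : 0 < L0) (hLL : L0 ≤ L)
    (hinit : ∀ m : ℕ, ∑ i ∈ Finset.range m, ε * max (F ε i 0 - L0) 0 ≤ κ) (m' : ℕ) :
    ∑ i ∈ Finset.range m', ε * max (F ε i t - 2 * L) 0 ≤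
      tl R + κ + L0 * h' + (1/2) * (T * (2 * CK * M * tl R) + (∫ τ in (0:ℝ)..T, bandRate K F ε h' h τ) +
        4 * C * M * (T * (L * h') + L * ∫ τ in (0:ℝ)..T, EL F ε L ⌊R / ε⌋₊ τ)) := by
  have hR1 : 1 ≤ R := H.R1_one.trans hR
  have hR0 : 0 ≤ R := by linarith
  have hT : 0 ≤ T := ht.trans htT
  have hfl := fun i => floor_iff h0 hR0 i
  set m := ⌊R / ε⌋₊ with hm
  have hM := H.M_nonneg
  have hCK := H.CK_nonneg
  have htl := H.tl_nonneg hR1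
  have Fn := fun i t => H.F_nonneg ε h0 h1 i t
  have Wz : ∀ i, i ∉ Finset.range (m + 1) → ε * Wt ε h' R L i (F ε i t) = 0 := by
    intro i hi
    have : m < i := by simpa using hi
    rw [hfl] at this
    unfold Wt
    rw [ind_neg (by rintro ⟨_, a⟩; linarith), ind_neg (by rintro ⟨_, a⟩; linarith)]; simp
  have e1 : ∑ i ∈ Finset.range m', ε * max (F ε i t - 2 * L) 0 ≤
      tl R + ∑ i ∈ Finset.range (m + 1), ε * Wt ε h' R L i (F ε i t) := by
    obtain ⟨bs, bl⟩ := H.bt_tsum h0 h1 t hR1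
    have a1 : ∑ i ∈ Finset.range m', b F ε t i * ind (R < ε * i) ≤ tl R :=
      (bs.sum_le_tsum _ (fun i _ => mul_nonneg (H.b_nonneg h0 h1 t i) (ind_nonneg _))).trans bl
    have a2 : ∑ i ∈ Finset.range m', ε * Wt ε h' R L i (F ε i t) ≤
        ∑ i ∈ Finset.range (m + 1), ε * Wt ε h' R L i (F ε i t) :=
      sum_le_hasSum _ (fun i _ => mul_nonneg h0.le (Wt_nonneg hL i (Fn i t)))
        (hasSum_sum_of_ne_finset_zero (L := SummationFilter.unconditional ℕ) Wz)
    refine le_trans ?_ (add_le_add a1 a2)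
    rw [← Finset.sum_add_distrib]
    refine Finset.sum_le_sum (fun i _ => ?_)
    have w := mul_nonneg h0.le (Wt_nonneg (ε := ε) (h1 := h') (R := R) hL i (Fn i t))
    have bn := H.b_nonneg h0 h1 t i
    rcases Nat.eq_zero_or_pos i with hi | hi
    · subst hi
      rw [H.F_zero] at w ⊢
      rw [max_eq_right (by linarith)]
      have := mul_nonneg bn (ind_nonneg (R < ε * ((0:ℕ):ℝ)))
      linarith
    by_cases hx : R < ε * i
    · rw [ind_pos hx]
      have : max (F ε i t - 2 * L) 0 ≤ F ε i t := max_le (by linarith) (Fn i t)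
      have := mul_le_mul_of_nonneg_left this h0.le
      linarith [H.F_le_b h0 h1 t i]
    · rw [ind_neg hx, mul_zero, zero_add]
      exact mul_le_mul_of_nonneg_left (Wt_ge hL hi (not_lt.1 hx) (Fn i t)) h0.le
  have e2 : ∑ i ∈ Finset.range (m + 1), ε * Wt ε h' R L i (F ε i 0) ≤ κ + L0 * h' := by
    refine (Finset.sum_le_sum (fun i _ => mul_le_mul_of_nonneg_left
      (Wt_le (L0 := L0) hL hLL i (F ε i 0)) h0.le)).trans ?_
    simp only [mul_add]
    rw [Finset.sum_add_distrib]
    refine add_le_add (hinit _) ?_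
    have := mul_le_mul_of_nonneg_left (count_le h0 hh' (m + 1)) hL0.le
    rw [Finset.mul_sum] at this
    refine le_trans (le_of_eq ?_) this
    exact Finset.sum_congr rfl (fun i _ => by ring)
  have wf := H.weak_form h0 h1 m (fun i u => Wt ε h' R L i u) (fun i u => wt ε h' R L i u)
    (fun i u => by
      have := ((hasDerivAt_id u).const_mul (ind (1 ≤ i ∧ ε * (i : ℝ) < h'))).add
        ((phi_deriv hL u).const_mul (ind (h' ≤ ε * (i : ℝ) ∧ ε * (i : ℝ) ≤ R)))
      rw [mul_one] at this
      exact this)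
    (fun i => ((dphi_meas L).const_mul _).const_add _) (B := 1)
    (fun i u => by
      have := wt_bd (ε := ε) hL hh' (hhh.trans hhR) i u
      rw [abs_of_nonneg this.1]; exact this.2)
    (fun u => wt_zero hh') (fun i hi u => wt_far ((hfl i).1 hi) (hhh.trans hhR)) le_rfl ht
  have Ib := H.band_int h0 h1 h' h 0 T
  have Ie := H.EL_int h0 h1 L m 0 T
  have Ig : IntervalIntegrable (fun τ => (2 * CK * M * tl R + bandRate K F ε h' h τ) +
      4 * C * L * M * (h' + EL F ε L m τ)) volume 0 T :=
    (intervalIntegrable_const.add Ib).add ((intervalIntegrable_const.add Ie).const_mul _)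
  have hsub : Set.uIcc 0 t ⊆ Set.uIcc 0 T := by
    rw [Set.uIcc_of_le ht, Set.uIcc_of_le hT]; exact Set.Icc_subset_Icc le_rfl htT
  have gn : ∀ τ, 0 ≤ (2 * CK * M * tl R + bandRate K F ε h' h τ) +
      4 * C * L * M * (h' + EL F ε L m τ) := by
    intro τ
    have := H.band_nonneg h0 h1 h' h τ
    have := EL_nonneg (F := F) h0 L m τ
    positivity
  have hV4 : ∀ p τ, |rbkV (fun i => wt ε h' R L i (F ε i τ)) p| ≤ 4 := by
    intro p τ
    have wb : ∀ i, 0 ≤ wt ε h' R L i (F ε i τ) ∧ wt ε h' R L i (F ε i τ) ≤ 1 :=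
      fun i => wt_bd hL hh' (hhh.trans hhR) i _
    have a1 := wb (p.1 - p.2); have a2 := wb (p.2 - p.1); have a3 := wb p.1; have a4 := wb p.2
    unfold rbkV
    rw [abs_le]; constructor <;> linarith [a1.1, a1.2, a2.1, a2.2, a3.1, a3.2, a4.1, a4.2]
  have hwm : ∀ i, Measurable (fun τ => wt ε h' R L i (F ε i τ)) := fun i =>
    (((dphi_meas L).const_mul _).const_add _).comp (H.F_cont ε h0 h1 i).measurable
  have I3 := H.CV_int h0 h1 (fun p τ => rbkV (fun i => wt ε h' R L i (F ε i τ)) p) hV4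
    (fun p => (((hwm _).add (hwm _)).sub (hwm _)).sub (hwm _)) 0 t
  have mono : ∫ τ in (0:ℝ)..t, (1/2) * ∑' p, rbkC K F ε p τ * rbkV (fun i => wt ε h' R L i (F ε i τ)) p ≤
      ∫ τ in (0:ℝ)..t, (1/2) * ((2 * CK * M * tl R + bandRate K F ε h' h τ) +
      4 * C * L * M * (h' + EL F ε L m τ)) := by
    refine intervalIntegral.integral_mono_on ht (I3.const_mul _) ((Ig.mono_set hsub).const_mul _) (fun τ _ => ?_)
    exact mul_le_mul_of_nonneg_left (H.UI_rate h0 h1 τ hR hh' hhh hhR hL hC hK) (by norm_num)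
  have mono2 := intervalIntegral.integral_mono_interval (le_refl (0:ℝ)) ht htT
    (Filter.Eventually.of_forall (fun τ => mul_nonneg (by norm_num : (0:ℝ) ≤ 1/2) (gn τ))) (Ig.const_mul (1/2))
  have val : ∫ τ in (0:ℝ)..T, (1/2) * ((2 * CK * M * tl R + bandRate K F ε h' h τ) +
      4 * C * L * M * (h' + EL F ε L m τ)) =
      (1/2) * (T * (2 * CK * M * tl R) + (∫ τ in (0:ℝ)..T, bandRate K F ε h' h τ) +
        4 * C * M * (T * (L * h') + L * ∫ τ in (0:ℝ)..T, EL F ε L m τ)) := by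
    rw [intervalIntegral.integral_const_mul, intervalIntegral.integral_add (intervalIntegrable_const.add Ib)
      ((intervalIntegrable_const.add Ie).const_mul _), intervalIntegral.integral_add intervalIntegrable_const Ib,
      intervalIntegral.integral_const, intervalIntegral.integral_const_mul (4 * C * L * M),
      intervalIntegral.integral_add intervalIntegrable_const Ie, intervalIntegral.integral_const]
    simp only [sub_zero, smul_eq_mul]
    ring
  rw [val] at mono2
  have := wf.le.trans (mono.trans mono2)
  simp only [mul_sub] at this
  rw [Finset.sum_sub_distrib] at this
  linarith

lemma level_sum {L0 : ℝ} (hL0 : 0 < L0) {u : ℝ} (hu : 0 ≤ u) (N : ℕ) :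
    ∑ k ∈ Finset.range N, L0 * 2 ^ k * ind (L0 * 2 ^ k < u) ≤ 2 * u ∧
    ∑ k ∈ Finset.range N, L0 * 2 ^ k * ind (L0 * 2 ^ k < u) ≤ L0 * 2 ^ N := by
  induction N with
  | zero => simp; constructor <;> linarith
  | succ N ih =>
    rw [Finset.sum_range_succ]
    have p : 0 < L0 * 2 ^ N := by positivity
    rw [pow_succ]
    by_cases h : L0 * 2 ^ N < u
    · rw [ind_pos h]
      constructor <;> linarith [ih.2]
    · rw [ind_neg h]
      constructor <;> linarith [ih.1, ih.2]

lemma band_sum {hs : ℕ → ℝ} (hmono : ∀ n, hs (n + 1) ≤ hs n) (x : ℝ) (J : ℕ) :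
    ∑ n ∈ Finset.range J, ind (hs (n + 1) ≤ x ∧ x < hs n) ≤ ind (hs J ≤ x) := by
  induction J with
  | zero => simpa using ind_nonneg _
  | succ J ih =>
    rw [Finset.sum_range_succ]
    by_cases h : hs J ≤ x
    · rw [ind_pos h] at ih
      rw [ind_neg (P := hs (J + 1) ≤ x ∧ x < hs J) (by rintro ⟨_, a⟩; linarith),
        ind_pos (P := hs (J + 1) ≤ x) ((hmono J).trans h)]
      linarith
    · rw [ind_neg h] at ih
      by_cases h2 : hs (J + 1) ≤ x
      · rw [ind_pos h2]; linarith [ind_le (hs (J + 1) ≤ x ∧ x < hs J)]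
      · rw [ind_neg h2, ind_neg (P := hs (J + 1) ≤ x ∧ x < hs J) (by rintro ⟨a, _⟩; exact h2 a)]
        linarith

lemma pigeon {N : ℕ} (hN : 0 < N) {a : ℕ → ℝ} {B : ℝ} (h : ∑ k ∈ Finset.range N, a k ≤ B) :
    ∃ k < N, a k ≤ B / N := by
  have : ∑ k ∈ Finset.range N, a k ≤ ∑ k ∈ Finset.range N, B / N := by
    have : (0:ℝ) < N := by exact_mod_cast hN
    rw [Finset.sum_const, Finset.card_range, nsmul_eq_mul]
    refine h.trans (le_of_eq (by field_simp))
  obtain ⟨k, hk, hk'⟩ := Finset.exists_le_of_sum_le (Finset.nonempty_range_iff.2 hN.ne') this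
  exact ⟨k, Finset.mem_range.1 hk, hk'⟩

lemma level_pigeon (H : RbkFam K F M CK R1 tl) {ε : ℝ} (h0 : 0 < ε) (h1 : ε < 1) {T L0 : ℝ} (hT : 0 ≤ T)
    (hL0 : 0 < L0) (m : ℕ) {N : ℕ} (hN : 0 < N) :
    ∃ k < N, L0 * 2 ^ k * ∫ τ in (0:ℝ)..T, EL F ε (L0 * 2 ^ k) m τ ≤ (T * (2 * M)) / N := by
  apply pigeon hN
  simp_rw [← intervalIntegral.integral_const_mul]
  rw [← intervalIntegral.integral_finsetSum (fun k _ => (H.EL_int h0 h1 _ m 0 T).const_mul _)]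
  have : ∫ τ in (0:ℝ)..T, (2 * M) = T * (2 * M) := by simp; ring
  rw [← this]
  refine intervalIntegral.integral_mono_on hT ?_ intervalIntegrable_const (fun τ _ => ?_)
  · have := IntervalIntegrable.sum (Finset.range N) (fun k _ => (H.EL_int h0 h1 (L0 * 2 ^ k) m 0 T).const_mul (L0 * 2 ^ k))
    exact this.congr (fun τ _ => by simp)
  · unfold EL
    simp_rw [Finset.mul_sum]
    rw [Finset.sum_comm]
    have : ∑ i ∈ Finset.range (m+1), 2 * (ε * F ε i τ) ≤ 2 * M := by
      rw [← Finset.mul_sum]; linarith [H.num_le h0 h1 τ (Finset.range (m+1))]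
    refine le_trans (Finset.sum_le_sum (fun i _ => ?_)) this
    have := mul_le_mul_of_nonneg_left (level_sum hL0 (H.F_nonneg ε h0 h1 i τ) N).1 h0.le
    rw [Finset.mul_sum] at this
    refine le_trans (le_of_eq (Finset.sum_congr rfl (fun k _ => by ring))) (this.trans (by linarith))

lemma band_pigeon (H : RbkFam K F M CK R1 tl) {ε : ℝ} (h0 : 0 < ε) (h1 : ε < 1) {T D : ℝ} (hT : 0 ≤ T)
    (hD : ∫ τ in (0:ℝ)..T, ∑' p, rbkC K F ε p τ ≤ D) {hs : ℕ → ℝ} (hmono : ∀ n, hs (n + 1) ≤ hs n)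
    {J : ℕ} (hJ : 0 < J) :
    ∃ n < J, ∫ τ in (0:ℝ)..T, bandRate K F ε (hs (n + 1)) (hs n) τ ≤ D / J := by
  apply pigeon hJ
  rw [← intervalIntegral.integral_finsetSum (fun k _ => (H.band_int h0 h1 _ _ 0 T))]
  refine le_trans ?_ hD
  have I1 : IntervalIntegrable (fun τ => ∑' p, rbkC K F ε p τ) volume 0 T := by
    have := H.CV_int h0 h1 (fun _ _ => 1) (B := 1) (fun _ _ => by simp) (fun _ => measurable_const) 0 T
    simpa using this
  refine intervalIntegral.integral_mono_on hT ?_ I1 (fun τ _ => ?_)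
  · have := IntervalIntegrable.sum (Finset.range J) (fun k _ => (H.band_int h0 h1 (hs (k + 1)) (hs k) 0 T))
    exact this.congr (fun τ _ => by simp)
  · unfold bandRate
    have ss : ∀ n ∈ Finset.range J, Summable (fun p : ℕ × ℕ => rbkC K F ε p τ *
      ind (hs (n+1) ≤ min (ε * (p.1:ℝ)) (ε * (p.2:ℝ)) ∧ min (ε * (p.1:ℝ)) (ε * (p.2:ℝ)) < hs n)) :=
      fun n _ => H.CV_sum h0 h1 τ (fun p => _) (fun p => ind_abs _)
    rw [← Summable.tsum_finsetSum ss]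
    refine Summable.tsum_le_tsum (fun p => ?_) (summable_sum ss) (H.C_sum h0 h1 τ)
    rw [← Finset.mul_sum]
    exact mul_le_of_le_one_right (H.C_nonneg h0 h1 p τ) ((band_sum hmono _ J).trans (ind_le _))

/-- Uniform integrability, uniformly in `ε` and in time. -/
lemma UI (H : RbkFam K F M CK R1 tl) {T κ : ℝ} (hT : 0 ≤ T) (hκ : 0 < κ) :
    ∃ L, 0 < L ∧ ∀ ε, 0 < ε → ε < 1 → ∀ t, 0 ≤ t → t ≤ T → ∀ m : ℕ,
      ∑ i ∈ Finset.range m, ε * max (F ε i t - L) 0 ≤ κ := by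
  have hM := H.M_nonneg
  have hCK := H.CK_nonneg
  set η := κ / 10 with hη
  have hηp : 0 < η := by positivity
  obtain ⟨L0, hL0, hinit⟩ := H.init_UI η hηp
  -- choice of R
  obtain ⟨R, hR1, hRa, hRb⟩ : ∃ R, R1 ≤ R ∧ tl R ≤ η ∧ T * (2 * CK * M * tl R) ≤ η := by
    have l2 : Filter.Tendsto (fun R => T * (2 * CK * M * tl R)) Filter.atTop (nhds 0) := by
      have := (H.tl_lim.const_mul (2 * CK * M)).const_mul T
      simpa using this
    have := ((H.tl_lim.eventually_le_const hηp).and (l2.eventually_le_const hηp)).and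
      (Filter.eventually_ge_atTop R1)
    obtain ⟨R, h⟩ := this.exists
    exact ⟨R, h.2, h.1.1, h.1.2⟩
  have hR1' : 1 ≤ R := H.R1_one.trans hR1
  obtain ⟨D, hD, hdis⟩ := H.dissip hT
  have step : ∀ h : ℝ, 0 < h → ∃ h' Lm : ℝ, 0 < h' ∧ h' ≤ h ∧ 0 < Lm ∧ (h ≤ 1 → ∀ ε, 0 < ε → ε < 1 →
      ∀ t, 0 ≤ t → t ≤ T → ∀ m : ℕ, ∑ i ∈ Finset.range m, ε * max (F ε i t - Lm) 0 ≤
        5 * η + ∫ τ in (0:ℝ)..T, bandRate K F ε h' h τ) := by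
    intro h hh
    obtain ⟨C, hC, hK⟩ := H.K_loc (R := R) hh
    obtain ⟨N, hN⟩ := exists_nat_gt (4 * C * M * (T * (2 * M)) / η)
    have hN0 : 0 < N := by
      have : (0:ℝ) < N := lt_of_le_of_lt (by positivity) hN
      exact_mod_cast this
    have hN0' : (0:ℝ) < N := by exact_mod_cast hN0
    rw [div_lt_iff₀ hηp] at hN
    set Lm := L0 * 2 ^ N with hLm
    have hLmp : 0 < Lm := by positivity
    set h' := min h (min (η / L0) (η / (4 * C * M * (T * Lm) + 1))) with hh'
    have hden : 0 < 4 * C * M * (T * Lm) + 1 := by positivity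
    have p' : 0 < h' := by
      apply lt_min hh (lt_min (by positivity) (by positivity))
    refine ⟨h', 2 * Lm, p', min_le_left _ _, by positivity, ?_⟩
    intro hle ε h0 h1 t ht htT m
    obtain ⟨k, hk, hkl⟩ := H.level_pigeon h0 h1 hT hL0 ⌊R / ε⌋₊ hN0
    have hkLm : L0 * 2 ^ k ≤ Lm := by
      rw [hLm]; gcongr; norm_num
    have st := H.UI_step (L := L0 * 2 ^ k) h0 h1 ht htT hR1 p' (min_le_left _ _) (hle.trans hR1') (by positivity) hC hK hL0
      (by have : (1:ℝ) ≤ 2 ^ k := one_le_pow₀ (by norm_num)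
          nlinarith) (hinit ε h0 h1) m
    have m1 : ∑ i ∈ Finset.range m, ε * max (F ε i t - 2 * Lm) 0 ≤
        ∑ i ∈ Finset.range m, ε * max (F ε i t - 2 * (L0 * 2 ^ k)) 0 := by
      refine Finset.sum_le_sum (fun i _ => mul_le_mul_of_nonneg_left (max_le_max (by linarith) le_rfl) h0.le)
    have b1 : L0 * h' ≤ η := by
      have : h' ≤ η / L0 := (min_le_right _ _).trans (min_le_left _ _)
      rw [le_div_iff₀ hL0] at this; linarith
    have b2 : 4 * C * M * (T * (L0 * 2 ^ k * h')) ≤ η := by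
      have : h' ≤ η / (4 * C * M * (T * Lm) + 1) := (min_le_right _ _).trans (min_le_right _ _)
      rw [le_div_iff₀ hden] at this
      have q : 4 * C * M * (T * (L0 * 2 ^ k * h')) ≤ 4 * C * M * (T * (Lm * h')) := by gcongr
      nlinarith
    have b3 : 4 * C * M * (L0 * 2 ^ k * ∫ τ in (0:ℝ)..T, EL F ε (L0 * 2 ^ k) ⌊R / ε⌋₊ τ) ≤ η := by
      have q := mul_le_mul_of_nonneg_left hkl (by positivity : 0 ≤ 4 * C * M)
      refine q.trans ?_
      rw [← mul_div_assoc, div_le_iff₀ hN0']; linarith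
    have b4 : 0 ≤ ∫ τ in (0:ℝ)..T, bandRate K F ε h' h τ :=
      intervalIntegral.integral_nonneg hT (fun τ _ => H.band_nonneg h0 h1 h' h τ)
    rw [mul_add (4 * C * M)] at st
    linarith
  choose! nx Lm nx0 nxle Lm0 hstep using step
  let hs : ℕ → ℝ := fun n => nx^[n] 1
  have hs_succ : ∀ n, hs (n + 1) = nx (hs n) := fun n => Function.iterate_succ_apply' nx n 1
  have hs0 : ∀ n, 0 < hs n := by
    intro n
    induction n with
    | zero => exact one_pos
    | succ n ih => rw [hs_succ]; exact nx0 _ ih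
  have hsm : ∀ n, hs (n + 1) ≤ hs n := fun n => by rw [hs_succ]; exact nxle _ (hs0 n)
  have hs1 : ∀ n, hs n ≤ 1 := by
    intro n
    induction n with
    | zero => exact le_rfl
    | succ n ih => exact (hsm n).trans ih
  obtain ⟨J, hJ⟩ := exists_nat_gt (D / η)
  have hJ0' : (0:ℝ) < J := lt_of_le_of_lt (by positivity) hJ
  have hJ0 : 0 < J := by exact_mod_cast hJ0'
  rw [div_lt_iff₀ hηp] at hJ
  refine ⟨∑ n ∈ Finset.range J, Lm (hs n), Finset.sum_pos (fun n _ => Lm0 _ (hs0 n))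
    (Finset.nonempty_range_iff.2 hJ0.ne'), ?_⟩
  intro ε h0 h1 t ht htT m
  obtain ⟨n, hn, hb⟩ := H.band_pigeon h0 h1 hT (hdis ε h0 h1) hsm hJ0
  have st := hstep (hs n) (hs0 n) (hs1 n) ε h0 h1 t ht htT m
  rw [← hs_succ] at st
  have hle : Lm (hs n) ≤ ∑ n ∈ Finset.range J, Lm (hs n) :=
    Finset.single_le_sum (fun i _ => (Lm0 _ (hs0 i)).le) (Finset.mem_range.2 hn)
  have m1 : ∑ i ∈ Finset.range m, ε * max (F ε i t - ∑ n ∈ Finset.range J, Lm (hs n)) 0 ≤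
      ∑ i ∈ Finset.range m, ε * max (F ε i t - Lm (hs n)) 0 :=
    Finset.sum_le_sum (fun i _ => mul_le_mul_of_nonneg_left (max_le_max (by linarith) le_rfl) h0.le)
  have : D / J ≤ η := by rw [div_le_iff₀ hJ0']; linarith
  linarith

end RbkFam
open MeasureTheory

/-- test functions: continuous, compactly supported in `(0,∞)` -/
def IsTF (φ : ℝ → ℝ) : Prop :=
  Continuous φ ∧ ∃ a b, 0 < a ∧ (∀ x, x ≤ a → φ x = 0) ∧ (∀ x, b ≤ x → φ x = 0)

/-- symmetrised variation -/
def vphi (φ : ℝ → ℝ) (x y : ℝ) : ℝ := φ |x - y| - φ x - φ y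

lemma IsTF.compact {φ : ℝ → ℝ} (h : IsTF φ) : HasCompactSupport φ := by
  obtain ⟨_, a, b, _, h1, h2⟩ := h
  refine HasCompactSupport.intro (isCompact_Icc (a := a) (b := b)) (fun x hx => ?_)
  by_cases h : x ≤ a
  · exact h1 x h
  · apply h2; by_contra h3
    exact hx ⟨by linarith, by linarith⟩

lemma IsTF.bdd {φ : ℝ → ℝ} (h : IsTF φ) : ∃ B, 0 ≤ B ∧ ∀ x, |φ x| ≤ B := by
  obtain ⟨C, hC⟩ := h.compact.exists_bound_of_continuous h.1
  exact ⟨C, (norm_nonneg _).trans (hC 0), hC⟩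

lemma IsTF.zero {φ : ℝ → ℝ} (h : IsTF φ) : φ 0 = 0 := by
  obtain ⟨_, a, b, h0, h1, h2⟩ := h
  exact h1 0 h0.le

lemma IsTF.unif {φ : ℝ → ℝ} (h : IsTF φ) {η : ℝ} (hη : 0 < η) :
    ∃ δ, 0 < δ ∧ ∀ x y, |x - y| < δ → |φ x - φ y| ≤ η := by
  have := h.compact.uniformContinuous_of_continuous h.1
  obtain ⟨δ, h1, h2⟩ := Metric.uniformContinuous_iff.1 this η hη
  exact ⟨δ, h1, fun x y hxy => (h2 hxy).le⟩

lemma IsTF.small {φ : ℝ → ℝ} (h : IsTF φ) {η : ℝ} (hη : 0 < η) :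
    ∃ δ, 0 < δ ∧ ∀ x y, 0 < x → 0 < y → min x y < δ → |vphi φ x y| ≤ η := by
  obtain ⟨δ, h1, h2⟩ := h.unif hη
  obtain ⟨_, a, b, h0, ha, _⟩ := h
  refine ⟨min δ a, lt_min h1 h0, fun x y hx hy hxy => ?_⟩
  have gen : ∀ x y, 0 < x → y < min δ a → 0 < y → y ≤ x → |φ |x - y| - φ x - φ y| ≤ η := by
    intro x y hx hy hy0 hyx
    rw [ha y (hy.le.trans (min_le_right _ _)), sub_zero, abs_of_nonneg (by linarith : 0 ≤ x - y)]
    apply h2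
    have := hy.trans_le (min_le_left _ _)
    rw [abs_lt]; constructor <;> linarith
  unfold vphi
  rcases le_total x y with q | q
  · rw [min_eq_left q] at hxy
    have := gen y x hy hxy hx q
    rw [abs_sub_comm x y]
    rwa [sub_right_comm] at this
  · rw [min_eq_right q] at hxy
    exact gen x y hx hxy hy q

lemma vphi_bdd {φ : ℝ → ℝ} {B : ℝ} (h : ∀ x, |φ x| ≤ B) (x y : ℝ) : |vphi φ x y| ≤ 3 * B := by
  unfold vphi
  have a1 := abs_le.1 (h |x - y|); have a2 := abs_le.1 (h x); have a3 := abs_le.1 (h y)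
  rw [abs_le]; constructor <;> linarith [a1.1, a1.2, a2.1, a2.2, a3.1, a3.2]

lemma rbkV_eq {φ : ℝ → ℝ} (h : φ 0 = 0) {ε : ℝ} (h0 : 0 < ε) (p : ℕ × ℕ) :
    rbkV (fun i => φ (ε * (i : ℝ))) p = vphi φ (ε * p.1) (ε * p.2) := by
  obtain ⟨j, k⟩ := p
  unfold rbkV vphi
  simp only
  rcases le_total j k with q | q
  · have e : |ε * (j:ℝ) - ε * k| = ε * ((k - j : ℕ) : ℝ) := by
      have : (j:ℝ) ≤ k := by exact_mod_cast q
      rw [Nat.cast_sub q, abs_of_nonpos (by nlinarith)]; ring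
    rw [e, Nat.sub_eq_zero_of_le q]; simp [h]
  · have e : |ε * (j:ℝ) - ε * k| = ε * ((j - k : ℕ) : ℝ) := by
      have : (k:ℝ) ≤ j := by exact_mod_cast q
      rw [Nat.cast_sub q, abs_of_nonneg (by nlinarith)]; ring
    rw [e, Nat.sub_eq_zero_of_le q]; simp [h]

/-- discrete moments -/
noncomputable def Lam (F : ℝ → ℕ → ℝ → ℝ) (ε : ℝ) (φ : ℝ → ℝ) (t : ℝ) : ℝ :=
  ∑' i : ℕ, ε * F ε i t * φ (ε * (i : ℝ))

namespace RbkFam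

variable {K : ℝ → ℝ → ℝ} {F : ℝ → ℕ → ℝ → ℝ} {M CK R1 : ℝ} {tl : ℝ → ℝ}

lemma weak_lin (H : RbkFam K F M CK R1 tl) {ε : ℝ} (h0 : 0 < ε) (h1 : ε < 1) {φ : ℝ → ℝ} (hφ : IsTF φ)
    {s t : ℝ} (hs : 0 ≤ s) (hst : s ≤ t) :
    Lam F ε φ t - Lam F ε φ s =
      ∫ τ in s..t, (1/2) * ∑' p : ℕ × ℕ, rbkC K F ε p τ * vphi φ (ε * p.1) (ε * p.2) := by
  obtain ⟨B, hB, hφB⟩ := hφ.bdd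
  have hz := hφ.zero
  obtain ⟨hc, a, b, ha0, ha, hb⟩ := hφ
  set m := ⌊max b 0 / ε⌋₊ with hm
  have hmi : ∀ i : ℕ, m < i → φ (ε * i) = 0 := by
    intro i hi
    rw [hm, floor_iff h0 (le_max_right _ _)] at hi
    exact hb _ ((le_max_left _ _).trans hi.le)
  have hL : ∀ t, Lam F ε φ t = ∑ i ∈ Finset.range (m + 1), ε * (φ (ε * (i:ℝ)) * F ε i t) := by
    intro t
    unfold Lam
    rw [tsum_eq_sum (s := Finset.range (m + 1))]
    · exact Finset.sum_congr rfl (fun i _ => by ring)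
    · intro i hi
      rw [hmi i (by simpa using hi), mul_zero]
  have := H.weak_form h0 h1 m (fun i u => φ (ε * (i:ℝ)) * u) (fun i _ => φ (ε * (i:ℝ)))
    (fun i u => by simpa using (hasDerivAt_id u).const_mul (φ (ε * (i:ℝ))))
    (fun i => measurable_const) (fun i u => hφB _) (fun u => by simpa using hz) (fun i hi u => hmi i hi) hs hst
  simp only [rbkV_eq hz h0] at this
  rw [← this, hL, hL, ← Finset.sum_sub_distrib]
  exact Finset.sum_congr rfl (fun i _ => by ring)

lemma tot_int (H : RbkFam K F M CK R1 tl) {ε : ℝ} (h0 : 0 < ε) (h1 : ε < 1) (s t : ℝ) :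
    IntervalIntegrable (fun τ => ∑' p, rbkC K F ε p τ) volume s t := by
  have := H.CV_int h0 h1 (fun _ _ => 1) (B := 1) (fun _ _ => by simp) (fun _ => measurable_const) s t
  simpa using this

lemma tot_nonneg (H : RbkFam K F M CK R1 tl) {ε : ℝ} (h0 : 0 < ε) (h1 : ε < 1) (τ : ℝ) :
    0 ≤ ∑' p, rbkC K F ε p τ := tsum_nonneg (fun p => H.C_nonneg h0 h1 p τ)

lemma tot_sub (H : RbkFam K F M CK R1 tl) {ε : ℝ} (h0 : 0 < ε) (h1 : ε < 1) {s t T : ℝ} (hs : 0 ≤ s) (hst : s ≤ t)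
    (htT : t ≤ T) : ∫ τ in s..t, ∑' p, rbkC K F ε p τ ≤ ∫ τ in (0:ℝ)..T, ∑' p, rbkC K F ε p τ :=
  intervalIntegral.integral_mono_interval hs hst htT
    (Filter.Eventually.of_forall (fun τ => H.tot_nonneg h0 h1 τ)) (H.tot_int h0 h1 0 T)

/-- rate bound for collisions weighted by `g`, which is small when one particle is small -/
lemma rate_split (H : RbkFam K F M CK R1 tl) {ε : ℝ} (h0 : 0 < ε) (h1 : ε < 1) (τ : ℝ)
    {g : ℕ × ℕ → ℝ} {B η h R C : ℝ} (hg : ∀ p, |g p| ≤ B) (hη : 0 ≤ η) (hB : 0 ≤ B)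
    (hR : R1 ≤ R) (hC : 0 ≤ C)
    (hgs : ∀ p : ℕ × ℕ, 0 < p.1 → 0 < p.2 → min (ε * (p.1:ℝ)) (ε * (p.2:ℝ)) < h → |g p| ≤ η)
    (hgC : ∀ p : ℕ × ℕ, 0 < p.1 → 0 < p.2 → h ≤ ε * (p.1:ℝ) → h ≤ ε * (p.2:ℝ) → ε * (p.1:ℝ) ≤ R → ε * (p.2:ℝ) ≤ R →
      rbkC K F ε p τ * |g p| ≤ C * (b F ε τ p.1 * b F ε τ p.2)) :
    |∑' p, rbkC K F ε p τ * g p| ≤ η * (∑' p, rbkC K F ε p τ) + B * (2 * CK * M * tl R) + C * (M * M) := by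
  have s1 := H.C_sum h0 h1 τ
  have s2 := H.CV_sum h0 h1 τ (fun p => ind (R < ε * p.1 ∨ R < ε * p.2)) (fun p => ind_abs _)
  have s3 := H.bb_sum h0 h1 τ
  have key : ∀ p : ℕ × ℕ, ‖rbkC K F ε p τ * g p‖ ≤ η * rbkC K F ε p τ +
      B * (rbkC K F ε p τ * ind (R < ε * p.1 ∨ R < ε * p.2)) + C * (b F ε τ p.1 * b F ε τ p.2) := by
    intro p
    have cn := H.C_nonneg h0 h1 p τ
    have bn := mul_nonneg (H.b_nonneg h0 h1 τ p.1) (H.b_nonneg h0 h1 τ p.2)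
    have t1 := mul_nonneg hη cn
    have t2 := mul_nonneg hB (mul_nonneg cn (ind_nonneg (R < ε * p.1 ∨ R < ε * p.2)))
    have t3 := mul_nonneg hC bn
    rw [norm_mul, Real.norm_eq_abs, Real.norm_eq_abs, abs_of_nonneg cn]
    rcases Nat.eq_zero_or_pos p.1 with hj | hj
    · have : rbkC K F ε p τ = 0 := by simp [rbkC, hj, H.F_zero]
      rw [this, zero_mul]; rw [this] at t1 t2; linarith
    rcases Nat.eq_zero_or_pos p.2 with hk | hk
    · have : rbkC K F ε p τ = 0 := by simp [rbkC, hk, H.F_zero]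
      rw [this, zero_mul]; rw [this] at t1 t2; linarith
    by_cases c1 : R < ε * p.1 ∨ R < ε * p.2
    · rw [ind_pos c1] at t2 ⊢
      have := mul_le_mul_of_nonneg_left (hg p) cn
      linarith
    by_cases c2 : min (ε * (p.1:ℝ)) (ε * (p.2:ℝ)) < h
    · have := mul_le_mul_of_nonneg_left (hgs p hj hk c2) cn
      linarith
    · push Not at c1
      rw [not_lt] at c2
      have := hgC p hj hk (c2.trans (min_le_left _ _)) (c2.trans (min_le_right _ _)) c1.1 c1.2
      linarith
  have hs := ((s1.mul_left η).add (s2.mul_left B)).add (s3.mul_left C)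
  have := tsum_of_norm_bounded hs.hasSum key
  rw [Real.norm_eq_abs] at this
  refine this.trans ?_
  rw [Summable.tsum_add ((s1.mul_left η).add (s2.mul_left B)) (s3.mul_left C),
    Summable.tsum_add (s1.mul_left η) (s2.mul_left B), tsum_mul_left, tsum_mul_left, tsum_mul_left]
  have f := mul_le_mul_of_nonneg_left (H.far_rate h0 h1 τ hR) hB
  have q := mul_le_mul_of_nonneg_left (prod_tsum_le (H.b_sum h0 h1 τ) (H.b_sum h0 h1 τ)
    (H.b_nonneg h0 h1 τ) (H.b_nonneg h0 h1 τ) (H.b_tsum h0 h1 τ) (H.b_tsum h0 h1 τ)) hC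
  linarith

lemma C_reg (H : RbkFam K F M CK R1 tl) {ε : ℝ} (h0 : 0 < ε) (h1 : ε < 1) (τ : ℝ) {C : ℝ} (hC : 0 ≤ C)
    {p : ℕ × ℕ} (hK : K (ε * p.1) (ε * p.2) ≤ C) :
    rbkC K F ε p τ ≤ C * (b F ε τ p.1 * b F ε τ p.2) := by
  refine H.C_le h0 h1 (fun q1 q2 => hK.trans ?_) hC
  have : 1 ≤ (1 + ε * (p.1:ℝ)) * (1 + ε * p.2) := by
    have : 0 ≤ ε * (p.1:ℝ) := by positivity
    have : 0 ≤ ε * (p.2:ℝ) := by positivity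
    nlinarith
  nlinarith

/-- Equicontinuity in time of the discrete moments. -/
lemma equicont (H : RbkFam K F M CK R1 tl) {φ : ℝ → ℝ} (hφ : IsTF φ) {T κ : ℝ} (hT : 0 ≤ T) (hκ : 0 < κ) :
    ∃ δ, 0 < δ ∧ ∀ ε, 0 < ε → ε < 1 → ∀ s t, 0 ≤ s → s ≤ t → t ≤ T → t - s ≤ δ →
      |Lam F ε φ t - Lam F ε φ s| ≤ κ := by
  obtain ⟨D, hD, hdis⟩ := H.dissip hT
  obtain ⟨B, hB, hφB⟩ := hφ.bdd
  have hM := H.M_nonneg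
  have hCK := H.CK_nonneg
  have htl := H.tl_nonneg H.R1_one
  set η := κ / (D + 1) with hη
  have hηp : 0 < η := by positivity
  obtain ⟨h, hh, hs⟩ := hφ.small hηp
  obtain ⟨C, hC, hK⟩ := H.K_loc (R := R1) hh
  set A := 3 * B * (2 * CK * M * tl R1) + C * (3 * B) * (M * M) with hA
  have hAp : 0 ≤ A := by positivity
  refine ⟨κ / (A + 1), by positivity, fun ε h0 h1 s t hs0 hst htT hd => ?_⟩
  rw [H.weak_lin h0 h1 hφ hs0 hst]
  have hpt : ∀ τ, ‖(1/2) * ∑' p : ℕ × ℕ, rbkC K F ε p τ * vphi φ (ε * p.1) (ε * p.2)‖ ≤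
      (1/2) * (η * (∑' p, rbkC K F ε p τ) + A) := by
    intro τ
    rw [norm_mul, Real.norm_eq_abs, Real.norm_eq_abs, abs_of_pos (by norm_num : (0:ℝ) < 1/2)]
    have := H.rate_split h0 h1 τ (g := fun p => vphi φ (ε * p.1) (ε * p.2)) (B := 3 * B) (η := η) (h := h)
      (R := R1) (C := C * (3 * B)) (fun p => vphi_bdd hφB _ _) hηp.le (by positivity) le_rfl (by positivity)
      (fun p q1 q2 hm => hs _ _ (by positivity) (by positivity) hm)
      (fun p q1 q2 a1 a2 a3 a4 => by
        have c := H.C_reg h0 h1 τ hC (hK _ _ a1 a3 a2 a4)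
        have v := vphi_bdd hφB (ε * p.1) (ε * p.2)
        have bn := mul_nonneg (H.b_nonneg h0 h1 τ p.1) (H.b_nonneg h0 h1 τ p.2)
        calc rbkC K F ε p τ * |vphi φ (ε * p.1) (ε * p.2)| ≤ (C * (b F ε τ p.1 * b F ε τ p.2)) * (3 * B) :=
              mul_le_mul c v (abs_nonneg _) (by positivity)
          _ = _ := by ring)
    apply mul_le_mul_of_nonneg_left _ (by norm_num)
    linarith
  have I := H.tot_int h0 h1 s t
  have := intervalIntegral.norm_integral_le_of_norm_le hst
    (Filter.Eventually.of_forall (fun τ _ => hpt τ)) (((I.const_mul η).add intervalIntegrable_const).const_mul (1/2))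
  rw [Real.norm_eq_abs] at this
  refine this.trans ?_
  rw [intervalIntegral.integral_const_mul, intervalIntegral.integral_add (I.const_mul η) intervalIntegrable_const,
    intervalIntegral.integral_const_mul, intervalIntegral.integral_const, smul_eq_mul]
  have d1 := (H.tot_sub h0 h1 hs0 hst htT).trans (hdis ε h0 h1)
  have d2 : η * ∫ τ in s..t, ∑' p, rbkC K F ε p τ ≤ κ := by
    calc η * ∫ τ in s..t, ∑' p, rbkC K F ε p τ ≤ η * (D + 1) := by gcongr; linarith
      _ = κ := by rw [hη]; field_simp
  have d3 : (t - s) * A ≤ κ := by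
    calc (t - s) * A ≤ (κ / (A + 1)) * (A + 1) := by gcongr; linarith
      _ = κ := by field_simp
  linarith

end RbkFam
open MeasureTheory

/-- Index of the cell containing `x`. -/
noncomputable def idx (ε x : ℝ) : ℕ := ⌊x / ε + 1 / 2⌋₊

lemma idx_iff {ε x : ℝ} (hε : 0 < ε) (hx : 0 < x) (i : ℕ) :
    idx ε x = i ↔ ((i : ℝ) - 1 / 2) * ε ≤ x ∧ x < ((i : ℝ) + 1 / 2) * ε := by
  unfold idx
  rw [Nat.floor_eq_iff (by positivity)]
  have h1 : (i : ℝ) ≤ x / ε + 1 / 2 ↔ ((i : ℝ) - 1 / 2) * ε ≤ x := by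
    rw [← le_div_iff₀ hε]; constructor <;> intro h <;> linarith
  have h2 : x / ε + 1 / 2 < (i : ℝ) + 1 ↔ x < ((i : ℝ) + 1 / 2) * ε := by
    rw [← div_lt_iff₀ hε]; constructor <;> intro h <;> linarith
  rw [h1, h2]

lemma idx_meas (ε : ℝ) : Measurable (idx ε) := by
  unfold idx
  exact Nat.measurable_floor.comp (by fun_prop)

lemma idx_close {ε x : ℝ} (hε : 0 < ε) (hx : 0 < x) : |ε * (idx ε x : ℝ) - x| ≤ ε / 2 := by
  obtain ⟨h1, h2⟩ := (idx_iff hε hx (idx ε x)).1 rfl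
  rw [abs_le]; constructor <;> nlinarith

lemma stepFn_eq {ε x : ℝ} (hε : 0 < ε) (hx : 0 < x) (g : ℕ → ℝ) :
    stepFn ε g x = if idx ε x = 0 then 0 else g (idx ε x) := by
  unfold stepFn
  have hc : ∀ i : ℕ, x ∈ cell ε i ↔ idx ε x = i := by
    intro i; rw [idx_iff hε hx]; rfl
  split_ifs with h
  · rw [show (0:ℝ) = ∑' i : ℕ, (0:ℝ) by simp]
    congr 1; ext i
    rw [Set.indicator_of_notMem, mul_zero]
    rw [hc]; omega
  · rw [tsum_eq_single (idx ε x - 1)]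
    · have : idx ε x - 1 + 1 = idx ε x := by omega
      rw [this, Set.indicator_of_mem, mul_one]
      rw [hc]
    · intro j hj
      rw [Set.indicator_of_notMem, mul_zero]
      rw [hc]; omega

lemma idx_vol {ε : ℝ} (hε : 0 < ε) {i : ℕ} (hi : 1 ≤ i) :
    (volume.restrict (Set.Ioi (0:ℝ))).map (idx ε) {i} = ENNReal.ofReal ε := by
  rw [Measure.map_apply (idx_meas ε) (by simp), Measure.restrict_apply ((idx_meas ε) (by simp))]
  have hi' : (1:ℝ) ≤ i := by exact_mod_cast hi
  have : idx ε ⁻¹' {i} ∩ Set.Ioi 0 = Set.Ico (((i : ℝ) - 1 / 2) * ε) (((i : ℝ) + 1 / 2) * ε) := by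
    ext x
    simp only [Set.mem_inter_iff, Set.mem_preimage, Set.mem_singleton_iff, Set.mem_Ioi, Set.mem_Ico]
    constructor
    · rintro ⟨h, hx⟩; exact (idx_iff hε hx i).1 h
    · intro h
      have hx : 0 < x := lt_of_lt_of_le (mul_pos (by linarith) hε) h.1
      exact ⟨(idx_iff hε hx i).2 h, hx⟩
  rw [this, Real.volume_Ico]
  congr 1; ring

lemma idx_int {ε : ℝ} (hε : 0 < ε) {g : ℕ → ℝ} (g0 : g 0 = 0) (hg : Summable g) :
    IntegrableOn (fun x => g (idx ε x)) (Set.Ioi 0) ∧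
      ∫ x in Set.Ioi (0:ℝ), g (idx ε x) = ε * ∑' i, g i := by
  have hmg : Measurable g := measurable_from_nat
  set μ := (volume.restrict (Set.Ioi (0:ℝ))).map (idx ε) with hμ
  have hterm : ∀ i, ‖g i‖ₑ * μ {i} = ENNReal.ofReal (ε * |g i|) := by
    intro i
    rcases Nat.eq_zero_or_pos i with h | h
    · subst h; simp [g0]
    · rw [idx_vol hε h, Real.enorm_eq_ofReal_abs, ← ENNReal.ofReal_mul (abs_nonneg _), mul_comm]
  have hgi : Integrable g μ := by
    refine ⟨hmg.aestronglyMeasurable, ?_⟩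
    rw [HasFiniteIntegral, lintegral_countable']
    simp_rw [hterm]
    rw [← ENNReal.ofReal_tsum_of_nonneg (fun i => by positivity) (hg.abs.mul_left ε)]
    exact ENNReal.ofReal_lt_top
  refine ⟨hgi.comp_measurable (idx_meas ε), ?_⟩
  rw [← integral_map (idx_meas ε).aemeasurable hmg.aestronglyMeasurable, ← hμ, integral_countable' hgi,
    ← tsum_mul_left]
  congr 1; ext i
  rcases Nat.eq_zero_or_pos i with h | h
  · subst h; simp [g0]
  · rw [Measure.real, idx_vol hε h, ENNReal.toReal_ofReal hε.le, smul_eq_mul]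
open MeasureTheory

lemma isTF_approx {φ : ℝ → ℝ} {B R η : ℝ} (hm : Measurable φ) (hB : ∀ x, |φ x| ≤ B) (hη : 0 < η) :
    ∃ ψ, IsTF ψ ∧ (∀ x, |ψ x| ≤ B) ∧ ∫ x in Set.Ioc 0 R, |φ x - ψ x| ≤ η := by
  have B0 : 0 ≤ B := (abs_nonneg _).trans (hB 0)
  have hi0 : IntegrableOn φ (Set.Ioc 0 R) :=
    Measure.integrableOn_of_bounded (M := B) (by simp) hm.aestronglyMeasurable
      (ae_of_all _ (fun x => by simpa using hB x))
  have hi : Integrable ((Set.Ioc 0 R).indicator φ) := hi0.integrable_indicator measurableSet_Ioc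
  obtain ⟨g, hgs, hgi, hgc, hgI⟩ := hi.exists_hasCompactSupport_integral_sub_le (half_pos hη)
  obtain ⟨h, hh0, hh⟩ : ∃ h : ℝ, 0 < h ∧ 2 * h * B ≤ η / 2 := by
    refine ⟨η / (4 * (B + 1)), by positivity, ?_⟩
    rw [mul_div_assoc', div_mul_eq_mul_div, div_le_div_iff₀ (by positivity) (by positivity)]
    nlinarith
  obtain ⟨b, hb⟩ : ∃ b, ∀ x, b ≤ x → g x = 0 := by
    obtain ⟨r, hr⟩ := hgs.isCompact.isBounded.subset_closedBall 0
    refine ⟨r + 1, fun x hx => ?_⟩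
    by_contra hne
    have := hr (subset_tsupport _ (Function.mem_support.2 hne))
    rw [Metric.mem_closedBall, Real.dist_eq, sub_zero] at this
    have := le_abs_self x
    linarith
  set θ : ℝ → ℝ := fun x => max 0 (min 1 (x / h - 1)) with hθ
  have θ0 : ∀ x, 0 ≤ θ x := fun x => le_max_left _ _
  have θ1 : ∀ x, θ x ≤ 1 := fun x => max_le zero_le_one (min_le_left _ _)
  set g1 : ℝ → ℝ := fun x => max (-B) (min B (g x)) with hg1
  have g1b : ∀ x, |g1 x| ≤ B := fun x => abs_le.2 ⟨le_max_left _ _, max_le (by linarith) (min_le_left _ _)⟩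
  have ψb : ∀ x, |θ x * g1 x| ≤ B := fun x => by
    rw [abs_mul, abs_of_nonneg (θ0 x)]
    exact (mul_le_of_le_one_left (abs_nonneg _) (θ1 x)).trans (g1b x)
  have ψc : Continuous (fun x => θ x * g1 x) := by
    rw [hθ, hg1]; fun_prop
  refine ⟨fun x => θ x * g1 x, ⟨ψc, h, b, hh0, ?_, ?_⟩, ψb, ?_⟩
  · intro x hx
    have : θ x = 0 := by
      rw [hθ]
      have : x / h - 1 ≤ 0 := by rw [sub_nonpos, div_le_one hh0]; exact hx
      exact max_eq_left ((min_le_right _ _).trans this)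
    simp [this]
  · intro x hx
    simp [hg1, hb x hx, B0]
  · have key : ∀ x ∈ Set.Ioc 0 R, |φ x - θ x * g1 x| ≤
        ‖(Set.Ioc 0 R).indicator φ x - g x‖ + (Set.Ioc 0 (2 * h)).indicator (fun _ => B) x := by
      intro x hx
      rw [Set.indicator_of_mem hx, Real.norm_eq_abs]
      have h1 : |φ x - g1 x| ≤ |φ x - g x| := by
        have e : φ x = max (-B) (min B (φ x)) := by
          rw [min_eq_right (abs_le.1 (hB x)).2, max_eq_right (abs_le.1 (hB x)).1]
        conv_lhs => rw [e]
        have t1 := abs_max_sub_max_le_max (-B) (min B (φ x)) (-B) (min B (g x))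
        have t2 := abs_min_sub_min_le_max B (φ x) B (g x)
        rw [sub_self, abs_zero, max_eq_right (abs_nonneg (min B (φ x) - min B (g x)))] at t1
        rw [sub_self, abs_zero, max_eq_right (abs_nonneg (φ x - g x))] at t2
        exact t1.trans t2
      have h2 : |g1 x - θ x * g1 x| ≤ (Set.Ioc 0 (2 * h)).indicator (fun _ => B) x := by
        by_cases hx2 : x ≤ 2 * h
        · have hxm : x ∈ Set.Ioc 0 (2 * h) := ⟨hx.1, hx2⟩
          rw [Set.indicator_of_mem hxm]
          rw [show g1 x - θ x * g1 x = (1 - θ x) * g1 x by ring, abs_mul, abs_of_nonneg (by linarith [θ1 x])]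
          exact (mul_le_of_le_one_left (abs_nonneg _) (by linarith [θ0 x])).trans (g1b x)
        · have : θ x = 1 := by
            rw [hθ]
            have : 1 ≤ x / h - 1 := by
              rw [le_sub_iff_add_le, le_div_iff₀ hh0]; linarith
            simp [min_eq_left this]
          rw [this]; simp
          exact Set.indicator_nonneg (fun _ _ => B0) _
      calc |φ x - θ x * g1 x| = |(φ x - g1 x) + (g1 x - θ x * g1 x)| := by ring_nf
        _ ≤ _ := abs_add_le _ _
        _ ≤ _ := add_le_add h1 h2
    have I1 : Integrable (fun x => ‖(Set.Ioc 0 R).indicator φ x - g x‖) := (hi.sub hgI).norm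
    have I2 : Integrable ((Set.Ioc 0 (2 * h)).indicator (fun _ : ℝ => B)) :=
      IntegrableOn.integrable_indicator (integrable_const B) measurableSet_Ioc
    have I3 : IntegrableOn (fun x => |φ x - θ x * g1 x|) (Set.Ioc 0 R) := by
      refine Measure.integrableOn_of_bounded (M := B + B) (by simp) ?_ (ae_of_all _ (fun x => ?_))
      · exact (hm.sub ψc.measurable).abs.aestronglyMeasurable
      · simp only [Real.norm_eq_abs, abs_abs]
        exact (abs_sub _ _).trans (add_le_add (hB x) (ψb x))
    calc ∫ x in Set.Ioc 0 R, |φ x - θ x * g1 x|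
        ≤ ∫ x in Set.Ioc 0 R, (‖(Set.Ioc 0 R).indicator φ x - g x‖ + (Set.Ioc 0 (2 * h)).indicator (fun _ => B) x) :=
          setIntegral_mono_on I3 (I1.add I2).integrableOn measurableSet_Ioc key
      _ ≤ ∫ x, (‖(Set.Ioc 0 R).indicator φ x - g x‖ + (Set.Ioc 0 (2 * h)).indicator (fun _ => B) x) := by
          refine setIntegral_le_integral (I1.add I2) (ae_of_all _ (fun x => ?_))
          exact add_nonneg (norm_nonneg _) (Set.indicator_nonneg (fun _ _ => B0) _)
      _ ≤ η := by
          rw [integral_add I1 I2, integral_indicator measurableSet_Ioc]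
          simp
          rw [max_eq_left (by positivity)]
          simp only [Real.norm_eq_abs] at hgi
          linarith

lemma isTF_int {ψ : ℝ → ℝ} (h : IsTF ψ) (R : ℝ) : Integrable ψ (volume.restrict (Set.Ioc 0 R)) :=
  (h.1.integrable_of_hasCompactSupport h.compact).integrableOn

lemma isTF_zero : IsTF (fun _ => 0) := ⟨continuous_const, 1, 1, one_pos, fun _ _ => rfl, fun _ _ => rfl⟩

lemma isTF_family : ∃ ψ : ℕ → ℝ → ℝ, (∀ k, IsTF (ψ k)) ∧ ∀ (φ : ℝ → ℝ) (B R η : ℝ), Measurable φ →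
    (∀ x, |φ x| ≤ B) → 0 < η → ∃ k, (∀ x, |ψ k x| ≤ B + 1) ∧ ∫ x in Set.Ioc 0 R, |φ x - ψ k x| ≤ η := by
  have fam : ∀ (b r : ℕ), ∃ ψ : ℕ → ℝ → ℝ, (∀ k, IsTF (ψ k)) ∧ (∀ k x, |ψ k x| ≤ b) ∧
      ∀ ψ', IsTF ψ' → (∀ x, |ψ' x| ≤ b) → ∀ η, 0 < η → ∃ k, ∫ x in Set.Ioc 0 (r:ℝ), |ψ' x - ψ k x| < η := by
    intro b r
    set μ := (volume.restrict (Set.Ioc (0:ℝ) r)) with hμ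
    set S : Set (Lp ℝ 1 μ) := {g | ∃ ψ, ∃ h : IsTF ψ, (∀ x, |ψ x| ≤ b) ∧ g = (isTF_int h r).toL1 ψ} with hS
    have : Fact ((1:ENNReal) ≠ ⊤) := ⟨by simp⟩
    obtain ⟨D, hDS, hDc, hDd⟩ := (TopologicalSpace.IsSeparable.of_separableSpace S).exists_countable_dense_subset
    have hSne : ((isTF_int isTF_zero r).toL1 _ : Lp ℝ 1 μ) ∈ S := ⟨_, isTF_zero, by simp, rfl⟩
    have hDne : D.Nonempty := by
      rcases D.eq_empty_or_nonempty with h | h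
      · rw [h] at hDd; simp at hDd; rw [hDd] at hSne; exact hSne.elim
      · exact h
    obtain ⟨d, hd⟩ := hDc.exists_eq_range hDne
    have : ∀ k, d k ∈ S := fun k => hDS (hd ▸ Set.mem_range_self k)
    choose ψ h1 h2 h3 using this
    refine ⟨ψ, h1, h2, ?_⟩
    intro ψ' hψ' hb η hη
    have hmem : ((isTF_int hψ' r).toL1 ψ' : Lp ℝ 1 μ) ∈ closure D := hDd ⟨ψ', hψ', hb, rfl⟩
    rw [hd] at hmem
    obtain ⟨y, ⟨k, rfl⟩, hk⟩ := Metric.mem_closure_iff.1 hmem η hη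
    refine ⟨k, ?_⟩
    rw [h3 k, dist_eq_norm, ← Integrable.toL1_sub, L1.norm_of_fun_eq_integral_norm] at hk
    simpa using hk
  choose Ψ a1 a2 a3 using fam
  refine ⟨fun k => Ψ k.unpair.1 k.unpair.2.unpair.1 k.unpair.2.unpair.2, fun k => a1 _ _ _, ?_⟩
  intro φ B R η hm hB hη
  have B0 : 0 ≤ B := (abs_nonneg _).trans (hB 0)
  obtain ⟨ψ', c1, c2, c3⟩ := isTF_approx (R := ⌈R⌉₊) hm hB (half_pos hη)
  obtain ⟨k, hk⟩ := a3 ⌈B⌉₊ ⌈R⌉₊ ψ' c1 (fun x => (c2 x).trans (Nat.le_ceil _)) (η / 2) (half_pos hη)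
  refine ⟨Nat.pair ⌈B⌉₊ (Nat.pair ⌈R⌉₊ k), ?_, ?_⟩
  · simp only [Nat.unpair_pair]
    exact fun x => (a2 _ _ _ _).trans (Nat.ceil_lt_add_one B0).le
  · simp only [Nat.unpair_pair]
    have iφ : Integrable φ (volume.restrict (Set.Ioc (0:ℝ) ⌈R⌉₊)) :=
      Measure.integrableOn_of_bounded (M := B) (by simp) hm.aestronglyMeasurable
        (ae_of_all _ (fun x => by simpa using hB x))
    have i1 := isTF_int c1 ⌈R⌉₊
    have i2 := isTF_int (a1 ⌈B⌉₊ ⌈R⌉₊ k) ⌈R⌉₊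
    calc _ ≤ ∫ x in Set.Ioc 0 (⌈R⌉₊:ℝ), |φ x - Ψ ⌈B⌉₊ ⌈R⌉₊ k x| := by
            refine setIntegral_mono_set (iφ.sub i2).abs (ae_of_all _ (fun x => abs_nonneg _)) ?_
            exact (Set.Ioc_subset_Ioc_right (Nat.le_ceil R)).eventuallyLE
      _ ≤ ∫ x in Set.Ioc 0 (⌈R⌉₊:ℝ), (|φ x - ψ' x| + |ψ' x - Ψ ⌈B⌉₊ ⌈R⌉₊ k x|) := by
            refine integral_mono (iφ.sub i2).abs ((iφ.sub i1).abs.add (i1.sub i2).abs) (fun x => ?_)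
            exact abs_sub_le _ _ _
      _ ≤ η := by
            have e := integral_add (iφ.sub i1).abs (i1.sub i2).abs
            simp only [Pi.sub_apply] at e
            rw [e]
            linarith
open MeasureTheory

/-- Abstract hypotheses for weak `L¹` compactness, uniformly in time. -/
structure UFam (u : ℕ → ℝ → ℝ → ℝ) (M : ℝ) : Prop where
  meas : ∀ n t, Measurable (u n t)
  nonneg : ∀ n t x, 0 ≤ u n t x
  int : ∀ n t, IntegrableOn (fun x => (1 + x) * u n t x) (Set.Ioi 0)
  mass : ∀ n t, ∫ x in Set.Ioi (0:ℝ), (1 + x) * u n t x ≤ M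
  UI : ∀ T κ, 0 ≤ T → 0 < κ → ∃ L, 0 < L ∧ ∀ n t, 0 ≤ t → t ≤ T →
    ∫ x in Set.Ioi (0:ℝ), max (u n t x - L) 0 ≤ κ
  EC : ∀ φ, IsTF φ → ∀ T κ, 0 ≤ T → 0 < κ → ∃ δ, 0 < δ ∧ ∃ N, ∀ n, N ≤ n → ∀ s t, 0 ≤ s → s ≤ t → t ≤ T →
    t - s ≤ δ → |(∫ x in Set.Ioi (0:ℝ), φ x * u n t x) - ∫ x in Set.Ioi (0:ℝ), φ x * u n s x| ≤ κ

namespace UFam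
variable {u : ℕ → ℝ → ℝ → ℝ} {M : ℝ}

lemma M_nonneg (H : UFam u M) : 0 ≤ M := by
  refine le_trans ?_ (H.mass 0 0)
  refine setIntegral_nonneg measurableSet_Ioi (fun x hx => ?_)
  have : 0 < x := hx
  have := H.nonneg 0 0 x
  positivity

lemma int1 (H : UFam u M) (n : ℕ) (t : ℝ) : IntegrableOn (u n t) (Set.Ioi 0) := by
  refine (H.int n t).mono' (H.meas n t).aestronglyMeasurable ?_
  refine ae_restrict_of_forall_mem measurableSet_Ioi (fun x hx => ?_)
  have : 0 < x := hx
  have h := H.nonneg n t x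
  rw [Real.norm_eq_abs, abs_of_nonneg h]; nlinarith

lemma intφ (H : UFam u M) (n : ℕ) (t : ℝ) {φ : ℝ → ℝ} {B : ℝ} (hm : Measurable φ) (hB : ∀ x, |φ x| ≤ B) :
    IntegrableOn (fun x => φ x * u n t x) (Set.Ioi 0) :=
  (H.int1 n t).bdd_mul (c := B) hm.aestronglyMeasurable (ae_of_all _ (fun x => by simpa using hB x))

lemma core (H : UFam u M) {T B κ : ℝ} (hT : 0 ≤ T) (hκ : 0 < κ) (hB0 : 0 ≤ B) :
    ∃ R η, 0 < R ∧ 0 < η ∧ ∀ g : ℝ → ℝ, Measurable g → (∀ x, |g x| ≤ B) → ∫ x in Set.Ioc 0 R, |g x| ≤ η →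
      ∀ n t, 0 ≤ t → t ≤ T → ∫ x in Set.Ioi (0:ℝ), |g x| * u n t x ≤ κ := by
  obtain ⟨L, hL, hUI⟩ := H.UI T (κ / (3 * (B + 1))) hT (by positivity)
  have hM := H.M_nonneg
  refine ⟨3 * (B + 1) * (M + 1) / κ, κ / (3 * L), by positivity, by positivity, ?_⟩
  intro g hg hgB hgη n t h0 h1
  set R := 3 * (B + 1) * (M + 1) / κ with hR
  have R0 : 0 < R := by positivity
  have iu := H.int1 n t
  have iL : IntegrableOn (fun x => max (u n t x - L) 0) (Set.Ioi 0) := by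
    refine iu.mono' (((H.meas n t).sub_const L).max measurable_const).aestronglyMeasurable (ae_of_all _ (fun x => ?_))
    have h := H.nonneg n t x
    rw [Real.norm_eq_abs, abs_of_nonneg (le_max_right _ _)]
    exact max_le (by linarith) h
  have ig : IntegrableOn (fun x => |g x|) (Set.Ioc 0 R) :=
    Measure.integrableOn_of_bounded (M := B) (by simp) hg.abs.aestronglyMeasurable
      (ae_of_all _ (fun x => by simpa using hgB x))
  have ig' : IntegrableOn ((Set.Ioc 0 R).indicator (fun x => |g x|)) (Set.Ioi 0) :=
    (ig.integrable_indicator measurableSet_Ioc).integrableOn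
  have key : ∀ x ∈ Set.Ioi (0:ℝ), |g x| * u n t x ≤ B * max (u n t x - L) 0 +
      (L * (Set.Ioc 0 R).indicator (fun x => |g x|) x + B / (1 + R) * ((1 + x) * u n t x)) := by
    intro x hx
    have hx0 : 0 < x := hx
    have h := H.nonneg n t x
    have e3 : 0 ≤ B / (1 + R) * ((1 + x) * u n t x) := by positivity
    by_cases hxR : x ≤ R
    · rw [Set.indicator_of_mem (show x ∈ Set.Ioc 0 R from ⟨hx, hxR⟩)]
      have e1 : |g x| * max (u n t x - L) 0 ≤ B * max (u n t x - L) 0 :=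
        mul_le_mul_of_nonneg_right (hgB x) (le_max_right _ _)
      have e2 : |g x| * (u n t x - L) ≤ |g x| * max (u n t x - L) 0 :=
        mul_le_mul_of_nonneg_left (le_max_left _ _) (abs_nonneg _)
      nlinarith
    · have e1 : |g x| * u n t x ≤ B * u n t x := mul_le_mul_of_nonneg_right (hgB x) h
      have e2 : B * u n t x ≤ B / (1 + R) * ((1 + x) * u n t x) := by
        rw [div_mul_eq_mul_div, le_div_iff₀ (by positivity)]
        have : B * u n t x * (1 + R) ≤ B * u n t x * (1 + x) :=
          mul_le_mul_of_nonneg_left (by linarith) (by positivity)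
        nlinarith
      have e4 : 0 ≤ B * max (u n t x - L) 0 := mul_nonneg hB0 (le_max_right _ _)
      have e5 : 0 ≤ L * (Set.Ioc 0 R).indicator (fun x => |g x|) x :=
        mul_nonneg hL.le (Set.indicator_nonneg (fun _ _ => abs_nonneg _) _)
      linarith
  have I0 : IntegrableOn (fun x => |g x| * u n t x) (Set.Ioi 0) :=
    H.intφ n t (B := B) hg.abs (by simpa using hgB)
  have I1 := iL.const_mul B
  have I2 := ig'.const_mul L
  have I3 := (H.int n t).const_mul (B / (1 + R))
  have := setIntegral_mono_on I0 (I1.add (I2.add I3)) measurableSet_Ioi key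
  refine this.trans ?_
  have e : ∫ x in Set.Ioi (0:ℝ), (B * max (u n t x - L) 0 +
      (L * (Set.Ioc 0 R).indicator (fun x => |g x|) x + B / (1 + R) * ((1 + x) * u n t x))) =
      B * (∫ x in Set.Ioi (0:ℝ), max (u n t x - L) 0) + (L * (∫ x in Set.Ioc 0 R, |g x|) +
        B / (1 + R) * ∫ x in Set.Ioi (0:ℝ), (1 + x) * u n t x) := by
    have t0 := integral_add I1 (I2.add I3)
    have t1 := integral_add I2 I3
    simp only [Pi.add_apply] at t0 t1
    rw [t0, t1, integral_const_mul, integral_const_mul, integral_const_mul,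
      setIntegral_indicator measurableSet_Ioc]
    have : Set.Ioi 0 ∩ Set.Ioc 0 R = Set.Ioc 0 R := by
      ext x; simp only [Set.mem_inter_iff, Set.mem_Ioi, Set.mem_Ioc]; tauto
    rw [this]
  simp only [Pi.add_apply]
  rw [e]
  have a1 : B * (∫ x in Set.Ioi (0:ℝ), max (u n t x - L) 0) ≤ κ / 3 := by
    calc _ ≤ B * (κ / (3 * (B + 1))) := mul_le_mul_of_nonneg_left (hUI n t h0 h1) hB0
      _ ≤ (B + 1) * (κ / (3 * (B + 1))) := mul_le_mul_of_nonneg_right (by linarith) (by positivity)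
      _ = κ / 3 := by field_simp
  have a2 : L * (∫ x in Set.Ioc 0 R, |g x|) ≤ κ / 3 := by
    calc _ ≤ L * (κ / (3 * L)) := mul_le_mul_of_nonneg_left hgη hL.le
      _ = κ / 3 := by field_simp
  have a3 : B / (1 + R) * ∫ x in Set.Ioi (0:ℝ), (1 + x) * u n t x ≤ κ / 3 := by
    calc _ ≤ B / (1 + R) * M := mul_le_mul_of_nonneg_left (H.mass n t) (by positivity)
      _ ≤ κ / 3 := by
        rw [div_mul_eq_mul_div, div_le_div_iff₀ (by positivity) (by positivity)]
        have : κ * R = 3 * (B + 1) * (M + 1) := by rw [hR]; field_simp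
        nlinarith [mul_nonneg hB0 hM]
  linarith

lemma abs_sub_le_int (H : UFam u M) (n : ℕ) (t : ℝ) {φ ψ : ℝ → ℝ} {B B' : ℝ} (hm : Measurable φ) (hB : ∀ x, |φ x| ≤ B)
    (hm' : Measurable ψ) (hB' : ∀ x, |ψ x| ≤ B') :
    |(∫ x in Set.Ioi (0:ℝ), φ x * u n t x) - ∫ x in Set.Ioi (0:ℝ), ψ x * u n t x| ≤
      ∫ x in Set.Ioi (0:ℝ), |φ x - ψ x| * u n t x := by
  rw [← integral_sub (H.intφ n t hm hB) (H.intφ n t hm' hB')]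
  refine (abs_integral_le_integral_abs).trans (le_of_eq ?_)
  congr 1; ext x
  rw [← sub_mul, abs_mul, abs_of_nonneg (H.nonneg n t x)]

lemma approx (H : UFam u M) {ψ : ℕ → ℝ → ℝ} (h1 : ∀ k, IsTF (ψ k))
    (h2 : ∀ (φ : ℝ → ℝ) (B R η : ℝ), Measurable φ →
    (∀ x, |φ x| ≤ B) → 0 < η → ∃ k, (∀ x, |ψ k x| ≤ B + 1) ∧ ∫ x in Set.Ioc 0 R, |φ x - ψ k x| ≤ η)
    {φ : ℝ → ℝ} {B : ℝ} (hm : Measurable φ) (hB : ∀ x, |φ x| ≤ B) {T κ : ℝ} (hT : 0 ≤ T) (hκ : 0 < κ) :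
    ∃ k, ∀ n t, 0 ≤ t → t ≤ T →
      |(∫ x in Set.Ioi (0:ℝ), φ x * u n t x) - ∫ x in Set.Ioi (0:ℝ), ψ k x * u n t x| ≤ κ := by
  have B0 : 0 ≤ B := (abs_nonneg _).trans (hB 0)
  obtain ⟨R, η, hR, hη, hc⟩ := H.core (B := 2 * B + 1) hT hκ (by positivity)
  obtain ⟨k, hk1, hk2⟩ := h2 φ B R η hm hB hη
  refine ⟨k, fun n t h0 hT' => ?_⟩
  refine (H.abs_sub_le_int n t hm hB (h1 k).1.measurable hk1).trans ?_
  refine hc _ (hm.sub (h1 k).1.measurable) (fun x => ?_) hk2 n t h0 hT'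
  exact (abs_sub _ _).trans (by linarith [hB x, hk1 x])

lemma EC' (H : UFam u M) {φ : ℝ → ℝ} {B : ℝ} (hm : Measurable φ) (hB : ∀ x, |φ x| ≤ B) {T κ : ℝ} (hT : 0 ≤ T) (hκ : 0 < κ) :
    ∃ δ, 0 < δ ∧ ∃ N, ∀ n, N ≤ n → ∀ s t, 0 ≤ s → s ≤ t → t ≤ T →
    t - s ≤ δ → |(∫ x in Set.Ioi (0:ℝ), φ x * u n t x) - ∫ x in Set.Ioi (0:ℝ), φ x * u n s x| ≤ κ := by
  obtain ⟨ψ, h1, h2⟩ := isTF_family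
  obtain ⟨k, hk⟩ := H.approx h1 h2 hm hB hT (show 0 < κ / 3 by positivity)
  obtain ⟨δ, hδ, N, hN⟩ := H.EC (ψ k) (h1 k) T (κ / 3) hT (by positivity)
  refine ⟨δ, hδ, N, fun n hn s t hs hst ht hd => ?_⟩
  have a := abs_le.1 (hN n hn s t hs hst ht hd)
  have b := abs_le.1 (hk n t (hs.trans hst) ht)
  have c := abs_le.1 (hk n s hs (hst.trans ht))
  rw [abs_le]; constructor <;> linarith [a.1, a.2, b.1, b.2, c.1, c.2]

lemma bound (H : UFam u M) (n : ℕ) (t : ℝ) {φ : ℝ → ℝ} {B : ℝ} (hB : ∀ x, |φ x| ≤ B) :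
    |∫ x in Set.Ioi (0:ℝ), φ x * u n t x| ≤ B * M := by
  have B0 : 0 ≤ B := (abs_nonneg _).trans (hB 0)
  have : ‖∫ x in Set.Ioi (0:ℝ), φ x * u n t x‖ ≤ ∫ x in Set.Ioi (0:ℝ), B * ((1 + x) * u n t x) := by
    refine norm_integral_le_of_norm_le ((H.int n t).const_mul B) ?_
    refine ae_restrict_of_forall_mem measurableSet_Ioi (fun x hx => ?_)
    have hx0 : 0 < x := hx
    have h := H.nonneg n t x
    rw [norm_mul, Real.norm_eq_abs, Real.norm_eq_abs, abs_of_nonneg h]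
    refine mul_le_mul (hB x) (by nlinarith) h B0
  rw [integral_const_mul, Real.norm_eq_abs] at this
  exact this.trans (mul_le_mul_of_nonneg_left (H.mass n t) B0)

/-- Extraction of a subsequence along which all pairings are uniformly Cauchy. -/
lemma extract (H : UFam u M) : ∃ σ : ℕ → ℕ, StrictMono σ ∧
    ∀ (φ : ℝ → ℝ) (B : ℝ), Measurable φ → (∀ x, |φ x| ≤ B) → ∀ T κ, 0 ≤ T → 0 < κ →
      ∃ N, ∀ n m, N ≤ n → N ≤ m → ∀ t, 0 ≤ t → t ≤ T →
      |(∫ x in Set.Ioi (0:ℝ), φ x * u (σ n) t x) - ∫ x in Set.Ioi (0:ℝ), φ x * u (σ m) t x| ≤ κ := by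
  obtain ⟨ψ, h1, h2⟩ := isTF_family
  choose Bk hBk0 hBk using fun k => (h1 k).bdd
  set S : Set (ℕ × ℚ → ℝ) := Set.univ.pi (fun p => Set.Icc (-(Bk p.1 * M)) (Bk p.1 * M)) with hS
  have hSc : IsCompact S := isCompact_univ_pi (fun p => isCompact_Icc)
  set X : ℕ → ℕ × ℚ → ℝ := fun n p => ∫ x in Set.Ioi (0:ℝ), ψ p.1 x * u n p.2 x with hX
  have hXS : ∀ n, X n ∈ S := by
    intro n p _
    exact abs_le.1 (H.bound n p.2 (hBk p.1))
  obtain ⟨a, -, σ, hσ, hlim⟩ := hSc.tendsto_subseq hXS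
  refine ⟨σ, hσ, ?_⟩
  rw [tendsto_pi_nhds] at hlim
  have stepψ : ∀ k T κ, 0 ≤ T → 0 < κ → ∃ N, ∀ n m, N ≤ n → N ≤ m → ∀ t, 0 ≤ t → t ≤ T →
      |(∫ x in Set.Ioi (0:ℝ), ψ k x * u (σ n) t x) - ∫ x in Set.Ioi (0:ℝ), ψ k x * u (σ m) t x| ≤ κ := by
    intro k T κ hT hκ
    obtain ⟨δ, hδ, N0, hN0⟩ := H.EC (ψ k) (h1 k) (T + 1) (κ / 3) (by linarith) (by positivity)
    set δ' := min δ 1 with hδ'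
    have hδ'0 : 0 < δ' := lt_min hδ one_pos
    obtain ⟨J, hJ⟩ := exists_nat_gt ((T + 1) / (δ' / 2))
    have qex : ∀ j : ℕ, ∃ q : ℚ, (j : ℝ) * (δ' / 2) < q ∧ (q : ℝ) < j * (δ' / 2) + δ' / 2 :=
      fun j => exists_rat_btwn (by linarith)
    choose q hq1 hq2 using qex
    have cau : ∀ j, ∃ N, ∀ n m, N ≤ n → N ≤ m → |X (σ n) (k, q j) - X (σ m) (k, q j)| ≤ κ / 3 := by
      intro j
      have := (hlim (k, q j)).cauchySeq
      obtain ⟨N, hN⟩ := Metric.cauchySeq_iff.1 this (κ / 3) (by positivity)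
      exact ⟨N, fun n m hn hm => (hN n hn m hm).le⟩
    choose N1 hN1 using cau
    refine ⟨max N0 ((Finset.range (J + 1)).sup N1), fun n m hn hm t h0 ht => ?_⟩
    set j := ⌊t / (δ' / 2)⌋₊ with hj
    have j1 : (j : ℝ) * (δ' / 2) ≤ t := by
      have := Nat.floor_le (show 0 ≤ t / (δ' / 2) by positivity)
      rwa [le_div_iff₀ (by positivity)] at this
    have j2 : t < (j : ℝ) * (δ' / 2) + δ' / 2 := by
      have := Nat.lt_floor_add_one (t / (δ' / 2))
      rw [← hj, div_lt_iff₀ (by positivity)] at this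
      linarith
    have jJ : j ∈ Finset.range (J + 1) := by
      rw [Finset.mem_range]
      have : (j : ℝ) ≤ t / (δ' / 2) := Nat.floor_le (by positivity)
      have h3 : t / (δ' / 2) ≤ (T + 1) / (δ' / 2) := div_le_div_of_nonneg_right (by linarith) (by positivity)
      have : (j : ℝ) < J := by linarith
      have : j < J := by exact_mod_cast this
      omega
    have hjN : N1 j ≤ (Finset.range (J + 1)).sup N1 := Finset.le_sup jJ
    have q0 : (0:ℝ) ≤ q j := le_trans (by positivity) (hq1 j).le
    have dδ : δ' ≤ δ := min_le_left _ _
    have dδ1 : δ' ≤ 1 := min_le_right _ _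
    have close : ∀ n, N0 ≤ n → |(∫ x in Set.Ioi (0:ℝ), ψ k x * u n t x) - X n (k, q j)| ≤ κ / 3 := by
      intro n hn
      rcases le_total (q j : ℝ) t with h | h
      · exact hN0 n hn (q j) t q0 h (by linarith) (by linarith [hq1 j])
      · rw [abs_sub_comm]
        exact hN0 n hn t (q j) h0 h (by linarith [hq2 j]) (by linarith [hq2 j])
    have c1 := abs_le.1 (close (σ n) (((le_max_left _ _).trans hn).trans (hσ.id_le n)))
    have c2 := abs_le.1 (close (σ m) (((le_max_left _ _).trans hm).trans (hσ.id_le m)))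
    have c3 := abs_le.1 (hN1 j n m (hjN.trans ((le_max_right _ _).trans hn)) (hjN.trans ((le_max_right _ _).trans hm)))
    rw [abs_le]; constructor <;> linarith [c1.1, c1.2, c2.1, c2.2, c3.1, c3.2]
  intro φ B hm hB T κ hT hκ
  obtain ⟨k, hk⟩ := H.approx h1 h2 hm hB hT (show 0 < κ / 3 by positivity)
  obtain ⟨N, hN⟩ := stepψ k T (κ / 3) hT (by positivity)
  refine ⟨N, fun n m hn hm t h0 ht => ?_⟩
  have c1 := abs_le.1 (hk (σ n) t h0 ht)
  have c2 := abs_le.1 (hk (σ m) t h0 ht)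
  have c3 := abs_le.1 (hN n m hn hm t h0 ht)
  rw [abs_le]; constructor <;> linarith [c1.1, c1.2, c2.1, c2.2, c3.1, c3.2]

end UFam
open MeasureTheory

namespace UFam
variable {v : ℕ → ℝ → ℝ → ℝ} {M : ℝ}

/-- Uniform Cauchy property of all pairings. -/
def Cau (v : ℕ → ℝ → ℝ → ℝ) : Prop :=
  ∀ (φ : ℝ → ℝ) (B : ℝ), Measurable φ → (∀ x, |φ x| ≤ B) → ∀ T κ, 0 ≤ T → 0 < κ →
      ∃ N, ∀ n m, N ≤ n → N ≤ m → ∀ t, 0 ≤ t → t ≤ T →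
      |(∫ x in Set.Ioi (0:ℝ), φ x * v n t x) - ∫ x in Set.Ioi (0:ℝ), φ x * v m t x| ≤ κ

/-- Limit pairing. -/
noncomputable def ell (v : ℕ → ℝ → ℝ → ℝ) (t : ℝ) (φ : ℝ → ℝ) : ℝ :=
  Filter.limUnder Filter.atTop (fun n => ∫ x in Set.Ioi (0:ℝ), φ x * v n t x)

/-- The indicator function of `A`. -/
noncomputable def one (A : Set ℝ) : ℝ → ℝ := A.indicator (fun _ => 1)

lemma one_meas {A : Set ℝ} (hA : MeasurableSet A) : Measurable (one A) := measurable_const.indicator hA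

lemma one_nonneg (A : Set ℝ) (x : ℝ) : 0 ≤ one A x := Set.indicator_nonneg (fun _ _ => zero_le_one) _

lemma one_le (A : Set ℝ) (x : ℝ) : one A x ≤ 1 := by
  unfold one; by_cases h : x ∈ A <;> simp [h]

lemma one_abs (A : Set ℝ) (x : ℝ) : |one A x| ≤ 1 := by
  rw [abs_of_nonneg (one_nonneg A x)]; exact one_le A x

lemma ell_tendsto (hC : Cau v) {φ : ℝ → ℝ} {B : ℝ} (hm : Measurable φ) (hB : ∀ x, |φ x| ≤ B) {t : ℝ} (ht : 0 ≤ t) :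
    Filter.Tendsto (fun n => ∫ x in Set.Ioi (0:ℝ), φ x * v n t x) Filter.atTop (nhds (ell v t φ)) := by
  refine CauchySeq.tendsto_limUnder (Metric.cauchySeq_iff.2 (fun κ hκ => ?_))
  obtain ⟨N, hN⟩ := hC φ B hm hB t (κ / 2) ht (half_pos hκ)
  refine ⟨N, fun m hm n hn => ?_⟩
  rw [Real.dist_eq]
  exact (hN m n hm hn t ht le_rfl).trans_lt (by linarith)

lemma ell_unif (hC : Cau v) {φ : ℝ → ℝ} {B : ℝ} (hm : Measurable φ) (hB : ∀ x, |φ x| ≤ B) {T κ : ℝ} (hT : 0 ≤ T)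
    (hκ : 0 < κ) : ∃ N, ∀ n, N ≤ n → ∀ t, 0 ≤ t → t ≤ T →
      |(∫ x in Set.Ioi (0:ℝ), φ x * v n t x) - ell v t φ| ≤ κ := by
  obtain ⟨N, hN⟩ := hC φ B hm hB T κ hT hκ
  refine ⟨N, fun n hn t h0 ht => ?_⟩
  have : Filter.Tendsto (fun m => |(∫ x in Set.Ioi (0:ℝ), φ x * v n t x) - ∫ x in Set.Ioi (0:ℝ), φ x * v m t x|)
      Filter.atTop (nhds |(∫ x in Set.Ioi (0:ℝ), φ x * v n t x) - ell v t φ|) :=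
    ((ell_tendsto hC hm hB h0).const_sub _).abs
  refine le_of_tendsto this ?_
  filter_upwards [Filter.eventually_ge_atTop N] with m hm
  exact hN n m hn hm t h0 ht

lemma ell_sum (H : UFam v M) (hC : Cau v) {ι : Type*} (s : Finset ι) (c : ι → ℝ) (φ : ι → ℝ → ℝ) {B : ℝ}
    (hm : ∀ i, Measurable (φ i)) (hB : ∀ i x, |φ i x| ≤ B) {t : ℝ} (ht : 0 ≤ t) :
    ell v t (fun x => ∑ i ∈ s, c i * φ i x) = ∑ i ∈ s, c i * ell v t (φ i) := by
  have h1 := tendsto_finsetSum s (fun i _ => (ell_tendsto hC (hm i) (hB i) ht).const_mul (c i))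
  have hb : ∀ x, |∑ i ∈ s, c i * φ i x| ≤ ∑ i ∈ s, |c i| * B := by
    intro x
    refine (Finset.abs_sum_le_sum_abs _ _).trans (Finset.sum_le_sum (fun i _ => ?_))
    rw [abs_mul]; exact mul_le_mul_of_nonneg_left (hB i x) (abs_nonneg _)
  have h2 := ell_tendsto hC (φ := fun x => ∑ i ∈ s, c i * φ i x)
    (Finset.measurable_sum s (fun i _ => (hm i).const_mul (c i))) hb ht
  refine tendsto_nhds_unique h2 (h1.congr (fun n => ?_))
  simp_rw [Finset.sum_mul, ← integral_const_mul]
  rw [integral_finsetSum]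
  · refine Finset.sum_congr rfl (fun i _ => ?_)
    congr 1; ext x; ring
  · intro i _
    have := (H.intφ n t (hm i) (hB i)).const_mul (c i)
    refine this.congr (ae_of_all _ (fun x => ?_))
    simp only; ring

lemma ell_nonneg (H : UFam v M) (hC : Cau v) {φ : ℝ → ℝ} {B : ℝ} (hm : Measurable φ) (hB : ∀ x, |φ x| ≤ B)
    (h0 : ∀ x, 0 < x → 0 ≤ φ x) {t : ℝ} (ht : 0 ≤ t) : 0 ≤ ell v t φ := by
  refine ge_of_tendsto' (ell_tendsto hC hm hB ht) (fun n => ?_)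
  exact setIntegral_nonneg measurableSet_Ioi (fun x hx => mul_nonneg (h0 x hx) (H.nonneg n t x))

lemma ell_le (H : UFam v M) (hC : Cau v) {φ : ℝ → ℝ} {B : ℝ} (hm : Measurable φ) (hB : ∀ x, |φ x| ≤ B)
    (h0 : ∀ x, 0 < x → φ x ≤ 1 + x) {t : ℝ} (ht : 0 ≤ t) : ell v t φ ≤ M := by
  refine le_of_tendsto' (ell_tendsto hC hm hB ht) (fun n => ?_)
  refine le_trans ?_ (H.mass n t)
  exact setIntegral_mono_on (H.intφ n t hm hB) (H.int n t) measurableSet_Ioi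
    (fun x hx => mul_le_mul_of_nonneg_right (h0 x hx) (H.nonneg n t x))

lemma ell_bound (H : UFam v M) (hC : Cau v) {φ : ℝ → ℝ} {B : ℝ} (hm : Measurable φ) (hB : ∀ x, |φ x| ≤ B)
    {t : ℝ} (ht : 0 ≤ t) : |ell v t φ| ≤ B * M :=
  le_of_tendsto' (ell_tendsto hC hm hB ht).abs (fun n => H.bound n t hB)

lemma ell_congr {φ ψ : ℝ → ℝ} (h : ∀ x, 0 < x → φ x = ψ x) (t : ℝ) : ell v t φ = ell v t ψ := by
  unfold ell
  congr 1; ext n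
  refine setIntegral_congr_fun measurableSet_Ioi (fun x hx => ?_)
  rw [h x hx]

lemma ell_diff (H : UFam v M) (hC : Cau v) {φ ψ : ℝ → ℝ} {B B' : ℝ} (hm : Measurable φ) (hB : ∀ x, |φ x| ≤ B)
    (hm' : Measurable ψ) (hB' : ∀ x, |ψ x| ≤ B') {η : ℝ} (hη : ∀ x, |φ x - ψ x| ≤ η) {t : ℝ} (ht : 0 ≤ t) :
    |ell v t φ - ell v t ψ| ≤ η * M := by
  refine le_of_tendsto' ((ell_tendsto hC hm hB ht).sub (ell_tendsto hC hm' hB' ht)).abs (fun n => ?_)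
  rw [← integral_sub (H.intφ n t hm hB) (H.intφ n t hm' hB')]
  simp_rw [← sub_mul]
  exact H.bound n t hη

lemma ell_cont (H : UFam v M) (hC : Cau v) {φ : ℝ → ℝ} {B : ℝ} (hm : Measurable φ) (hB : ∀ x, |φ x| ≤ B) :
    Continuous (fun t => ell v (max t 0) φ) := by
  rw [Metric.continuous_iff]
  intro a κ hκ
  obtain ⟨δ, hδ, N, hN⟩ := H.EC' hm hB (T := |a| + 1) (by positivity) (half_pos hκ)
  have key : ∀ s t, 0 ≤ s → s ≤ t → t ≤ |a| + 1 → t - s ≤ δ → |ell v t φ - ell v s φ| ≤ κ / 2 := by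
    intro s t hs hst ht hd
    refine le_of_tendsto ((ell_tendsto hC hm hB (hs.trans hst)).sub (ell_tendsto hC hm hB hs)).abs ?_
    filter_upwards [Filter.eventually_ge_atTop N] with n hn
    exact hN n hn s t hs hst ht hd
  refine ⟨min δ 1, lt_min hδ one_pos, fun b hb => ?_⟩
  rw [Real.dist_eq] at hb ⊢
  have hb1 : |b - a| < δ := hb.trans_le (min_le_left _ _)
  have hb2 : |b - a| < 1 := hb.trans_le (min_le_right _ _)
  have hm1 : |max b 0 - max a 0| ≤ |b - a| := abs_max_sub_max_le_abs _ _ _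
  have h3 : max a 0 ≤ |a| + 1 := max_le (by linarith [le_abs_self a]) (by positivity)
  have h4 : max b 0 ≤ |a| + 1 := max_le (by linarith [le_abs_self a, (abs_lt.1 hb2).2]) (by positivity)
  rcases le_total (max a 0) (max b 0) with h | h
  · refine (key _ _ (le_max_right _ _) h h4 ?_).trans_lt (by linarith)
    linarith [le_abs_self (max b 0 - max a 0)]
  · rw [abs_sub_comm]
    refine (key _ _ (le_max_right _ _) h h3 ?_).trans_lt (by linarith)
    linarith [neg_abs_le (max b 0 - max a 0)]

lemma ell_hasSum (H : UFam v M) (hC : Cau v) {t : ℝ} (ht : 0 ≤ t) {f : ℕ → Set ℝ} (hf : ∀ i, MeasurableSet (f i))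
    (hd : Pairwise (Function.onFun Disjoint f)) :
    HasSum (fun i => ell v t (one (f i))) (ell v t (one (⋃ i, f i))) := by
  rw [hasSum_iff_tendsto_nat_of_nonneg
    (fun i => H.ell_nonneg hC (one_meas (hf i)) (one_abs _) (fun x _ => one_nonneg _ x) ht)]
  set U := ⋃ i, f i with hU
  set V : ℕ → Set ℝ := fun n => ⋃ i ∈ Finset.range n, f i with hV
  set D : ℕ → Set ℝ := fun n => U \ V n with hD
  have mU : MeasurableSet U := MeasurableSet.iUnion hf
  have mV : ∀ n, MeasurableSet (V n) := fun n => Finset.measurableSet_biUnion _ (fun i _ => hf i)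
  have mD : ∀ n, MeasurableSet (D n) := fun n => mU.diff (mV n)
  have VU : ∀ n, V n ⊆ U := fun n => Set.iUnion₂_subset (fun i _ => Set.subset_iUnion f i)
  have e1 : ∀ n, ∑ i ∈ Finset.range n, ell v t (one (f i)) = ell v t (one (V n)) := by
    intro n
    have := H.ell_sum hC (Finset.range n) (fun _ => 1) (fun i => one (f i)) (fun i => one_meas (hf i))
      (fun i => one_abs (f i)) ht
    simp only [one_mul] at this
    rw [← this]
    congr 1; ext x
    unfold one
    rw [hV]
    simp only
    rw [Finset.indicator_biUnion]
    intro i _ j _ hij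
    exact hd hij
  have e2 : ∀ n, ell v t (one U) = ell v t (one (V n)) + ell v t (one (D n)) := by
    intro n
    have := H.ell_sum hC Finset.univ (fun _ : Bool => 1) (fun b => if b then one (V n) else one (D n))
      (B := 1) (fun b => by cases b <;> simp [one_meas, mV, mD]) (fun b x => by cases b <;> simp [one_abs]) ht
    simp only [one_mul, Fintype.sum_bool, if_true, Bool.false_eq_true, if_false] at this
    rw [← this]
    congr 1; ext x
    unfold one
    by_cases hx : x ∈ V n
    · simp [hx, VU n hx, hD]
    · by_cases hx' : x ∈ U <;> simp [hx, hx', hD]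
  have e3 : Filter.Tendsto (fun n => ell v t (one (D n))) Filter.atTop (nhds 0) := by
    rw [Metric.tendsto_atTop]
    intro κ hκ
    obtain ⟨R, η, hR, hη, hc⟩ := H.core (B := 1) ht (half_pos hκ) zero_le_one
    have lim : Filter.Tendsto (fun n => ∫ x in Set.Ioc 0 R, |one (D n) x|) Filter.atTop
        (nhds (∫ x in Set.Ioc 0 R, (0:ℝ))) := by
      refine tendsto_integral_of_dominated_convergence (fun _ => (1:ℝ)) ?_ (integrable_const _) ?_ ?_
      · exact fun n => (one_meas (mD n)).abs.aestronglyMeasurable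
      · exact fun n => ae_of_all _ (fun x => by simpa using one_abs (D n) x)
      · refine ae_of_all _ (fun x => ?_)
        refine tendsto_const_nhds.congr' ?_
        by_cases hx : x ∈ U
        · obtain ⟨j, hj⟩ := Set.mem_iUnion.1 hx
          filter_upwards [Filter.eventually_gt_atTop j] with n hn
          have : x ∉ D n := fun h => h.2 (Set.mem_biUnion (by simpa using hn) hj)
          simp [one, this]
        · refine Filter.Eventually.of_forall (fun n => ?_)
          have : x ∉ D n := fun h => hx h.1
          simp [one, this]
    rw [integral_zero] at lim
    obtain ⟨N, hN⟩ := Metric.tendsto_atTop.1 lim η hη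
    refine ⟨N, fun n hn => ?_⟩
    have h1 := hN n hn
    rw [Real.dist_eq, sub_zero] at h1
    have h2 := hc (one (D n)) (one_meas (mD n)) (one_abs _) ((le_abs_self _).trans h1.le)
    have h3 : ell v t (one (D n)) ≤ κ / 2 := by
      refine le_of_tendsto' (ell_tendsto hC (one_meas (mD n)) (one_abs _) ht) (fun m => ?_)
      refine le_trans (le_of_eq ?_) (h2 m t ht le_rfl)
      congr 1; ext x; rw [abs_of_nonneg (one_nonneg _ _)]
    have h4 := H.ell_nonneg hC (one_meas (mD n)) (one_abs _) (fun x _ => one_nonneg _ x) ht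
    rw [Real.dist_eq, sub_zero, abs_of_nonneg h4]; linarith
  have := (tendsto_const_nhds (x := ell v t (one U))).sub e3
  rw [sub_zero] at this
  refine this.congr (fun n => ?_)
  rw [e1 n, e2 n]; ring

end UFam
open MeasureTheory

namespace UFam
variable {v : ℕ → ℝ → ℝ → ℝ} {M : ℝ}

/-- Limit measures. -/
lemma exists_measure (H : UFam v M) (hC : Cau v) {t : ℝ} (ht : 0 ≤ t) :
    ∃ ν : Measure ℝ, ∀ A, MeasurableSet A → ν A = ENNReal.ofReal (ell v t (one A)) := by
  refine ⟨Measure.ofMeasurable (fun A _ => ENNReal.ofReal (ell v t (one A))) ?_ ?_, ?_⟩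
  · have : ell v t (one ∅) = 0 := by
      unfold ell one; simp [Filter.Tendsto.limUnder_eq tendsto_const_nhds]
    simp [this]
  · intro f hf hd
    have hs := H.ell_hasSum hC ht hf hd
    rw [← hs.tsum_eq, ENNReal.ofReal_tsum_of_nonneg]
    · exact fun i => H.ell_nonneg hC (one_meas (hf i)) (one_abs _) (fun x _ => one_nonneg _ x) ht
    · exact hs.summable
  · intro A hA
    rw [Measure.ofMeasurable_apply A hA]

/-- A measure representing indicator pairings represents all bounded pairings. -/
lemma measure_int (H : UFam v M) (hC : Cau v) {t : ℝ} (ht : 0 ≤ t) {ν : Measure ℝ} [IsFiniteMeasure ν]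
    (hν : ∀ A, MeasurableSet A → ν A = ENNReal.ofReal (ell v t (one A)))
    {φ : ℝ → ℝ} {B : ℝ} (hm : Measurable φ) (hB : ∀ x, |φ x| ≤ B) : ∫ x, φ x ∂ν = ell v t φ := by
  have hM := H.M_nonneg
  have B0 : 0 ≤ B := (abs_nonneg _).trans (hB 0)
  have hνr : ∀ A, MeasurableSet A → ν.real A = ell v t (one A) := by
    intro A hA
    rw [Measure.real, hν A hA, ENNReal.toReal_ofReal]
    exact H.ell_nonneg hC (one_meas hA) (one_abs _) (fun x _ => one_nonneg _ x) ht
  have hνM : ν.real Set.univ ≤ M := by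
    rw [hνr _ MeasurableSet.univ]
    refine H.ell_le hC (one_meas MeasurableSet.univ) (one_abs _) (fun x hx => ?_) ht
    linarith [one_le Set.univ x]
  have key : ∀ n : ℕ, 0 < n → |(∫ x, φ x ∂ν) - ell v t φ| ≤ 2 * M / n := by
    intro n hn
    have hn' : (0:ℝ) < n := by exact_mod_cast hn
    set A : ℤ → Set ℝ := fun k => {x | ⌊(n:ℝ) * φ x⌋ = k} with hA
    have mA : ∀ k, MeasurableSet (A k) := fun k =>
      (Int.measurable_floor.comp (hm.const_mul (n:ℝ))) (measurableSet_singleton k)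
    set s : Finset ℤ := Finset.Icc (-⌈(n:ℝ) * B⌉ - 1) ⌈(n:ℝ) * B⌉ with hs
    set ψ : ℝ → ℝ := fun x => ∑ k ∈ s, ((k:ℝ) / n) * one (A k) x with hψ
    have ψe : ∀ x, ψ x = (⌊(n:ℝ) * φ x⌋ : ℝ) / n := by
      intro x
      rw [hψ]; simp only
      rw [Finset.sum_eq_single ⌊(n:ℝ) * φ x⌋]
      · simp [one, hA]
      · intro k _ hk
        have : x ∉ A k := fun h => hk h.symm
        simp [one, this]
      · intro hk
        exfalso; apply hk
        rw [hs, Finset.mem_Icc]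
        have b1 : (n:ℝ) * φ x ≤ n * B := mul_le_mul_of_nonneg_left (abs_le.1 (hB x)).2 hn'.le
        have b2 : -(n * B) ≤ (n:ℝ) * φ x := by nlinarith [(abs_le.1 (hB x)).1]
        have b3 := Int.le_ceil ((n:ℝ) * B)
        constructor
        · rw [Int.le_floor]; push_cast; linarith
        · have : (⌊(n:ℝ) * φ x⌋ : ℝ) ≤ (⌈(n:ℝ) * B⌉ : ℝ) := (Int.floor_le _).trans (b1.trans b3)
          exact_mod_cast this
    have ψd : ∀ x, |φ x - ψ x| ≤ 1 / n := by
      intro x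
      rw [ψe]
      have a1 := Int.floor_le ((n:ℝ) * φ x)
      have a2 := Int.lt_floor_add_one ((n:ℝ) * φ x)
      have : φ x - (⌊(n:ℝ) * φ x⌋ : ℝ) / n = ((n:ℝ) * φ x - ⌊(n:ℝ) * φ x⌋) / n := by field_simp
      rw [this, abs_div, abs_of_pos hn', div_le_div_iff_of_pos_right hn', abs_le]
      constructor <;> linarith
    have ψm : Measurable ψ := Finset.measurable_sum s (fun k _ => (one_meas (mA k)).const_mul _)
    have ψb : ∀ x, |ψ x| ≤ B + 1 / n := by
      intro x
      have := abs_le.1 (ψd x)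
      have := abs_le.1 (hB x)
      rw [abs_le]; constructor <;> linarith
    have e1 : ell v t ψ = ∑ k ∈ s, ((k:ℝ) / n) * ell v t (one (A k)) :=
      H.ell_sum hC s _ (fun k => one (A k)) (fun k => one_meas (mA k)) (fun k => one_abs _) ht
    have e2 : ∫ x, ψ x ∂ν = ∑ k ∈ s, ((k:ℝ) / n) * ell v t (one (A k)) := by
      rw [hψ, integral_finsetSum]
      · refine Finset.sum_congr rfl (fun k _ => ?_)
        rw [integral_const_mul]
        unfold one
        rw [integral_indicator_const _ (mA k), hνr _ (mA k)]
        simp [one]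
      · intro k _
        refine Integrable.const_mul ?_ _
        exact Integrable.of_bound (one_meas (mA k)).aestronglyMeasurable 1 (ae_of_all _ (fun x => by simpa using one_abs _ x))
    have iφ : Integrable φ ν := Integrable.of_bound hm.aestronglyMeasurable B (ae_of_all _ (fun x => by simpa using hB x))
    have iψ : Integrable ψ ν := Integrable.of_bound ψm.aestronglyMeasurable (B + 1/n) (ae_of_all _ (fun x => by simpa using ψb x))
    have d1 : |(∫ x, φ x ∂ν) - ∫ x, ψ x ∂ν| ≤ 1 / n * M := by
      rw [← integral_sub iφ iψ]
      have := norm_integral_le_of_norm_le_const (μ := ν) (f := fun x => φ x - ψ x) (C := 1 / n)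
        (ae_of_all _ (fun x => ψd x))
      exact this.trans (mul_le_mul_of_nonneg_left hνM (by positivity))
    have d2 : |ell v t φ - ell v t ψ| ≤ 1 / n * M := H.ell_diff hC hm hB ψm ψb ψd ht
    have : 2 * M / n = 1 / n * M + 1 / n * M := by ring
    rw [this]
    rw [e2, ← e1] at d1
    have c1 := abs_le.1 d1
    have c2 := abs_le.1 d2
    rw [abs_le]; constructor <;> linarith [c1.1, c1.2, c2.1, c2.2]
  have lim : Filter.Tendsto (fun n : ℕ => 2 * M / (n:ℝ)) Filter.atTop (nhds 0) :=
    tendsto_const_div_atTop_nhds_zero_nat _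
  have : |(∫ x, φ x ∂ν) - ell v t φ| ≤ 0 := by
    refine ge_of_tendsto lim ?_
    filter_upwards [Filter.eventually_gt_atTop 0] with n hn
    exact key n hn
  exact sub_eq_zero.1 (abs_eq_zero.1 (le_antisymm this (abs_nonneg _)))

set_option maxHeartbeats 2000000 in
lemma limit (H : UFam v M) (hC : Cau v) : ∃ ρ : ℝ → ℝ → ℝ, Measurable (Function.uncurry ρ) ∧
    (∀ t x, 0 ≤ ρ t x) ∧ (∀ t, ρ t = ρ (max t 0)) ∧ (∀ t, IntegrableOn (fun x => (1 + x) * ρ t x) (Set.Ioi 0)) ∧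
    (∀ t, ∫ x in Set.Ioi (0:ℝ), (1 + x) * ρ t x ≤ M) ∧
    (∀ (φ : ℝ → ℝ) (B : ℝ), Measurable φ → (∀ x, |φ x| ≤ B) → ∀ t, 0 ≤ t →
      ∫ x in Set.Ioi (0:ℝ), φ x * ρ t x = ell v t φ) := by
  have hM := H.M_nonneg
  choose ν0 hν0 using fun t : ℝ => H.exists_measure hC (le_max_right t 0)
  have hνuniv : ∀ t, ν0 t Set.univ ≤ ENNReal.ofReal M := by
    intro t
    rw [hν0 t _ MeasurableSet.univ]
    refine ENNReal.ofReal_le_ofReal ?_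
    refine H.ell_le hC (one_meas MeasurableSet.univ) (one_abs _) (fun x hx => ?_) (le_max_right t 0)
    linarith [one_le Set.univ x]
  have hmk : Measurable ν0 := by
    refine Measure.measurable_of_measurable_coe _ (fun A hA => ?_)
    simp_rw [hν0 _ A hA]
    exact (H.ell_cont hC (one_meas hA) (one_abs _)).measurable.ennreal_ofReal
  set κ : ProbabilityTheory.Kernel ℝ ℝ := ⟨ν0, hmk⟩ with hκ
  have hκt : ∀ t, κ t = ν0 t := fun t => rfl
  have : ProbabilityTheory.IsFiniteKernel κ := ⟨⟨ENNReal.ofReal M, ENNReal.ofReal_lt_top, hνuniv⟩⟩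
  set η : ProbabilityTheory.Kernel ℝ ℝ := ProbabilityTheory.Kernel.const ℝ (ProbabilityTheory.gaussianReal 0 1) with hη
  have hac0 : ∀ t A, MeasurableSet A → volume (A ∩ Set.Ioi 0) = 0 → ν0 t A = 0 := by
    intro t A hA h0
    rw [hν0 t A hA]
    have : ell v (max t 0) (one A) = 0 := by
      refine tendsto_nhds_unique (ell_tendsto hC (one_meas hA) (one_abs _) (le_max_right t 0)) ?_
      refine tendsto_const_nhds.congr (fun n => ?_)
      symm
      rw [setIntegral_eq_zero_iff_of_nonneg_ae]
      · have h1 : ∀ᵐ x ∂(volume.restrict (Set.Ioi (0:ℝ))), x ∉ A := by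
          rw [ae_iff]
          simp only [not_not, Set.ofPred_mem_eq]
          rw [Measure.restrict_apply hA]; exact h0
        filter_upwards [h1] with x hx
        simp [one, hx]
      · exact ae_of_all _ (fun x => mul_nonneg (one_nonneg _ _) (H.nonneg _ _ _))
      · exact H.intφ n _ (one_meas hA) (one_abs _)
    rw [this]; simp
  have hac : ∀ t, κ t ≪ η t := by
    intro t
    refine Measure.AbsolutelyContinuous.mk (fun A hA h0 => ?_)
    rw [hη, ProbabilityTheory.Kernel.const_apply] at h0
    have := ProbabilityTheory.gaussianReal_absolutelyContinuous' 0 (v := 1) one_ne_zero h0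
    exact hac0 t A hA (measure_mono_null Set.inter_subset_left this)
  set d : ℝ → ℝ → ENNReal := fun t => ProbabilityTheory.gaussianPDF 0 1 * κ.rnDeriv η t with hd
  have mrn : Measurable (Function.uncurry (κ.rnDeriv η)) :=
    (κ.measurable_rnDeriv η)
  have md : Measurable (Function.uncurry d) := by
    have : Function.uncurry d = fun p => ProbabilityTheory.gaussianPDF 0 1 p.2 * Function.uncurry (κ.rnDeriv η) p := by
      ext p; rfl
    rw [this]
    exact ((ProbabilityTheory.measurable_gaussianPDF 0 1).comp measurable_snd).mul mrn
  have hdν : ∀ t, volume.withDensity (d t) = ν0 t := by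
    intro t
    rw [hd]
    simp only
    rw [withDensity_mul _ (ProbabilityTheory.measurable_gaussianPDF 0 1) (κ.measurable_rnDeriv_right η t),
      ← ProbabilityTheory.gaussianReal_of_var_ne_zero 0 one_ne_zero]
    have := ProbabilityTheory.Kernel.withDensity_rnDeriv_eq (hac t)
    rw [ProbabilityTheory.Kernel.withDensity_apply _ mrn] at this
    exact this
  clear_value d
  have : ∀ t, IsFiniteMeasure (ν0 t) := fun t => ⟨(hνuniv t).trans_lt ENNReal.ofReal_lt_top⟩
  have mdt : ∀ t, Measurable (d t) := fun t => md.comp (by fun_prop : Measurable fun x => (t, x))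
  have dfin : ∀ t, ∀ᵐ x, d t x < ⊤ := by
    intro t
    refine ae_lt_top (mdt t) ?_
    rw [← setLIntegral_univ, ← withDensity_apply _ MeasurableSet.univ, hdν]
    exact measure_ne_top _ _
  have rep : ∀ (φ : ℝ → ℝ) (B : ℝ), Measurable φ → (∀ x, |φ x| ≤ B) → ∀ t,
      ∫ x in Set.Ioi (0:ℝ), φ x * (d t x).toReal = ell v (max t 0) φ := by
    intro φ B hm hB t
    have m1 : Measurable ((Set.Ioi (0:ℝ)).indicator φ) := hm.indicator measurableSet_Ioi
    have b1 : ∀ x, |(Set.Ioi (0:ℝ)).indicator φ x| ≤ B := by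
      intro x
      by_cases hx : x ∈ Set.Ioi (0:ℝ)
      · rw [Set.indicator_of_mem hx]; exact hB x
      · rw [Set.indicator_of_notMem hx, abs_zero]; exact (abs_nonneg _).trans (hB 0)
    have e1 := H.measure_int hC (le_max_right t 0) (hν0 t) m1 b1
    rw [← hdν t, integral_withDensity_eq_integral_toReal_smul (mdt t) (dfin t)] at e1
    rw [← integral_indicator measurableSet_Ioi]
    have e2 : ell v (max t 0) ((Set.Ioi (0:ℝ)).indicator φ) = ell v (max t 0) φ :=
      ell_congr (fun x hx => Set.indicator_of_mem hx φ) _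
    rw [← e2, ← e1]
    congr 1; ext x
    by_cases hx : x ∈ Set.Ioi (0:ℝ)
    · simp only [Set.indicator_of_mem hx, smul_eq_mul]; ring
    · simp only [Set.indicator_of_notMem hx, smul_zero]
  have lint : ∀ t, ∫⁻ x in Set.Ioi (0:ℝ), ENNReal.ofReal ((1 + x) * (d t x).toReal) ≤ ENNReal.ofReal M := by
    intro t
    have mono := lintegral_tendsto_of_tendsto_of_monotone (μ := volume.restrict (Set.Ioi (0:ℝ)))
      (f := fun k : ℕ => fun x => ENNReal.ofReal (min (max (1 + x) 0) k * (d t x).toReal))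
      (F := fun x => ENNReal.ofReal ((1 + x) * (d t x).toReal))
      (fun k => ?_) ?_ ?_
    · refine le_of_tendsto' mono (fun k => ?_)
      have mφ : Measurable (fun x : ℝ => min (max (1 + x) 0) (k:ℝ)) := by fun_prop
      have bφ : ∀ x : ℝ, |min (max (1 + x) 0) (k:ℝ)| ≤ k := by
        intro x
        rw [abs_of_nonneg (le_min (le_max_right _ _) (Nat.cast_nonneg k))]
        exact min_le_right _ _
      have i1 : IntegrableOn (fun x => min (max (1 + x) 0) (k:ℝ) * (d t x).toReal) (Set.Ioi 0) := by
        have : Integrable (fun x => (d t x).toReal) := by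
          refine integrable_toReal_of_lintegral_ne_top (mdt t).aemeasurable ?_
          rw [← setLIntegral_univ, ← withDensity_apply _ MeasurableSet.univ, hdν]
          exact measure_ne_top _ _
        exact (this.integrableOn (s := Set.Ioi 0)).bdd_mul (c := k) mφ.aestronglyMeasurable
          (ae_of_all _ (fun x => bφ x))
      rw [← ofReal_integral_eq_lintegral_ofReal i1
        (ae_of_all _ (fun x => mul_nonneg (le_min (le_max_right _ _) (Nat.cast_nonneg k)) ENNReal.toReal_nonneg)),
        rep _ k mφ bφ t]
      refine ENNReal.ofReal_le_ofReal (H.ell_le hC mφ bφ (fun x hx => ?_) (le_max_right t 0))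
      exact (min_le_left _ _).trans (max_le le_rfl (by linarith))
    · have : Measurable (fun x => min (max (1 + x) 0) (k:ℝ) * (d t x).toReal) :=
        (by fun_prop : Measurable fun x : ℝ => min (max (1 + x) 0) (k:ℝ)).mul (mdt t).ennreal_toReal
      exact this.ennreal_ofReal.aemeasurable
    · refine ae_of_all _ (fun x k l hkl => ?_)
      refine ENNReal.ofReal_le_ofReal (mul_le_mul_of_nonneg_right ?_ ENNReal.toReal_nonneg)
      exact min_le_min_left _ (by exact_mod_cast hkl)
    · refine ae_restrict_of_forall_mem measurableSet_Ioi (fun x hx => ?_)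
      have hx0 : 0 < x := hx
      refine tendsto_const_nhds.congr' ?_
      filter_upwards [Filter.eventually_ge_atTop ⌈1 + x⌉₊] with k hk
      have : 1 + x ≤ k := (Nat.le_ceil _).trans (by exact_mod_cast hk)
      rw [max_eq_left (by linarith), min_eq_left this]
  have mF : ∀ t, Measurable (fun x => (1 + x) * (d t x).toReal) := fun t =>
    (by fun_prop : Measurable fun x : ℝ => 1 + x).mul (mdt t).ennreal_toReal
  have F0 : ∀ t, 0 ≤ᵐ[volume.restrict (Set.Ioi (0:ℝ))] (fun x => (1 + x) * (d t x).toReal) := fun t =>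
    ae_restrict_of_forall_mem measurableSet_Ioi (fun x hx => by
      have hx0 : 0 < x := hx
      have : 0 ≤ (d t x).toReal := ENNReal.toReal_nonneg
      show 0 ≤ (1 + x) * (d t x).toReal
      positivity)
  have FI : ∀ t, IntegrableOn (fun x => (1 + x) * (d t x).toReal) (Set.Ioi 0) := by
    intro t
    refine ⟨(mF t).aestronglyMeasurable, ?_⟩
    rw [hasFiniteIntegral_iff_ofReal (F0 t)]
    exact (lint t).trans_lt ENNReal.ofReal_lt_top
  refine ⟨fun t x => (d (max t 0) x).toReal, ?_, fun t x => ENNReal.toReal_nonneg, ?_, fun t => FI _, fun t => ?_, ?_⟩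
  · have : Measurable (fun p : ℝ × ℝ => Function.uncurry d (max p.1 0, p.2)) := md.comp (by fun_prop)
    exact this.ennreal_toReal
  · intro t; simp
  · rw [integral_eq_lintegral_of_nonneg_ae (F0 _) (mF _).aestronglyMeasurable]
    exact ENNReal.toReal_le_of_le_ofReal hM (lint _)
  · intro φ B hm hB t ht
    have := rep φ B hm hB t
    rw [max_eq_left ht] at this
    simp only [max_eq_left ht]
    exact this

end UFam
open MeasureTheory

/-- Step densities. -/
noncomputable def uFn (F : ℝ → ℕ → ℝ → ℝ) (ε : ℕ → ℝ) (n : ℕ) (t x : ℝ) : ℝ := F (ε n) (idx (ε n) x) t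

namespace RbkFam
variable {K : ℝ → ℝ → ℝ} {F : ℝ → ℕ → ℝ → ℝ} {M CK R1 : ℝ} {tl : ℝ → ℝ}

lemma F_summable (H : RbkFam K F M CK R1 tl) {e : ℝ} (h0 : 0 < e) (h1 : e < 1) (t : ℝ) :
    Summable (fun i => F e i t) := by
  refine Summable.of_nonneg_of_le (fun i => H.F_nonneg e h0 h1 i t) (fun i => ?_) (H.F_sum e h0 h1 t)
  have := H.F_nonneg e h0 h1 i t
  have : 0 ≤ e * (i:ℝ) := by positivity
  nlinarith

lemma F_summable_mul (H : RbkFam K F M CK R1 tl) {e : ℝ} (h0 : 0 < e) (h1 : e < 1) (t : ℝ) {w : ℕ → ℝ} {B : ℝ}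
    (hw : ∀ i, |w i| ≤ B) : Summable (fun i => w i * F e i t) := by
  refine Summable.of_norm_bounded ((H.F_summable h0 h1 t).mul_left B) (fun i => ?_)
  rw [norm_mul, Real.norm_eq_abs, Real.norm_eq_abs, abs_of_nonneg (H.F_nonneg e h0 h1 i t)]
  exact mul_le_mul_of_nonneg_right (hw i) (H.F_nonneg e h0 h1 i t)

lemma F_step_int (H : RbkFam K F M CK R1 tl) {e : ℝ} (h0 : 0 < e) (h1 : e < 1) (t : ℝ) {w : ℕ → ℝ} {B : ℝ}
    (hw : ∀ i, |w i| ≤ B) : IntegrableOn (fun x => w (idx e x) * F e (idx e x) t) (Set.Ioi 0) ∧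
      ∫ x in Set.Ioi (0:ℝ), w (idx e x) * F e (idx e x) t = e * ∑' i, w i * F e i t :=
  idx_int h0 (g := fun i => w i * F e i t) (by simp [H.F_zero]) (H.F_summable_mul h0 h1 t hw)

lemma Lam_eq (H : RbkFam K F M CK R1 tl) {e : ℝ} (h0 : 0 < e) (h1 : e < 1) (t : ℝ) {φ : ℝ → ℝ} {B : ℝ}
    (hw : ∀ x, |φ x| ≤ B) : IntegrableOn (fun x => φ (e * idx e x) * F e (idx e x) t) (Set.Ioi 0) ∧
      ∫ x in Set.Ioi (0:ℝ), φ (e * idx e x) * F e (idx e x) t = Lam F e φ t := by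
  have := H.F_step_int h0 h1 t (w := fun i => φ (e * i)) (fun i => hw _)
  refine ⟨this.1, this.2.trans ?_⟩
  unfold Lam
  rw [← tsum_mul_left]
  congr 1; ext i; ring

lemma u_meas (F : ℝ → ℕ → ℝ → ℝ) (e t : ℝ) : Measurable (fun x => F e (idx e x) t) :=
  (measurable_from_nat (f := fun i => F e i t)).comp (idx_meas e)

lemma u_int (H : RbkFam K F M CK R1 tl) {e : ℝ} (h0 : 0 < e) (h1 : e < 1) (t : ℝ) :
    IntegrableOn (fun x => (1 + x) * F e (idx e x) t) (Set.Ioi 0) ∧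
      ∫ x in Set.Ioi (0:ℝ), (1 + x) * F e (idx e x) t ≤ 2 * M := by
  have k := idx_int h0 (g := fun i => (1 + e * (i:ℝ)) * F e i t) (by simp [H.F_zero]) (H.F_sum e h0 h1 t)
  have i2 : IntegrableOn (fun x => 2 * ((1 + e * (idx e x : ℝ)) * F e (idx e x) t)) (Set.Ioi 0) := k.1.const_mul 2
  have le : ∀ x, 0 < x → (1 + x) * F e (idx e x) t ≤ 2 * ((1 + e * (idx e x : ℝ)) * F e (idx e x) t) := by
    intro x hx
    have hF := H.F_nonneg e h0 h1 (idx e x) t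
    rcases Nat.eq_zero_or_pos (idx e x) with h | h
    · rw [h, H.F_zero]; simp
    · have h' : (1:ℝ) ≤ idx e x := by exact_mod_cast h
      have := abs_le.1 (idx_close h0 hx)
      have : e ≤ e * (idx e x : ℝ) := by nlinarith
      have : 1 + x ≤ 2 * (1 + e * (idx e x : ℝ)) := by linarith
      nlinarith
  have i1 : IntegrableOn (fun x => (1 + x) * F e (idx e x) t) (Set.Ioi 0) := by
    refine i2.mono' ((by fun_prop : Measurable fun x : ℝ => 1 + x).mul (u_meas F e t)).aestronglyMeasurable ?_
    refine ae_restrict_of_forall_mem measurableSet_Ioi (fun x hx => ?_)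
    have hx0 : (0:ℝ) < x := hx
    have := H.F_nonneg e h0 h1 (idx e x) t
    rw [Real.norm_eq_abs, abs_of_nonneg (by positivity)]
    exact le x hx
  refine ⟨i1, (setIntegral_mono_on i1 i2 measurableSet_Ioi (fun x hx => le x hx)).trans ?_⟩
  rw [integral_const_mul, k.2]
  linarith [H.F_mass e h0 h1 t]

lemma u_one (H : RbkFam K F M CK R1 tl) {e : ℝ} (h0 : 0 < e) (h1 : e < 1) (t : ℝ) :
    IntegrableOn (fun x => F e (idx e x) t) (Set.Ioi 0) ∧ ∫ x in Set.Ioi (0:ℝ), F e (idx e x) t ≤ M := by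
  have k := idx_int h0 (g := fun i => F e i t) (H.F_zero _ _) (H.F_summable h0 h1 t)
  refine ⟨k.1, ?_⟩
  rw [k.2]
  refine le_trans (mul_le_mul_of_nonneg_left ?_ h0.le) (H.F_mass e h0 h1 t)
  have key : ∀ i : ℕ, F e i t ≤ (1 + e * (i:ℝ)) * F e i t := by
    intro i
    have := H.F_nonneg e h0 h1 i t
    have : 0 ≤ e * (i:ℝ) := by positivity
    nlinarith
  exact Summable.tsum_le_tsum key (H.F_summable h0 h1 t) (H.F_sum e h0 h1 t)

lemma Lam_close (H : RbkFam K F M CK R1 tl) {φ : ℝ → ℝ} (hφ : IsTF φ) {η : ℝ} (hη : 0 < η) :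
    ∃ δ, 0 < δ ∧ ∀ e, 0 < e → e < 1 → e < δ → ∀ t,
      |(∫ x in Set.Ioi (0:ℝ), φ x * F e (idx e x) t) - Lam F e φ t| ≤ η := by
  have hM := H.M_nonneg
  obtain ⟨δ, hδ, hu⟩ := hφ.unif (η := η / (M + 1)) (by positivity)
  obtain ⟨B, hB0, hB⟩ := hφ.bdd
  refine ⟨δ, hδ, fun e h0 h1 he t => ?_⟩
  have L := H.Lam_eq h0 h1 t hB
  have U := H.u_one h0 h1 t
  have i1 : IntegrableOn (fun x => φ x * F e (idx e x) t) (Set.Ioi 0) :=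
    U.1.bdd_mul (c := B) hφ.1.measurable.aestronglyMeasurable (ae_of_all _ (fun x => by simpa using hB x))
  rw [← L.2, ← integral_sub i1 L.1]
  have : ‖∫ x in Set.Ioi (0:ℝ), (φ x * F e (idx e x) t - φ (e * idx e x) * F e (idx e x) t)‖ ≤
      ∫ x in Set.Ioi (0:ℝ), (η / (M + 1)) * F e (idx e x) t := by
    refine norm_integral_le_of_norm_le (U.1.const_mul _) ?_
    refine ae_restrict_of_forall_mem measurableSet_Ioi (fun x hx => ?_)
    have hF := H.F_nonneg e h0 h1 (idx e x) t
    rw [← sub_mul, norm_mul, Real.norm_eq_abs, Real.norm_eq_abs, abs_of_nonneg hF]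
    refine mul_le_mul_of_nonneg_right (hu _ _ ?_) hF
    rw [abs_sub_comm]
    exact (idx_close h0 hx).trans_lt (by linarith)
  rw [integral_const_mul] at this
  refine this.trans ((mul_le_mul_of_nonneg_left U.2 (by positivity)).trans ?_)
  rw [div_mul_eq_mul_div, div_le_iff₀ (by positivity)]
  nlinarith

lemma uFam (H : RbkFam K F M CK R1 tl) {ε : ℕ → ℝ} (h0 : ∀ n, 0 < ε n) (h1 : ∀ n, ε n < 1)
    (hl : Filter.Tendsto ε Filter.atTop (nhds 0)) : UFam (uFn F ε) (2 * M) where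
  meas n t := u_meas F (ε n) t
  nonneg n t x := H.F_nonneg _ (h0 n) (h1 n) _ _
  int n t := (H.u_int (h0 n) (h1 n) t).1
  mass n t := (H.u_int (h0 n) (h1 n) t).2
  UI T κ hT hκ := by
    obtain ⟨L, hL, hUI⟩ := H.UI hT hκ
    refine ⟨L, hL, fun n t ht htT => ?_⟩
    have s : Summable (fun i => max (F (ε n) i t - L) 0) := by
      refine Summable.of_nonneg_of_le (fun i => le_max_right _ _) (fun i => ?_) (H.F_summable (h0 n) (h1 n) t)
      exact max_le (by linarith) (H.F_nonneg _ (h0 n) (h1 n) _ _)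
    have k := idx_int (h0 n) (g := fun i => max (F (ε n) i t - L) 0)
      (by simp [H.F_zero, hL.le]) s
    refine (le_of_eq k.2).trans ?_
    rw [← tsum_mul_left]
    refine Summable.tsum_le_of_sum_range_le (s.mul_left _) (fun m => ?_)
    exact hUI (ε n) (h0 n) (h1 n) t ht htT m
  EC φ hφ T κ hT hκ := by
    obtain ⟨δ, hδ, hE⟩ := H.equicont hφ hT (κ := κ / 3) (by positivity)
    obtain ⟨d, hd, hL⟩ := H.Lam_close hφ (η := κ / 3) (by positivity)
    obtain ⟨N, hN⟩ := Filter.eventually_atTop.1 (hl.eventually (gt_mem_nhds hd))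
    refine ⟨δ, hδ, N, fun n hn s t hs hst ht hts => ?_⟩
    have a := abs_le.1 (hE (ε n) (h0 n) (h1 n) s t hs hst ht hts)
    have b := abs_le.1 (hL (ε n) (h0 n) (h1 n) (hN n hn) s)
    have c := abs_le.1 (hL (ε n) (h0 n) (h1 n) (hN n hn) t)
    unfold uFn
    rw [abs_le]; constructor <;> linarith [a.1, a.2, b.1, b.2, c.1, c.2]

/-- Subsequence and limit. -/
lemma exists_limit (H : RbkFam K F M CK R1 tl) : ∃ ε : ℕ → ℝ, (∀ n, 0 < ε n) ∧ (∀ n, ε n < 1) ∧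
    Filter.Tendsto ε Filter.atTop (nhds 0) ∧ UFam.Cau (uFn F ε) := by
  set e : ℕ → ℝ := fun n => 1 / ((n:ℝ) + 2) with he
  have e0 : ∀ n, 0 < e n := fun n => by positivity
  have e1 : ∀ n, e n < 1 := fun n => by
    rw [he]; simp only; rw [div_lt_one (by positivity)]
    have : (0:ℝ) ≤ n := Nat.cast_nonneg n
    linarith
  have el : Filter.Tendsto e Filter.atTop (nhds 0) := by
    have := (tendsto_const_div_atTop_nhds_zero_nat (1:ℝ)).comp (Filter.tendsto_add_atTop_nat 2)
    refine this.congr (fun n => ?_)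
    simp [he]
  obtain ⟨σ, hσ, h⟩ := (H.uFam e0 e1 el).extract
  exact ⟨fun n => e (σ n), fun n => e0 _, fun n => e1 _, el.comp hσ.tendsto_atTop, h⟩

end RbkFam
open MeasureTheory

/-- clamp to the unit interval -/
noncomputable def clp (z : ℝ) : ℝ := max 0 (min z 1)

lemma clp_mono : Monotone clp := fun _ _ h => max_le_max_left _ (min_le_min_right _ h)
lemma clp_nonneg (z : ℝ) : 0 ≤ clp z := le_max_left _ _
lemma clp_le (z : ℝ) : clp z ≤ 1 := max_le zero_le_one (min_le_right _ _)
lemma clp_zero {z : ℝ} (h : z ≤ 0) : clp z = 0 := max_eq_left ((min_le_left _ _).trans h)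
lemma clp_one {z : ℝ} (h : 1 ≤ z) : clp z = 1 := by
  unfold clp; rw [min_eq_right h, max_eq_right zero_le_one]
lemma clp_cont : Continuous clp := by unfold clp; fun_prop

/-- hat functions -/
noncomputable def hat (δ : ℝ) (i : ℕ) (x : ℝ) : ℝ := clp (x / δ - i + 1) - clp (x / δ - i)

lemma hat_nonneg (δ : ℝ) (i : ℕ) (x : ℝ) : 0 ≤ hat δ i x := sub_nonneg.2 (clp_mono (by linarith))

lemma hat_le (δ : ℝ) (i : ℕ) (x : ℝ) : hat δ i x ≤ 1 := by
  unfold hat; linarith [clp_nonneg (x / δ - i), clp_le (x / δ - i + 1)]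

lemma hat_abs (δ : ℝ) (i : ℕ) (x : ℝ) : |hat δ i x| ≤ 1 := by
  rw [abs_of_nonneg (hat_nonneg _ _ _)]; exact hat_le _ _ _

lemma hat_cont (δ : ℝ) (i : ℕ) : Continuous (hat δ i) := by
  unfold hat
  exact (clp_cont.comp (by fun_prop)).sub (clp_cont.comp (by fun_prop))

lemma hat_sum (δ : ℝ) (N : ℕ) (x : ℝ) :
    ∑ i ∈ Finset.range N, hat δ i x = clp (x / δ + 1) - clp (x / δ - N + 1) := by
  induction N with
  | zero => simp
  | succ n ih => rw [Finset.sum_range_succ, ih]; unfold hat; push_cast; ring_nf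

lemma hat_supp {δ : ℝ} (hδ : 0 < δ) {i : ℕ} {x : ℝ} (h : hat δ i x ≠ 0) : |x - δ * i| < δ := by
  have e : x / δ - i = (x - δ * i) / δ := by field_simp
  by_contra h'
  push Not at h'
  apply h
  unfold hat
  rw [e]
  rcases le_abs.1 h' with q | q
  · have : 1 ≤ (x - δ * i) / δ := by rw [le_div_iff₀ hδ]; linarith
    rw [clp_one this, clp_one (by linarith), sub_self]
  · have : (x - δ * i) / δ ≤ -1 := by rw [div_le_iff₀ hδ]; linarith
    rw [clp_zero (by linarith), clp_zero (by linarith), sub_self]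

lemma hat_TF {δ : ℝ} (hδ : 0 < δ) {i : ℕ} (hi : 2 ≤ i) : IsTF (hat δ i) := by
  have hi' : (2:ℝ) ≤ i := by exact_mod_cast hi
  refine ⟨hat_cont δ i, δ, δ * (i + 1), hδ, fun x hx => ?_, fun x hx => ?_⟩
  · by_contra h
    have := abs_lt.1 (hat_supp hδ h)
    nlinarith
  · by_contra h
    have := abs_lt.1 (hat_supp hδ h)
    nlinarith

lemma hat_approx {H : ℝ → ℝ → ℝ} {a b : ℝ} (h0a : 0 < a)
    (Hu : UniformContinuous (fun p : ℝ × ℝ => H p.1 p.2))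
    (H1 : ∀ x y, x ≤ a ∨ y ≤ a ∨ b ≤ x ∨ b ≤ y → H x y = 0) {η : ℝ} (hη : 0 < η) :
    ∃ δ, 0 < δ ∧ δ ≤ a ∧ ∃ N : ℕ, ∀ x y,
      |H x y - ∑ i ∈ Finset.range N, ∑ j ∈ Finset.range N, H (δ * i) (δ * j) * (hat δ i x * hat δ j y)| ≤ η := by
  obtain ⟨d, hd, hu⟩ := Metric.uniformContinuous_iff.1 Hu η hη
  set δ := min d a with hδe
  have hδ : 0 < δ := lt_min hd h0a
  obtain ⟨N, hN⟩ := exists_nat_gt (b / δ + 1)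
  refine ⟨δ, hδ, min_le_right _ _, N, fun x y => ?_⟩
  set S : ℝ → ℝ := fun x => ∑ i ∈ Finset.range N, hat δ i x with hS
  have S0 : ∀ x, 0 ≤ S x := fun x => Finset.sum_nonneg (fun i _ => hat_nonneg _ _ _)
  have S1 : ∀ x, S x ≤ 1 := fun x => by
    rw [hS]; simp only; rw [hat_sum]; linarith [clp_nonneg (x / δ - N + 1), clp_le (x / δ + 1)]
  have Se : ∀ x, 0 ≤ x → x ≤ b → S x = 1 := fun x hx hb => by
    rw [hS]; simp only; rw [hat_sum, clp_one, clp_zero, sub_zero]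
    · have : x / δ ≤ b / δ := div_le_div_of_nonneg_right hb hδ.le
      linarith
    · have : 0 ≤ x / δ := by positivity
      linarith
  have SS : ∑ i ∈ Finset.range N, ∑ j ∈ Finset.range N, H x y * (hat δ i x * hat δ j y) = H x y := by
    have : ∑ i ∈ Finset.range N, ∑ j ∈ Finset.range N, H x y * (hat δ i x * hat δ j y) = H x y * (S x * S y) := by
      rw [hS]; simp only; rw [Finset.sum_mul_sum, Finset.mul_sum]
      refine Finset.sum_congr rfl (fun i _ => ?_)
      rw [Finset.mul_sum]
    rw [this]
    by_cases h : x ≤ a ∨ y ≤ a ∨ b ≤ x ∨ b ≤ y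
    · rw [H1 x y h, zero_mul]
    · push Not at h
      rw [Se x (by linarith) (by linarith), Se y (by linarith) (by linarith)]; ring
  have : |H x y - ∑ i ∈ Finset.range N, ∑ j ∈ Finset.range N, H (δ * i) (δ * j) * (hat δ i x * hat δ j y)|
      ≤ ∑ i ∈ Finset.range N, ∑ j ∈ Finset.range N, η * (hat δ i x * hat δ j y) := by
    rw [← SS, ← Finset.sum_sub_distrib]
    refine (Finset.abs_sum_le_sum_abs _ _).trans (Finset.sum_le_sum (fun i _ => ?_))
    rw [← Finset.sum_sub_distrib]
    refine (Finset.abs_sum_le_sum_abs _ _).trans (Finset.sum_le_sum (fun j _ => ?_))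
    rw [← sub_mul, abs_mul, abs_of_nonneg (mul_nonneg (hat_nonneg _ _ _) (hat_nonneg _ _ _))]
    by_cases h1 : hat δ i x = 0
    · simp [h1]
    by_cases h2 : hat δ j y = 0
    · simp [h2]
    refine mul_le_mul_of_nonneg_right ?_ (mul_nonneg (hat_nonneg _ _ _) (hat_nonneg _ _ _))
    have k1 := (hat_supp hδ h1).trans_le (min_le_left d a)
    have k2 := (hat_supp hδ h2).trans_le (min_le_left d a)
    have := hu (a := (x, y)) (b := (δ * i, δ * j)) (by
      rw [Prod.dist_eq]; exact max_lt k1 k2)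
    exact this.le
  refine this.trans ?_
  have : ∑ i ∈ Finset.range N, ∑ j ∈ Finset.range N, η * (hat δ i x * hat δ j y) = η * (S x * S y) := by
    rw [hS]; simp only; rw [Finset.sum_mul_sum, Finset.mul_sum]
    refine Finset.sum_congr rfl (fun i _ => ?_)
    rw [Finset.mul_sum]
  rw [this]
  have : S x * S y ≤ 1 := mul_le_one₀ (S1 x) (S0 y) (S1 y)
  nlinarith

/-- Quadratic convergence. -/
lemma quad_tendsto {m : ℕ → ℕ → ℝ} {z : ℕ → ℕ → ℝ} {M : ℝ} {ρ : ℝ → ℝ}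
    (m0 : ∀ n i, 0 ≤ m n i) (ms : ∀ n, Summable (m n)) (mM : ∀ n, ∑' i, m n i ≤ M)
    (ρ0 : ∀ x, 0 ≤ ρ x) (ρi : IntegrableOn ρ (Set.Ioi 0))
    (hl : ∀ φ, IsTF φ → Filter.Tendsto (fun n => ∑' i, m n i * φ (z n i)) Filter.atTop
      (nhds (∫ x in Set.Ioi (0:ℝ), φ x * ρ x)))
    {H : ℝ → ℝ → ℝ} {a b : ℝ} (h0a : 0 < a)
    (Hu : UniformContinuous (fun p : ℝ × ℝ => H p.1 p.2))
    (H1 : ∀ x y, x ≤ a ∨ y ≤ a ∨ b ≤ x ∨ b ≤ y → H x y = 0) :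
    Filter.Tendsto (fun n => ∑' p : ℕ × ℕ, m n p.1 * m n p.2 * H (z n p.1) (z n p.2)) Filter.atTop
      (nhds (∫ p, H p.1 p.2 * (ρ p.1 * ρ p.2) ∂((volume.restrict (Set.Ioi (0:ℝ))).prod (volume.restrict (Set.Ioi (0:ℝ)))))) := by
  set lam := volume.restrict (Set.Ioi (0:ℝ)) with hlam
  have M0 : 0 ≤ M := (tsum_nonneg (m0 0)).trans (mM 0)
  set M' := ∫ x, ρ x ∂lam with hM'
  have M'0 : 0 ≤ M' := integral_nonneg ρ0
  have pi : Integrable (fun p : ℝ × ℝ => ρ p.1 * ρ p.2) (lam.prod lam) := Integrable.mul_prod ρi ρi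
  have pM : ∫ p : ℝ × ℝ, ρ p.1 * ρ p.2 ∂(lam.prod lam) = M' * M' := integral_prod_mul ρ ρ
  have qs : ∀ n, Summable (fun p : ℕ × ℕ => m n p.1 * m n p.2) := fun n =>
    (ms n).mul_of_nonneg (ms n) (m0 n) (m0 n)
  have qM : ∀ n, ∑' p : ℕ × ℕ, m n p.1 * m n p.2 ≤ M * M := fun n => by
    rw [← (ms n).tsum_mul_tsum (ms n) (qs n)]
    exact mul_le_mul (mM n) (mM n) (tsum_nonneg (m0 n)) M0
  have bs : ∀ n (g : ℝ → ℝ → ℝ) (B : ℝ), (∀ x y, |g x y| ≤ B) →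
      Summable (fun p : ℕ × ℕ => m n p.1 * m n p.2 * g (z n p.1) (z n p.2)) := by
    intro n g B hg
    refine Summable.of_norm_bounded ((qs n).mul_right B) (fun p => ?_)
    have := mul_nonneg (m0 n p.1) (m0 n p.2)
    rw [norm_mul, Real.norm_eq_abs, Real.norm_eq_abs, abs_of_nonneg this]
    exact mul_le_mul_of_nonneg_left (hg _ _) this
  have bs1 : ∀ n (g : ℝ → ℝ) (B : ℝ), (∀ x, |g x| ≤ B) → Summable (fun i => m n i * g (z n i)) := by
    intro n g B hg
    refine Summable.of_norm_bounded ((ms n).mul_right B) (fun p => ?_)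
    rw [norm_mul, Real.norm_eq_abs, Real.norm_eq_abs, abs_of_nonneg (m0 n p)]
    exact mul_le_mul_of_nonneg_left (hg _) (m0 n p)
  rw [Metric.tendsto_atTop]
  intro κ hκ
  set η := κ / (3 * (M * M + M' * M' + 1)) with hη
  have hden : 0 < M * M + M' * M' + 1 := by nlinarith [mul_nonneg M0 M0, mul_nonneg M'0 M'0]
  have η0 : 0 < η := by positivity
  have ηe : η * (M * M + M' * M' + 1) = κ / 3 := by rw [hη]; field_simp
  obtain ⟨δ, hδ, hδa, N, happ⟩ := hat_approx h0a Hu H1 η0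
  set S : ℝ → ℝ → ℝ := fun x y => ∑ i ∈ Finset.range N, ∑ j ∈ Finset.range N, H (δ * i) (δ * j) * (hat δ i x * hat δ j y) with hS
  have Sb : ∀ x y, |S x y| ≤ ∑ i ∈ Finset.range N, ∑ j ∈ Finset.range N, |H (δ * i) (δ * j)| := by
    intro x y
    refine (Finset.abs_sum_le_sum_abs _ _).trans (Finset.sum_le_sum (fun i _ => ?_))
    refine (Finset.abs_sum_le_sum_abs _ _).trans (Finset.sum_le_sum (fun j _ => ?_))
    rw [abs_mul, abs_of_nonneg (mul_nonneg (hat_nonneg _ _ _) (hat_nonneg _ _ _))]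
    have : hat δ i x * hat δ j y ≤ 1 := mul_le_one₀ (hat_le _ _ _) (hat_nonneg _ _ _) (hat_le _ _ _)
    exact mul_le_of_le_one_right (abs_nonneg _) this
  have Hb : ∀ x y, |H x y| ≤ η + ∑ i ∈ Finset.range N, ∑ j ∈ Finset.range N, |H (δ * i) (δ * j)| := by
    intro x y
    have h1 := abs_le.1 (happ x y); have h2 := abs_le.1 (Sb x y)
    rw [abs_le]; constructor <;> linarith [h1.1, h1.2, h2.1, h2.2]
  have Sm : Continuous (fun p : ℝ × ℝ => S p.1 p.2) := by
    rw [hS]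
    refine continuous_finsetSum _ (fun i _ => continuous_finsetSum _ (fun j _ => ?_))
    exact continuous_const.mul (((hat_cont δ i).comp continuous_fst).mul ((hat_cont δ j).comp continuous_snd))
  -- discrete approximations
  have A1 : ∀ n, |(∑' p : ℕ × ℕ, m n p.1 * m n p.2 * H (z n p.1) (z n p.2)) -
      ∑' p : ℕ × ℕ, m n p.1 * m n p.2 * S (z n p.1) (z n p.2)| ≤ η * (M * M) := by
    intro n
    rw [← (bs n H _ Hb).tsum_sub (bs n S _ Sb)]
    have k : ∀ p : ℕ × ℕ, |m n p.1 * m n p.2 * H (z n p.1) (z n p.2) - m n p.1 * m n p.2 * S (z n p.1) (z n p.2)| ≤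
        η * (m n p.1 * m n p.2) := by
      intro p
      have := mul_nonneg (m0 n p.1) (m0 n p.2)
      rw [← mul_sub, abs_mul, abs_of_nonneg this, mul_comm]
      exact mul_le_mul_of_nonneg_right (happ _ _) this
    have := tsum_of_norm_bounded ((qs n).mul_left η).hasSum (f := fun p : ℕ × ℕ => m n p.1 * m n p.2 * H (z n p.1) (z n p.2) - m n p.1 * m n p.2 * S (z n p.1) (z n p.2)) k
    rw [tsum_mul_left] at this
    exact this.trans (mul_le_mul_of_nonneg_left (qM n) η0.le)
  have A2 : |(∫ p, H p.1 p.2 * (ρ p.1 * ρ p.2) ∂(lam.prod lam)) - ∫ p, S p.1 p.2 * (ρ p.1 * ρ p.2) ∂(lam.prod lam)| ≤ η * (M' * M') := by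
    have iH : Integrable (fun p : ℝ × ℝ => H p.1 p.2 * (ρ p.1 * ρ p.2)) (lam.prod lam) :=
      pi.bdd_mul Hu.continuous.aestronglyMeasurable (ae_of_all _ (fun p => Hb p.1 p.2))
    have iS : Integrable (fun p : ℝ × ℝ => S p.1 p.2 * (ρ p.1 * ρ p.2)) (lam.prod lam) :=
      pi.bdd_mul Sm.aestronglyMeasurable (ae_of_all _ (fun p => Sb p.1 p.2))
    rw [← integral_sub iH iS, ← pM, ← integral_const_mul, ← Real.norm_eq_abs]
    refine norm_integral_le_of_norm_le (pi.const_mul η) (ae_of_all _ (fun p => ?_))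
    have := mul_nonneg (ρ0 p.1) (ρ0 p.2)
    rw [← sub_mul, norm_mul, Real.norm_eq_abs, Real.norm_eq_abs, abs_of_nonneg this]
    exact mul_le_mul_of_nonneg_right (happ _ _) this
  have E1 : ∀ n, ∑' p : ℕ × ℕ, m n p.1 * m n p.2 * S (z n p.1) (z n p.2) =
      ∑ i ∈ Finset.range N, ∑ j ∈ Finset.range N, H (δ * i) (δ * j) *
        ((∑' k, m n k * hat δ i (z n k)) * ∑' k, m n k * hat δ j (z n k)) := by
    intro n
    have e : ∀ p : ℕ × ℕ, m n p.1 * m n p.2 * S (z n p.1) (z n p.2) = ∑ i ∈ Finset.range N, ∑ j ∈ Finset.range N,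
        H (δ * i) (δ * j) * ((m n p.1 * hat δ i (z n p.1)) * (m n p.2 * hat δ j (z n p.2))) := by
      intro p
      rw [hS]; simp only
      rw [Finset.mul_sum]
      refine Finset.sum_congr rfl (fun i _ => ?_)
      rw [Finset.mul_sum]
      refine Finset.sum_congr rfl (fun j _ => ?_)
      ring
    simp_rw [e]
    have s1 : ∀ i j : ℕ, Summable (fun p : ℕ × ℕ => (m n p.1 * hat δ i (z n p.1)) * (m n p.2 * hat δ j (z n p.2))) := by
      intro i j
      exact (bs1 n _ 1 (hat_abs δ i)).mul_of_nonneg (bs1 n _ 1 (hat_abs δ j))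
        (fun k => mul_nonneg (m0 n k) (hat_nonneg _ _ _)) (fun k => mul_nonneg (m0 n k) (hat_nonneg _ _ _))
    rw [Summable.tsum_finsetSum (fun i _ => summable_sum (fun j _ => (s1 i j).mul_left _))]
    refine Finset.sum_congr rfl (fun i _ => ?_)
    rw [Summable.tsum_finsetSum (fun j _ => (s1 i j).mul_left _)]
    refine Finset.sum_congr rfl (fun j _ => ?_)
    rw [tsum_mul_left, (bs1 n _ 1 (hat_abs δ i)).tsum_mul_tsum (bs1 n _ 1 (hat_abs δ j)) (s1 i j)]
  have E2 : ∫ p, S p.1 p.2 * (ρ p.1 * ρ p.2) ∂(lam.prod lam) =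
      ∑ i ∈ Finset.range N, ∑ j ∈ Finset.range N, H (δ * i) (δ * j) *
        ((∫ x, hat δ i x * ρ x ∂lam) * ∫ x, hat δ j x * ρ x ∂lam) := by
    have e : ∀ p : ℝ × ℝ, S p.1 p.2 * (ρ p.1 * ρ p.2) = ∑ i ∈ Finset.range N, ∑ j ∈ Finset.range N,
        H (δ * i) (δ * j) * ((hat δ i p.1 * ρ p.1) * (hat δ j p.2 * ρ p.2)) := by
      intro p
      rw [hS]; simp only
      rw [Finset.sum_mul]
      refine Finset.sum_congr rfl (fun i _ => ?_)
      rw [Finset.sum_mul]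
      refine Finset.sum_congr rfl (fun j _ => ?_)
      ring
    simp_rw [e]
    have i1 : ∀ i : ℕ, Integrable (fun x => hat δ i x * ρ x) lam := fun i =>
      ρi.bdd_mul (c := 1) (hat_cont δ i).aestronglyMeasurable (ae_of_all _ (hat_abs δ i))
    have s1 : ∀ i j : ℕ, Integrable (fun p : ℝ × ℝ => (hat δ i p.1 * ρ p.1) * (hat δ j p.2 * ρ p.2)) (lam.prod lam) :=
      fun i j => Integrable.mul_prod (i1 i) (i1 j)
    rw [integral_finsetSum _ (fun i _ => integrable_finsetSum _ (fun j _ => (s1 i j).const_mul _))]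
    refine Finset.sum_congr rfl (fun i _ => ?_)
    rw [integral_finsetSum _ (fun j _ => (s1 i j).const_mul _)]
    refine Finset.sum_congr rfl (fun j _ => ?_)
    rw [integral_const_mul]
    congr 1
    exact integral_prod_mul (fun x => hat δ i x * ρ x) (fun x => hat δ j x * ρ x)
  have T : Filter.Tendsto (fun n => ∑' p : ℕ × ℕ, m n p.1 * m n p.2 * S (z n p.1) (z n p.2)) Filter.atTop
      (nhds (∫ p, S p.1 p.2 * (ρ p.1 * ρ p.2) ∂(lam.prod lam))) := by
    rw [E2]
    simp_rw [E1]
    refine tendsto_finsetSum _ (fun i _ => tendsto_finsetSum _ (fun j _ => ?_))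
    have small : ∀ i : ℕ, i < 2 → δ * (i:ℝ) ≤ a := by
      intro i hi
      have : (i:ℝ) ≤ 1 := by exact_mod_cast Nat.lt_succ_iff.1 hi
      nlinarith
    by_cases hi : 2 ≤ i
    · by_cases hj : 2 ≤ j
      · exact ((hl _ (hat_TF hδ hi)).mul (hl _ (hat_TF hδ hj))).const_mul _
      · rw [H1 (δ * i) (δ * j) (Or.inr (Or.inl (small j (by omega))))]; simp
    · rw [H1 (δ * i) (δ * j) (Or.inl (small i (by omega)))]; simp
  obtain ⟨n0, hn0⟩ := Metric.tendsto_atTop.1 T (κ / 3) (by positivity)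
  refine ⟨n0, fun n hn => ?_⟩
  have t1 := abs_le.1 (A1 n)
  have t2 := abs_le.1 A2
  have t3 := hn0 n hn
  rw [Real.dist_eq] at t3 ⊢
  have t3' := abs_lt.1 t3
  have : 0 ≤ η * (M * M) := by positivity
  have : 0 ≤ η * (M' * M') := by positivity
  rw [abs_lt]; constructor <;> nlinarith [t1.1, t1.2, t2.1, t2.2, t3'.1, t3'.2]
open MeasureTheory

/-- cutoffs -/
noncomputable def cut (k : ℕ) (x : ℝ) : ℝ := clp (2 * ((k:ℝ) + 1) * x - 1) * clp ((k:ℝ) + 2 - x)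

lemma cut_nonneg (k : ℕ) (x : ℝ) : 0 ≤ cut k x := mul_nonneg (clp_nonneg _) (clp_nonneg _)
lemma cut_le (k : ℕ) (x : ℝ) : cut k x ≤ 1 := mul_le_one₀ (clp_le _) (clp_nonneg _) (clp_le _)
lemma cut_cont (k : ℕ) : Continuous (cut k) :=
  (clp_cont.comp (by fun_prop)).mul (clp_cont.comp (by fun_prop))
lemma cut_low {k : ℕ} {x : ℝ} (h : x ≤ 1 / (2 * ((k:ℝ) + 1))) : cut k x = 0 := by
  unfold cut
  rw [clp_zero, zero_mul]
  have : (0:ℝ) < 2 * ((k:ℝ) + 1) := by positivity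
  rw [le_div_iff₀ this] at h; linarith
lemma cut_high {k : ℕ} {x : ℝ} (h : (k:ℝ) + 2 ≤ x) : cut k x = 0 := by
  unfold cut
  rw [clp_zero (z := (k:ℝ) + 2 - x) (by linarith), mul_zero]
lemma cut_one {k : ℕ} {x : ℝ} (h : 1 / ((k:ℝ) + 1) ≤ x) (h' : x ≤ (k:ℝ) + 1) : cut k x = 1 := by
  unfold cut
  have : (0:ℝ) < (k:ℝ) + 1 := by positivity
  rw [div_le_iff₀ this] at h
  rw [clp_one (by nlinarith), clp_one (by linarith), mul_one]
lemma cut_TF (k : ℕ) : IsTF (cut k) :=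
  ⟨cut_cont k, 1 / (2 * ((k:ℝ) + 1)), k + 2, by positivity, fun _ h => cut_low h, fun _ h => cut_high h⟩
lemma cut_abs (k : ℕ) (x : ℝ) : |cut k x| ≤ 1 := by
  rw [abs_of_nonneg (cut_nonneg _ _)]; exact cut_le _ _

lemma cut_tendsto {x : ℝ} (hx : 0 < x) : Filter.Tendsto (fun k => cut k x) Filter.atTop (nhds 1) := by
  refine tendsto_const_nhds.congr' ?_
  obtain ⟨N, hN⟩ := exists_nat_gt (1 / x + x)
  filter_upwards [Filter.eventually_ge_atTop N] with k hk
  have hk' : (N:ℝ) ≤ k := by exact_mod_cast hk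
  have : 0 < 1 / x := by positivity
  symm
  refine cut_one ?_ (by linarith)
  rw [div_le_iff₀ (by positivity)]
  have e : x * (1 / x) = 1 := by field_simp
  nlinarith

/-- The kernel, set to zero off the open quadrant. -/
noncomputable def K0 (K : ℝ → ℝ → ℝ) (x y : ℝ) : ℝ := (Set.Ioi (0:ℝ) ×ˢ Set.Ioi (0:ℝ)).indicator (fun p : ℝ × ℝ => K p.1 p.2) (x, y)

lemma K0_eq (K : ℝ → ℝ → ℝ) {x y : ℝ} (hx : 0 < x) (hy : 0 < y) : K0 K x y = K x y := by
  unfold K0; rw [Set.indicator_of_mem]; exact ⟨hx, hy⟩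

lemma K0_off (K : ℝ → ℝ → ℝ) {x y : ℝ} (h : ¬ (0 < x ∧ 0 < y)) : K0 K x y = 0 := by
  unfold K0; rw [Set.indicator_of_notMem]; exact h

namespace RbkFam
variable {K : ℝ → ℝ → ℝ} {F : ℝ → ℕ → ℝ → ℝ} {M CK R1 : ℝ} {tl : ℝ → ℝ}

lemma K0_nonneg (H : RbkFam K F M CK R1 tl) (x y : ℝ) : 0 ≤ K0 K x y := by
  by_cases h : 0 < x ∧ 0 < y
  · rw [K0_eq K h.1 h.2]; exact H.K_nonneg _ _ h.1 h.2
  · rw [K0_off K h]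

lemma K0_symm (H : RbkFam K F M CK R1 tl) (x y : ℝ) : K0 K x y = K0 K y x := by
  by_cases h : 0 < x ∧ 0 < y
  · rw [K0_eq K h.1 h.2, K0_eq K h.2 h.1]; exact H.K_symm _ _ h.1 h.2
  · rw [K0_off K h, K0_off K (fun q => h ⟨q.2, q.1⟩)]

open Classical in
lemma K0_meas (H : RbkFam K F M CK R1 tl) : Measurable (fun p : ℝ × ℝ => K0 K p.1 p.2) := by
  have : (fun p : ℝ × ℝ => K0 K p.1 p.2) = (Set.Ioi (0:ℝ) ×ˢ Set.Ioi (0:ℝ)).piecewise (fun p : ℝ × ℝ => K p.1 p.2) 0 := by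
    rw [Set.piecewise_eq_indicator]; rfl
  rw [this]
  exact H.K_cont.measurable_piecewise continuous_zero.continuousOn (measurableSet_Ioi.prod measurableSet_Ioi)

/-- truncated kernel -/
noncomputable def Kcut (K : ℝ → ℝ → ℝ) (ψ : ℝ → ℝ → ℝ) (k : ℕ) (x y : ℝ) : ℝ := K0 K x y * (ψ x y * (cut k x * cut k y))

lemma Kcut_zero (ψ : ℝ → ℝ → ℝ) (k : ℕ) (x y : ℝ)
    (h : x ≤ 1 / (2 * ((k:ℝ) + 1)) ∨ y ≤ 1 / (2 * ((k:ℝ) + 1)) ∨ (k:ℝ) + 2 ≤ x ∨ (k:ℝ) + 2 ≤ y) : Kcut K ψ k x y = 0 := by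
  unfold Kcut
  rcases h with h | h | h | h
  · rw [cut_low h]; ring
  · rw [cut_low h]; ring
  · rw [cut_high h]; ring
  · rw [cut_high h]; ring

lemma Kcut_cont (H : RbkFam K F M CK R1 tl) {ψ : ℝ → ℝ → ℝ} (hψ : Continuous (fun p : ℝ × ℝ => ψ p.1 p.2)) (k : ℕ) :
    Continuous (fun p : ℝ × ℝ => Kcut K ψ k p.1 p.2) := by
  have ha : (0:ℝ) < 1 / (2 * ((k:ℝ) + 1)) := by positivity
  rw [continuous_iff_continuousAt]
  intro p
  by_cases hp : 0 < p.1 ∧ 0 < p.2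
  · have hn : (Set.Ioi (0:ℝ) ×ˢ Set.Ioi (0:ℝ)) ∈ nhds p :=
      (isOpen_Ioi.prod isOpen_Ioi).mem_nhds ⟨hp.1, hp.2⟩
    have hK : ContinuousAt (fun p : ℝ × ℝ => K p.1 p.2) p := H.K_cont.continuousAt hn
    have c2 : Continuous (fun p : ℝ × ℝ => ψ p.1 p.2 * (cut k p.1 * cut k p.2)) :=
      hψ.mul (((cut_cont k).comp continuous_fst).mul ((cut_cont k).comp continuous_snd))
    refine (hK.mul c2.continuousAt).congr ?_
    filter_upwards [hn] with q hq
    show _ = Kcut K ψ k q.1 q.2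
    unfold Kcut; rw [K0_eq K hq.1 hq.2]; rfl
  · have h0 : ∀ᶠ q : ℝ × ℝ in nhds p, q.1 ≤ 1 / (2 * ((k:ℝ) + 1)) ∨ q.2 ≤ 1 / (2 * ((k:ℝ) + 1)) := by
      by_cases h1 : 0 < p.1
      · have h2 : p.2 < 1 / (2 * ((k:ℝ) + 1)) := by
          have : ¬ 0 < p.2 := fun h => hp ⟨h1, h⟩
          linarith
        filter_upwards [(continuous_snd.tendsto p).eventually (gt_mem_nhds h2)] with q hq
        exact Or.inr hq.le
      · have h2 : p.1 < 1 / (2 * ((k:ℝ) + 1)) := by linarith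
        filter_upwards [(continuous_fst.tendsto p).eventually (gt_mem_nhds h2)] with q hq
        exact Or.inl hq.le
    have : ContinuousAt (fun _ : ℝ × ℝ => (0:ℝ)) p := continuousAt_const
    refine this.congr ?_
    filter_upwards [h0] with q hq
    exact (Kcut_zero ψ k q.1 q.2 (hq.elim Or.inl (fun h => Or.inr (Or.inl h)))).symm

lemma Kcut_unif (H : RbkFam K F M CK R1 tl) {ψ : ℝ → ℝ → ℝ} (hψ : Continuous (fun p : ℝ × ℝ => ψ p.1 p.2)) (k : ℕ) :
    UniformContinuous (fun p : ℝ × ℝ => Kcut K ψ k p.1 p.2) ∧ ∃ B, 0 ≤ B ∧ ∀ x y, |Kcut K ψ k x y| ≤ B := by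
  have hc : HasCompactSupport (fun p : ℝ × ℝ => Kcut K ψ k p.1 p.2) := by
    refine HasCompactSupport.intro (isCompact_Icc (a := ((0:ℝ), (0:ℝ))) (b := ((k:ℝ) + 2, (k:ℝ) + 2))) (fun p hp => ?_)
    apply Kcut_zero
    by_contra h
    push Not at h
    have ha : (0:ℝ) < 1 / (2 * ((k:ℝ) + 1)) := by positivity
    exact hp ⟨⟨by simp only; linarith, by simp only; linarith⟩, ⟨h.2.2.1.le, h.2.2.2.le⟩⟩
  refine ⟨hc.uniformContinuous_of_continuous (H.Kcut_cont hψ k), ?_⟩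
  obtain ⟨C, hC⟩ := hc.exists_bound_of_continuous (H.Kcut_cont hψ k)
  exact ⟨C, (norm_nonneg _).trans (hC (0, 0)), fun x y => hC (x, y)⟩

end RbkFam

/-- Limit data. -/
structure RbkLim (K : ℝ → ℝ → ℝ) (F : ℝ → ℕ → ℝ → ℝ) (M CK R1 : ℝ) (tl : ℝ → ℝ) (ε : ℕ → ℝ) (ρ : ℝ → ℝ → ℝ) : Prop where
  fam : RbkFam K F M CK R1 tl
  e0 : ∀ n, 0 < ε n
  e1 : ∀ n, ε n < 1
  el : Filter.Tendsto ε Filter.atTop (nhds 0)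
  meas : Measurable (Function.uncurry ρ)
  nonneg : ∀ t x, 0 ≤ ρ t x
  rmax : ∀ t, ρ t = ρ (max t 0)
  int : ∀ t, IntegrableOn (fun x => (1 + x) * ρ t x) (Set.Ioi 0)
  mass : ∀ t, ∫ x in Set.Ioi (0:ℝ), (1 + x) * ρ t x ≤ 2 * M
  conv : ∀ φ, IsTF φ → ∀ t, 0 ≤ t →
    Filter.Tendsto (fun n => Lam F (ε n) φ t) Filter.atTop (nhds (∫ x in Set.Ioi (0:ℝ), φ x * ρ t x))

/-- half-line measure -/
noncomputable def hl : Measure ℝ := volume.restrict (Set.Ioi (0:ℝ))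

instance hl_sf : SFinite hl := by unfold hl; infer_instance

/-- time-space-space measure -/
noncomputable def tss (t : ℝ) : Measure (ℝ × ℝ × ℝ) := (volume.restrict (Set.Ioc 0 t)).prod (hl.prod hl)

namespace RbkLim
variable {K : ℝ → ℝ → ℝ} {F : ℝ → ℕ → ℝ → ℝ} {M CK R1 : ℝ} {tl : ℝ → ℝ} {ε : ℕ → ℝ} {ρ : ℝ → ℝ → ℝ}

/-- collision density -/
noncomputable def G (K : ℝ → ℝ → ℝ) (ρ : ℝ → ℝ → ℝ) (q : ℝ × ℝ × ℝ) : ℝ :=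
  K0 K q.2.1 q.2.2 * (ρ q.1 q.2.1 * ρ q.1 q.2.2)

lemma meas_t (L : RbkLim K F M CK R1 tl ε ρ) (t : ℝ) : Measurable (ρ t) :=
  L.meas.comp (by fun_prop : Measurable fun x => (t, x))

lemma int1 (L : RbkLim K F M CK R1 tl ε ρ) (t : ℝ) : Integrable (ρ t) hl := by
  refine (L.int t).mono' (L.meas_t t).aestronglyMeasurable ?_
  refine ae_restrict_of_forall_mem measurableSet_Ioi (fun x hx => ?_)
  have : 0 < x := hx
  have h := L.nonneg t x
  rw [Real.norm_eq_abs, abs_of_nonneg h]; nlinarith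

lemma int1_le (L : RbkLim K F M CK R1 tl ε ρ) (t : ℝ) : ∫ x, ρ t x ∂hl ≤ 2 * M := by
  refine (setIntegral_mono_on (L.int1 t) (L.int t) measurableSet_Ioi (fun x hx => ?_)).trans (L.mass t)
  have : 0 < x := hx
  have h := L.nonneg t x
  nlinarith

lemma rr_meas (L : RbkLim K F M CK R1 tl ε ρ) : Measurable (fun q : ℝ × ℝ × ℝ => ρ q.1 q.2.1 * ρ q.1 q.2.2) :=
  (L.meas.comp (by fun_prop : Measurable fun q : ℝ × ℝ × ℝ => (q.1, q.2.1))).mul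
    (L.meas.comp (by fun_prop : Measurable fun q : ℝ × ℝ × ℝ => (q.1, q.2.2)))

lemma G_meas (L : RbkLim K F M CK R1 tl ε ρ) : Measurable (G K ρ) :=
  (L.fam.K0_meas.comp measurable_snd).mul L.rr_meas

lemma G_nonneg (L : RbkLim K F M CK R1 tl ε ρ) (q : ℝ × ℝ × ℝ) : 0 ≤ G K ρ q :=
  mul_nonneg (L.fam.K0_nonneg _ _) (mul_nonneg (L.nonneg _ _) (L.nonneg _ _))

lemma rr_int (L : RbkLim K F M CK R1 tl ε ρ) (t : ℝ) :
    Integrable (fun q : ℝ × ℝ × ℝ => ρ q.1 q.2.1 * ρ q.1 q.2.2) (tss t) := by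
  unfold tss
  rw [integrable_prod_iff L.rr_meas.aestronglyMeasurable]
  have hp : ∀ τ, Integrable (fun p : ℝ × ℝ => ρ τ p.1 * ρ τ p.2) (hl.prod hl) := fun τ =>
    Integrable.mul_prod (L.int1 τ) (L.int1 τ)
  refine ⟨ae_of_all _ hp, ?_⟩
  have e : ∀ τ, ∫ p : ℝ × ℝ, ‖ρ τ p.1 * ρ τ p.2‖ ∂(hl.prod hl) = (∫ x, ρ τ x ∂hl) * ∫ x, ρ τ x ∂hl := by
    intro τ
    rw [← integral_prod_mul]
    congr 1; ext p
    rw [Real.norm_eq_abs, abs_of_nonneg (mul_nonneg (L.nonneg _ _) (L.nonneg _ _))]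
  refine Integrable.of_bound (C := (2 * M) * (2 * M)) ?_ (ae_of_all _ (fun τ => ?_))
  · exact (L.rr_meas.norm.stronglyMeasurable.integral_prod_right (ν := hl.prod hl)).aestronglyMeasurable
  · show ‖∫ p : ℝ × ℝ, ‖ρ τ p.1 * ρ τ p.2‖ ∂(hl.prod hl)‖ ≤ _
    rw [e]
    have n0 : 0 ≤ ∫ x, ρ τ x ∂hl := integral_nonneg (L.nonneg τ)
    rw [Real.norm_eq_abs, abs_of_nonneg (mul_nonneg n0 n0)]
    exact mul_le_mul (L.int1_le τ) (L.int1_le τ) n0 (n0.trans (L.int1_le τ))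

lemma rbkC_Kcut (L : RbkLim K F M CK R1 tl ε ρ) (ψ : ℝ → ℝ → ℝ) (k n : ℕ) (τ : ℝ) (p : ℕ × ℕ) :
    rbkC K F (ε n) p τ * (ψ (ε n * p.1) (ε n * p.2) * (cut k (ε n * p.1) * cut k (ε n * p.2))) =
      (ε n * F (ε n) p.1 τ) * (ε n * F (ε n) p.2 τ) * RbkFam.Kcut K ψ k (ε n * p.1) (ε n * p.2) := by
  unfold rbkC RbkFam.Kcut
  have h0 := L.e0 n
  rcases Nat.eq_zero_or_pos p.1 with h | h
  · simp [h, L.fam.F_zero]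
  rcases Nat.eq_zero_or_pos p.2 with h' | h'
  · simp [h', L.fam.F_zero]
  rw [K0_eq K (by positivity) (by positivity)]
  ring

lemma Kcut_lim (L : RbkLim K F M CK R1 tl ε ρ) {ψ : ℝ → ℝ → ℝ} (hψ : Continuous (fun p : ℝ × ℝ => ψ p.1 p.2))
    (k : ℕ) {τ : ℝ} (hτ : 0 ≤ τ) :
    Filter.Tendsto (fun n => ∑' p : ℕ × ℕ, rbkC K F (ε n) p τ *
      (ψ (ε n * p.1) (ε n * p.2) * (cut k (ε n * p.1) * cut k (ε n * p.2)))) Filter.atTop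
      (nhds (∫ p, RbkFam.Kcut K ψ k p.1 p.2 * (ρ τ p.1 * ρ τ p.2) ∂(hl.prod hl))) := by
  simp_rw [L.rbkC_Kcut]
  refine quad_tendsto (m := fun n i => ε n * F (ε n) i τ) (z := fun n i => ε n * (i:ℝ)) (M := M)
    (fun n i => mul_nonneg (L.e0 n).le (L.fam.F_nonneg _ (L.e0 n) (L.e1 n) _ _))
    (fun n => (L.fam.F_summable (L.e0 n) (L.e1 n) τ).mul_left _) (fun n => ?_) (L.nonneg τ) (L.int1 τ)
    (fun φ hφ => L.conv φ hφ τ hτ) (a := 1 / (2 * ((k:ℝ) + 1))) (b := (k:ℝ) + 2) (by positivity)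
    (L.fam.Kcut_unif hψ k).1 (RbkFam.Kcut_zero ψ k)
  exact (Summable.tsum_le_tsum (fun i => L.fam.F_le_b (L.e0 n) (L.e1 n) τ i)
    ((L.fam.F_summable (L.e0 n) (L.e1 n) τ).mul_left _) (L.fam.b_sum (L.e0 n) (L.e1 n) τ)).trans
    (L.fam.b_tsum (L.e0 n) (L.e1 n) τ)

lemma Kcut_int (L : RbkLim K F M CK R1 tl ε ρ) {ψ : ℝ → ℝ → ℝ} (hψ : Continuous (fun p : ℝ × ℝ => ψ p.1 p.2))
    (k : ℕ) (t : ℝ) :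
    Integrable (fun q : ℝ × ℝ × ℝ => RbkFam.Kcut K ψ k q.2.1 q.2.2 * (ρ q.1 q.2.1 * ρ q.1 q.2.2)) (tss t) := by
  obtain ⟨B, _, hB⟩ := (L.fam.Kcut_unif hψ k).2
  exact (L.rr_int t).bdd_mul (c := B) ((L.fam.Kcut_cont hψ k).comp continuous_snd).aestronglyMeasurable
    (ae_of_all _ (fun q => hB _ _))

lemma Kcut_time (L : RbkLim K F M CK R1 tl ε ρ) {ψ : ℝ → ℝ → ℝ} (hψ : Continuous (fun p : ℝ × ℝ => ψ p.1 p.2))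
    {B : ℝ} (hB : ∀ x y, |ψ x y| ≤ B) (k : ℕ) {t : ℝ} (ht : 0 ≤ t) :
    Filter.Tendsto (fun n => ∫ τ in (0:ℝ)..t, ∑' p : ℕ × ℕ, rbkC K F (ε n) p τ *
      (ψ (ε n * p.1) (ε n * p.2) * (cut k (ε n * p.1) * cut k (ε n * p.2)))) Filter.atTop
      (nhds (∫ q, RbkFam.Kcut K ψ k q.2.1 q.2.2 * (ρ q.1 q.2.1 * ρ q.1 q.2.2) ∂(tss t))) := by
  obtain ⟨C, hC0, hC⟩ := (L.fam.Kcut_unif hψ k).2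
  have M0 := L.fam.M_nonneg
  have e : ∫ q, RbkFam.Kcut K ψ k q.2.1 q.2.2 * (ρ q.1 q.2.1 * ρ q.1 q.2.2) ∂(tss t) =
      ∫ τ in (0:ℝ)..t, ∫ p, RbkFam.Kcut K ψ k p.1 p.2 * (ρ τ p.1 * ρ τ p.2) ∂(hl.prod hl) := by
    rw [intervalIntegral.integral_of_le ht]
    exact integral_prod _ (L.Kcut_int hψ k t)
  rw [e]
  refine intervalIntegral.tendsto_integral_filter_of_dominated_convergence (fun _ => C * (M * M)) ?_ ?_
    intervalIntegrable_const ?_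
  · refine Filter.Eventually.of_forall (fun n => ?_)
    have B0 : 0 ≤ B := (abs_nonneg _).trans (hB 0 0)
    have := L.fam.CV_int (L.e0 n) (L.e1 n)
      (fun p _ => ψ (ε n * p.1) (ε n * p.2) * (cut k (ε n * p.1) * cut k (ε n * p.2))) (B := B) (fun p _ => by
        rw [abs_mul, abs_mul]
        calc _ ≤ B * (1 * 1) := mul_le_mul (hB _ _) (mul_le_mul (cut_abs _ _) (cut_abs _ _) (abs_nonneg _) zero_le_one) (by positivity) B0
          _ = B := by ring) (fun p => measurable_const) 0 t
    exact this.def'.aestronglyMeasurable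
  · refine Filter.Eventually.of_forall (fun n => ae_of_all _ (fun τ _ => ?_))
    simp_rw [L.rbkC_Kcut]
    have s := L.fam.bb_sum (L.e0 n) (L.e1 n) τ
    have k1 : ∀ p : ℕ × ℕ, ‖(ε n * F (ε n) p.1 τ) * (ε n * F (ε n) p.2 τ) * RbkFam.Kcut K ψ k (ε n * p.1) (ε n * p.2)‖ ≤
        C * (RbkFam.b F (ε n) τ p.1 * RbkFam.b F (ε n) τ p.2) := by
      intro p
      have f1 := mul_nonneg (L.e0 n).le (L.fam.F_nonneg _ (L.e0 n) (L.e1 n) p.1 τ)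
      have f2 := mul_nonneg (L.e0 n).le (L.fam.F_nonneg _ (L.e0 n) (L.e1 n) p.2 τ)
      rw [norm_mul, Real.norm_eq_abs, Real.norm_eq_abs, abs_of_nonneg (mul_nonneg f1 f2), mul_comm]
      refine mul_le_mul (hC _ _) (mul_le_mul (L.fam.F_le_b (L.e0 n) (L.e1 n) _ _)
        (L.fam.F_le_b (L.e0 n) (L.e1 n) _ _) f2 (L.fam.b_nonneg (L.e0 n) (L.e1 n) _ _)) (mul_nonneg f1 f2) hC0
    refine (tsum_of_norm_bounded (s.mul_left C).hasSum k1).trans ?_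
    rw [tsum_mul_left]
    refine mul_le_mul_of_nonneg_left ?_ hC0
    have bs := L.fam.b_sum (L.e0 n) (L.e1 n) τ
    rw [← bs.tsum_mul_tsum bs s]
    exact mul_le_mul (L.fam.b_tsum (L.e0 n) (L.e1 n) τ) (L.fam.b_tsum (L.e0 n) (L.e1 n) τ)
      (tsum_nonneg (L.fam.b_nonneg (L.e0 n) (L.e1 n) τ)) M0
  · refine ae_of_all _ (fun τ hτ => L.Kcut_lim hψ k ?_)
    rw [Set.uIoc_of_le ht] at hτ
    exact hτ.1.le

end RbkLim
open MeasureTheory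

namespace RbkLim
variable {K : ℝ → ℝ → ℝ} {F : ℝ → ℕ → ℝ → ℝ} {M CK R1 : ℝ} {tl : ℝ → ℝ} {ε : ℕ → ℝ} {ρ : ℝ → ℝ → ℝ}

lemma Kcut_pt (ψ : ℝ → ℝ → ℝ) (q : ℝ × ℝ × ℝ) :
    Filter.Tendsto (fun k => RbkFam.Kcut K ψ k q.2.1 q.2.2 * (ρ q.1 q.2.1 * ρ q.1 q.2.2)) Filter.atTop
      (nhds (ψ q.2.1 q.2.2 * G K ρ q)) := by
  unfold RbkFam.Kcut G
  by_cases h : 0 < q.2.1 ∧ 0 < q.2.2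
  · have := (((cut_tendsto h.1).mul (cut_tendsto h.2)).const_mul (K0 K q.2.1 q.2.2 * ψ q.2.1 q.2.2)).mul_const
      (ρ q.1 q.2.1 * ρ q.1 q.2.2)
    have e : ψ q.2.1 q.2.2 * (K0 K q.2.1 q.2.2 * (ρ q.1 q.2.1 * ρ q.1 q.2.2)) =
      K0 K q.2.1 q.2.2 * ψ q.2.1 q.2.2 * (1 * 1) * (ρ q.1 q.2.1 * ρ q.1 q.2.2) := by ring
    rw [e]
    refine this.congr (fun k => ?_)
    ring
  · rw [K0_off K h]; simp

lemma Kcut_le (L : RbkLim K F M CK R1 tl ε ρ) {ψ : ℝ → ℝ → ℝ} {B : ℝ} (hB : ∀ x y, |ψ x y| ≤ B) (k : ℕ) (q : ℝ × ℝ × ℝ) :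
    ‖RbkFam.Kcut K ψ k q.2.1 q.2.2 * (ρ q.1 q.2.1 * ρ q.1 q.2.2)‖ ≤ B * G K ρ q := by
  have B0 : 0 ≤ B := (abs_nonneg _).trans (hB 0 0)
  have e : RbkFam.Kcut K ψ k q.2.1 q.2.2 * (ρ q.1 q.2.1 * ρ q.1 q.2.2) =
      (ψ q.2.1 q.2.2 * (cut k q.2.1 * cut k q.2.2)) * G K ρ q := by unfold RbkFam.Kcut G; ring
  rw [e, norm_mul, Real.norm_eq_abs, Real.norm_eq_abs, abs_of_nonneg (L.G_nonneg q)]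
  refine mul_le_mul_of_nonneg_right ?_ (L.G_nonneg q)
  rw [abs_mul, abs_mul]
  calc _ ≤ B * (1 * 1) := mul_le_mul (hB _ _) (mul_le_mul (cut_abs _ _) (cut_abs _ _) (abs_nonneg _) zero_le_one) (by positivity) B0
    _ = B := by ring

lemma G_int (L : RbkLim K F M CK R1 tl ε ρ) {t : ℝ} (ht : 0 ≤ t) : Integrable (G K ρ) (tss t) := by
  obtain ⟨D, hD, hdis⟩ := L.fam.dissip ht
  have c1 : Continuous (fun _ : ℝ × ℝ => (1:ℝ)) := continuous_const
  set f : ℕ → ℝ × ℝ × ℝ → ℝ := fun k q => RbkFam.Kcut K (fun _ _ => 1) k q.2.1 q.2.2 * (ρ q.1 q.2.1 * ρ q.1 q.2.2) with hf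
  have f0 : ∀ k q, 0 ≤ f k q := fun k q => by
    have := L.fam.K0_nonneg q.2.1 q.2.2
    have := cut_nonneg k q.2.1
    have := cut_nonneg k q.2.2
    have := L.nonneg q.1 q.2.1
    have := L.nonneg q.1 q.2.2
    rw [hf]; simp only; unfold RbkFam.Kcut; positivity
  have fi : ∀ k, Integrable (f k) (tss t) := fun k => L.Kcut_int (ψ := fun _ _ => 1) c1 k t
  have fD : ∀ k, ∫ q, f k q ∂(tss t) ≤ D := by
    intro k
    refine le_of_tendsto' (L.Kcut_time (ψ := fun _ _ => 1) c1 (B := 1) (by simp) k ht) (fun n => ?_)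
    refine le_trans ?_ (hdis (ε n) (L.e0 n) (L.e1 n))
    have hb : ∀ p : ℕ × ℕ, |(1:ℝ) * (cut k (ε n * p.1) * cut k (ε n * p.2))| ≤ 1 := by
      intro p
      rw [one_mul, abs_mul]
      exact mul_le_one₀ (cut_abs _ _) (abs_nonneg _) (cut_abs _ _)
    have I1 := L.fam.CV_int (L.e0 n) (L.e1 n)
      (fun p _ => (1:ℝ) * (cut k (ε n * p.1) * cut k (ε n * p.2))) (B := 1) (fun p _ => hb p) (fun p => measurable_const) 0 t
    refine intervalIntegral.integral_mono_on ht I1 (L.fam.tot_int (L.e0 n) (L.e1 n) 0 t) (fun τ _ => ?_)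
    have key : ∀ p : ℕ × ℕ, rbkC K F (ε n) p τ * ((1:ℝ) * (cut k (ε n * p.1) * cut k (ε n * p.2))) ≤ rbkC K F (ε n) p τ :=
      fun p => mul_le_of_le_one_right (L.fam.C_nonneg (L.e0 n) (L.e1 n) p τ) ((le_abs_self _).trans (hb p))
    exact Summable.tsum_le_tsum key (L.fam.CV_sum (L.e0 n) (L.e1 n) τ _ hb) (L.fam.C_sum (L.e0 n) (L.e1 n) τ)
  have pt : ∀ q, Filter.Tendsto (fun k => f k q) Filter.atTop (nhds (G K ρ q)) := by
    intro q
    have := Kcut_pt (K := K) (ρ := ρ) (fun _ _ => 1) q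
    simpa using this
  refine ⟨L.G_meas.aestronglyMeasurable, ?_⟩
  rw [hasFiniteIntegral_iff_ofReal (ae_of_all _ L.G_nonneg)]
  have mk : ∀ k, Measurable (fun q => ENNReal.ofReal (f k q)) := fun k => by
    have : Measurable (f k) := (((L.fam.Kcut_cont (ψ := fun _ _ => 1) c1 k).measurable).comp measurable_snd).mul L.rr_meas
    exact this.ennreal_ofReal
  have fat := lintegral_liminf_le (μ := tss t) (u := Filter.atTop) mk
  have e : ∀ q, Filter.liminf (fun k => ENNReal.ofReal (f k q)) Filter.atTop = ENNReal.ofReal (G K ρ q) := fun q =>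
    (ENNReal.tendsto_ofReal (pt q)).liminf_eq
  simp_rw [e] at fat
  have : Filter.liminf (fun k => ∫⁻ q, ENNReal.ofReal (f k q) ∂(tss t)) Filter.atTop ≤ ENNReal.ofReal D := by
    have h := Filter.liminf_le_liminf (f := Filter.atTop) (u := fun k => ∫⁻ q, ENNReal.ofReal (f k q) ∂(tss t))
      (v := fun _ : ℕ => ENNReal.ofReal D) (Filter.Eventually.of_forall (fun k => by
        show ∫⁻ q, ENNReal.ofReal (f k q) ∂(tss t) ≤ ENNReal.ofReal D
        rw [← ofReal_integral_eq_lintegral_ofReal (fi k) (ae_of_all _ (f0 k))]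
        exact ENNReal.ofReal_le_ofReal (fD k)))
    rwa [Filter.liminf_const] at h
  exact (fat.trans this).trans_lt ENNReal.ofReal_lt_top

lemma vphi_cont {φ : ℝ → ℝ} (h : Continuous φ) : Continuous (fun p : ℝ × ℝ => vphi φ p.1 p.2) := by
  unfold vphi; fun_prop

lemma weak_TF (L : RbkLim K F M CK R1 tl ε ρ) {φ : ℝ → ℝ} (hφ : IsTF φ) {t : ℝ} (ht : 0 ≤ t) :
    (∫ x, φ x * ρ t x ∂hl) - ∫ x, φ x * ρ 0 x ∂hl = (1/2) * ∫ q, vphi φ q.2.1 q.2.2 * G K ρ q ∂(tss t) := by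
  obtain ⟨D, hD, hdis⟩ := L.fam.dissip ht
  obtain ⟨B, hB, hφB⟩ := hφ.bdd
  have M0 := L.fam.M_nonneg
  have CK0 := L.fam.CK_nonneg
  have vb : ∀ x y, |vphi φ x y| ≤ 3 * B := vphi_bdd hφB
  have vc := vphi_cont hφ.1
  set W : ℕ → ℝ := fun n => ∫ τ in (0:ℝ)..t, ∑' p : ℕ × ℕ, rbkC K F (ε n) p τ * vphi φ (ε n * p.1) (ε n * p.2) with hW
  set Wk : ℕ → ℕ → ℝ := fun k n => ∫ τ in (0:ℝ)..t, ∑' p : ℕ × ℕ, rbkC K F (ε n) p τ *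
      (vphi φ (ε n * p.1) (ε n * p.2) * (cut k (ε n * p.1) * cut k (ε n * p.2))) with hWk
  set V := ∫ q, vphi φ q.2.1 q.2.2 * G K ρ q ∂(tss t) with hV
  set Vk : ℕ → ℝ := fun k => ∫ q, RbkFam.Kcut K (vphi φ) k q.2.1 q.2.2 * (ρ q.1 q.2.1 * ρ q.1 q.2.2) ∂(tss t) with hVk
  have T1 : ∀ k, Filter.Tendsto (Wk k) Filter.atTop (nhds (Vk k)) := fun k => L.Kcut_time vc vb k ht
  have T2 : Filter.Tendsto Vk Filter.atTop (nhds V) := by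
    refine tendsto_integral_of_dominated_convergence (fun q => 3 * B * G K ρ q)
      (fun k => (L.Kcut_int vc k t).aestronglyMeasurable) ((L.G_int ht).const_mul _)
      (fun k => ae_of_all _ (fun q => L.Kcut_le vb k q)) (ae_of_all _ (fun q => Kcut_pt _ q))
  have T3 : Filter.Tendsto W Filter.atTop (nhds ((∫ x, φ x * ρ t x ∂hl) * 2 - (∫ x, φ x * ρ 0 x ∂hl) * 2)) := by
    refine (((L.conv φ hφ t ht).mul_const 2).sub ((L.conv φ hφ 0 le_rfl).mul_const 2)).congr (fun n => ?_)
    have := L.fam.weak_lin (L.e0 n) (L.e1 n) hφ le_rfl ht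
    rw [intervalIntegral.integral_const_mul] at this
    rw [hW]; simp only; linarith
  have key : ∀ κ, 0 < κ → ∃ k0, ∀ k, k0 ≤ k → ∀ n, |W n - Wk k n| ≤ κ := by
    intro κ hκ
    set η := κ / (2 * (D + 1)) with hη
    have η0 : 0 < η := by positivity
    obtain ⟨h, hh, hs⟩ := hφ.small η0
    set ζ := κ / (2 * (t * (3 * B * (2 * CK * M)) + 1)) with hζ
    have hden : 0 < t * (3 * B * (2 * CK * M)) + 1 := by positivity
    have ζ0 : 0 < ζ := by positivity
    obtain ⟨R0, hR0⟩ := Filter.eventually_atTop.1 (L.fam.tl_lim.eventually (gt_mem_nhds ζ0))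
    obtain ⟨k0, hk0⟩ := exists_nat_gt (1 / h + |R0| + R1)
    refine ⟨k0, fun k hk n => ?_⟩
    have hk' : (k0:ℝ) ≤ k := by exact_mod_cast hk
    have h1h : 0 < 1 / h := by positivity
    have R1' := L.fam.R1_one
    set R : ℝ := (k:ℝ) + 1 with hR
    have hRR0 : R0 ≤ R := by linarith [le_abs_self R0, abs_nonneg R0]
    have hRR1 : R1 ≤ R := by linarith [abs_nonneg R0]
    have hRh : 1 / R ≤ h := by
      rw [div_le_iff₀ (by positivity)]
      have : h * (1 / h) = 1 := by field_simp
      nlinarith [abs_nonneg R0]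
    have tlR : tl R ≤ ζ := (hR0 R hRR0).le
    have e0 := L.e0 n
    have e1 := L.e1 n
    set g : ℕ × ℕ → ℝ := fun p => vphi φ (ε n * p.1) (ε n * p.2) * (1 - cut k (ε n * p.1) * cut k (ε n * p.2)) with hg
    have cc0 : ∀ x y, 0 ≤ cut k x * cut k y := fun x y => mul_nonneg (cut_nonneg _ _) (cut_nonneg _ _)
    have cc1 : ∀ x y, cut k x * cut k y ≤ 1 := fun x y => mul_le_one₀ (cut_le _ _) (cut_nonneg _ _) (cut_le _ _)
    have gle : ∀ p : ℕ × ℕ, |g p| ≤ |vphi φ (ε n * p.1) (ε n * p.2)| := by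
      intro p
      rw [hg]; simp only; rw [abs_mul]
      refine mul_le_of_le_one_right (abs_nonneg _) ?_
      rw [abs_le]
      constructor <;> linarith [cc0 (ε n * p.1) (ε n * p.2), cc1 (ε n * p.1) (ε n * p.2)]
    have gb : ∀ p, |g p| ≤ 3 * B := fun p => (gle p).trans (vb _ _)
    have hb1 : ∀ p : ℕ × ℕ, |vphi φ (ε n * p.1) (ε n * p.2)| ≤ 3 * B := fun p => vb _ _
    have hb2 : ∀ p : ℕ × ℕ, |vphi φ (ε n * p.1) (ε n * p.2) * (cut k (ε n * p.1) * cut k (ε n * p.2))| ≤ 3 * B := by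
      intro p
      rw [abs_mul, abs_of_nonneg (cc0 _ _)]
      exact (mul_le_of_le_one_right (abs_nonneg _) (cc1 _ _)).trans (vb _ _)
    have I1 := L.fam.CV_int e0 e1 (fun p _ => vphi φ (ε n * p.1) (ε n * p.2)) (fun p _ => hb1 p) (fun p => measurable_const) 0 t
    have I2 := L.fam.CV_int e0 e1 (fun p _ => vphi φ (ε n * p.1) (ε n * p.2) * (cut k (ε n * p.1) * cut k (ε n * p.2)))
      (fun p _ => hb2 p) (fun p => measurable_const) 0 t
    have e : W n - Wk k n = ∫ τ in (0:ℝ)..t, ∑' p, rbkC K F (ε n) p τ * g p := by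
      rw [hW, hWk]; simp only
      rw [← intervalIntegral.integral_sub I1 I2]
      congr 1; ext τ
      rw [← (L.fam.CV_sum e0 e1 τ _ hb1).tsum_sub (L.fam.CV_sum e0 e1 τ _ hb2)]
      congr 1; ext p
      rw [hg]; ring
    have hpt : ∀ τ, ‖∑' p, rbkC K F (ε n) p τ * g p‖ ≤ η * (∑' p, rbkC K F (ε n) p τ) + 3 * B * (2 * CK * M) * ζ := by
      intro τ
      have := L.fam.rate_split e0 e1 τ (g := g) (B := 3 * B) (η := η) (h := h) (R := R) (C := 0) gb η0.le (by positivity)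
        hRR1 le_rfl (fun p q1 q2 hm => (gle p).trans (hs _ _ (by positivity) (by positivity) hm))
        (fun p q1 q2 a1 a2 a3 a4 => by
          have : g p = 0 := by
            rw [hg]; simp only
            rw [cut_one (hRh.trans a1) a3, cut_one (hRh.trans a2) a4]; ring
          rw [this]; simp)
      rw [Real.norm_eq_abs]
      refine this.trans ?_
      have : 3 * B * (2 * CK * M * tl R) ≤ 3 * B * (2 * CK * M) * ζ := by
        rw [← mul_assoc]; exact mul_le_mul_of_nonneg_left tlR (by positivity)
      linarith
    have I := L.fam.tot_int e0 e1 0 t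
    have fin := intervalIntegral.norm_integral_le_of_norm_le ht
      (Filter.Eventually.of_forall (fun τ _ => hpt τ)) ((I.const_mul η).add intervalIntegrable_const)
    rw [e, ← Real.norm_eq_abs]
    refine fin.trans ?_
    rw [intervalIntegral.integral_add (I.const_mul η) intervalIntegrable_const,
      intervalIntegral.integral_const_mul, intervalIntegral.integral_const, smul_eq_mul, sub_zero]
    have d2 : η * ∫ τ in (0:ℝ)..t, ∑' p, rbkC K F (ε n) p τ ≤ κ / 2 := by
      calc η * ∫ τ in (0:ℝ)..t, ∑' p, rbkC K F (ε n) p τ ≤ η * (D + 1) := by gcongr; linarith [hdis (ε n) e0 e1]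
        _ = κ / 2 := by rw [hη]; field_simp
    have d3 : t * (3 * B * (2 * CK * M) * ζ) ≤ κ / 2 := by
      calc t * (3 * B * (2 * CK * M) * ζ) ≤ (t * (3 * B * (2 * CK * M)) + 1) * ζ := by nlinarith
        _ = κ / 2 := by rw [hζ]; field_simp
    linarith
  have T4 : Filter.Tendsto W Filter.atTop (nhds V) := by
    rw [Metric.tendsto_atTop]
    intro κ hκ
    obtain ⟨k0, hk0⟩ := key (κ / 4) (by positivity)
    obtain ⟨k1, hk1⟩ := Metric.tendsto_atTop.1 T2 (κ / 4) (by positivity)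
    set k := max k0 k1 with hk
    obtain ⟨n0, hn0⟩ := Metric.tendsto_atTop.1 (T1 k) (κ / 4) (by positivity)
    refine ⟨n0, fun n hn => ?_⟩
    have a := abs_le.1 (hk0 k (le_max_left _ _) n)
    have b := hk1 k (le_max_right _ _)
    have c := hn0 n hn
    rw [Real.dist_eq] at b c ⊢
    have b' := abs_lt.1 b
    have c' := abs_lt.1 c
    rw [abs_lt]; constructor <;> linarith [a.1, a.2, b'.1, b'.2, c'.1, c'.2]
  have := tendsto_nhds_unique T3 T4
  linarith

end RbkLim
open MeasureTheory

/-- Two finite measures agreeing on test functions agree on the half line. -/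
lemma restrict_eq_of_TF {P N : Measure ℝ} [IsFiniteMeasure P] [IsFiniteMeasure N]
    (h : ∀ φ, IsTF φ → ∫ x, φ x ∂P = ∫ x, φ x ∂N) : P.restrict (Set.Ioi 0) = N.restrict (Set.Ioi 0) := by
  refine ext_of_forall_integral_eq_of_IsFiniteMeasure (fun f => ?_)
  have TF : ∀ k, IsTF (fun x => f x * cut k x) := by
    intro k
    obtain ⟨_, a, b, ha, h1, h2⟩ := cut_TF k
    exact ⟨f.continuous.mul (cut_cont k), a, b, ha, fun x hx => by simp only [h1 x hx, mul_zero], fun x hx => by simp only [h2 x hx, mul_zero]⟩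
  have key : ∀ (Q : Measure ℝ) [IsFiniteMeasure Q], Filter.Tendsto (fun k => ∫ x, f x * cut k x ∂Q) Filter.atTop
      (nhds (∫ x in Set.Ioi (0:ℝ), f x ∂Q)) := by
    intro Q _
    rw [← integral_indicator measurableSet_Ioi]
    refine tendsto_integral_of_dominated_convergence (fun _ => ‖f‖) (fun k => (TF k).1.aestronglyMeasurable)
      (integrable_const _) (fun k => ae_of_all _ (fun x => ?_)) (ae_of_all _ (fun x => ?_))
    · rw [norm_mul]
      exact (mul_le_mul (f.norm_coe_le_norm x) (cut_abs k x) (abs_nonneg _) (norm_nonneg _)).trans (mul_one _).le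
    · by_cases hx : 0 < x
      · rw [Set.indicator_of_mem (show x ∈ Set.Ioi (0:ℝ) from hx)]
        simpa using (cut_tendsto hx).const_mul (f x)
      · rw [Set.indicator_of_notMem (show x ∉ Set.Ioi (0:ℝ) from hx)]
        refine tendsto_const_nhds.congr (fun k => ?_)
        rw [cut_low (le_trans (not_lt.1 hx) (by positivity)), mul_zero]
  refine tendsto_nhds_unique ((key P).congr (fun k => h _ (TF k))) (key N)

lemma integral_wd {X : Type*} [MeasurableSpace X] {μ : Measure X} {h : X → ℝ} (hm : Measurable h) (h0 : ∀ x, 0 ≤ h x)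
    (g : X → ℝ) : ∫ x, g x ∂(μ.withDensity (fun x => ENNReal.ofReal (h x))) = ∫ x, g x * h x ∂μ := by
  rw [integral_withDensity_eq_integral_toReal_smul hm.ennreal_ofReal (ae_of_all _ (fun x => ENNReal.ofReal_lt_top))]
  refine integral_congr_ae (ae_of_all _ (fun x => ?_))
  simp only [ENNReal.toReal_ofReal (h0 x), smul_eq_mul, mul_comm]

lemma integrable_bdd {X : Type*} [MeasurableSpace X] {μ : Measure X} {h : X → ℝ} (hi : Integrable h μ)
    {φ : X → ℝ} (hm : Measurable φ) {B : ℝ} (hB : ∀ x, |φ x| ≤ B) : Integrable (fun x => φ x * h x) μ :=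
  hi.bdd_mul hm.aestronglyMeasurable (ae_of_all _ hB)

lemma vphi_meas {φ : ℝ → ℝ} (hm : Measurable φ) : Measurable (fun q : ℝ × ℝ × ℝ => vphi φ q.2.1 q.2.2) := by
  unfold vphi
  have h1 : Measurable (fun q : ℝ × ℝ × ℝ => |q.2.1 - q.2.2|) := by
    have : Continuous (fun q : ℝ × ℝ × ℝ => |q.2.1 - q.2.2|) := by fun_prop
    exact this.measurable
  exact ((hm.comp h1).sub (hm.comp (by fun_prop))).sub (hm.comp (by fun_prop))

namespace RbkLim
variable {K : ℝ → ℝ → ℝ} {F : ℝ → ℕ → ℝ → ℝ} {M CK R1 : ℝ} {tl : ℝ → ℝ} {ε : ℕ → ℝ} {ρ : ℝ → ℝ → ℝ}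

lemma weak_ind (L : RbkLim K F M CK R1 tl ε ρ) {φ : ℝ → ℝ} (hm : Measurable φ) {B : ℝ} (hB : ∀ x, |φ x| ≤ B)
    (hz : ∀ x, x ≤ 0 → φ x = 0) {t : ℝ} (ht : 0 ≤ t) :
    (∫ x, φ x * ρ t x ∂hl) - ∫ x, φ x * ρ 0 x ∂hl = (1/2) * ∫ q, vphi φ q.2.1 q.2.2 * G K ρ q ∂(tss t) := by
  set Q := (tss t).withDensity (fun q => ENNReal.ofReal (G K ρ q)) with hQ
  set m1 := hl.withDensity (fun x => ENNReal.ofReal (ρ t x)) with hm1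
  set m0 := hl.withDensity (fun x => ENNReal.ofReal (ρ 0 x)) with hm0
  have : IsFiniteMeasure Q := isFiniteMeasure_withDensity_ofReal (L.G_int ht).2
  have : IsFiniteMeasure m1 := isFiniteMeasure_withDensity_ofReal (L.int1 t).2
  have : IsFiniteMeasure m0 := isFiniteMeasure_withDensity_ofReal (L.int1 0).2
  set a1 : ℝ × ℝ × ℝ → ℝ := fun q => q.2.1 with ha1
  set a2 : ℝ × ℝ × ℝ → ℝ := fun q => q.2.2 with ha2
  set a3 : ℝ × ℝ × ℝ → ℝ := fun q => |q.2.1 - q.2.2| with ha3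
  have A1 : Measurable a1 := by fun_prop
  have A2 : Measurable a2 := by fun_prop
  have A3 : Measurable a3 := by
    have : Continuous a3 := by rw [ha3]; fun_prop
    exact this.measurable
  have bi : ∀ (ψ : ℝ → ℝ) (C : ℝ) (Z : Measure ℝ) [IsFiniteMeasure Z], Measurable ψ → (∀ x, |ψ x| ≤ C) → Integrable ψ Z := by
    intro ψ C Z _ h1 h2
    exact Integrable.of_bound h1.aestronglyMeasurable C (ae_of_all _ h2)
  have Pi : ∀ (ψ : ℝ → ℝ) (C : ℝ), Measurable ψ → (∀ x, |ψ x| ≤ C) →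
      (∫ x, ψ x ∂(m1 + m1 + (Q.map a1 + Q.map a2)) - ∫ x, ψ x ∂(m0 + m0 + Q.map a3)) =
      2 * (∫ x, ψ x * ρ t x ∂hl) - 2 * (∫ x, ψ x * ρ 0 x ∂hl) - ∫ q, vphi ψ q.2.1 q.2.2 * G K ρ q ∂(tss t) := by
    intro ψ C h1 h2
    have b := fun (Z : Measure ℝ) [IsFiniteMeasure Z] => bi ψ C Z h1 h2
    rw [integral_add_measure (b _) (b _), integral_add_measure (b _) (b _), integral_add_measure (b _) (b _),
      integral_add_measure (b _) (b _), integral_add_measure (b _) (b _), integral_map A1.aemeasurable h1.aestronglyMeasurable,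
      integral_map A2.aemeasurable h1.aestronglyMeasurable, integral_map A3.aemeasurable h1.aestronglyMeasurable,
      hm1, hm0, hQ, integral_wd (L.meas_t t) (L.nonneg t), integral_wd (L.meas_t 0) (L.nonneg 0),
      integral_wd L.G_meas L.G_nonneg, integral_wd L.G_meas L.G_nonneg, integral_wd L.G_meas L.G_nonneg]
    have j1 := integrable_bdd (L.G_int ht) (h1.comp A1) (fun q => h2 _)
    have j2 := integrable_bdd (L.G_int ht) (h1.comp A2) (fun q => h2 _)
    have j3 := integrable_bdd (L.G_int ht) (h1.comp A3) (fun q => h2 _)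
    have e : ∫ q, vphi ψ q.2.1 q.2.2 * G K ρ q ∂(tss t) = ∫ q, ψ (a3 q) * G K ρ q ∂(tss t)
        - ∫ q, ψ (a1 q) * G K ρ q ∂(tss t) - ∫ q, ψ (a2 q) * G K ρ q ∂(tss t) := by
      have e1 := integral_sub j3 j1
      have e2 := integral_sub (j3.sub j1) j2
      simp only [Function.comp, Pi.sub_apply] at e1 e2
      rw [← e1, ← e2]
      refine integral_congr_ae (ae_of_all _ (fun q => ?_))
      simp only [vphi, ha1, ha2, ha3]; ring
    rw [e]; ring
  have eq : (m1 + m1 + (Q.map a1 + Q.map a2)).restrict (Set.Ioi 0) = (m0 + m0 + Q.map a3).restrict (Set.Ioi 0) := by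
    refine restrict_eq_of_TF (fun ψ hψ => ?_)
    obtain ⟨C, _, hC⟩ := hψ.bdd
    have h1 := Pi ψ C hψ.1.measurable hC
    have h2 := L.weak_TF hψ ht
    linarith
  have h1 := Pi φ B hm hB
  have ind : ∀ Z : Measure ℝ, ∫ x, φ x ∂Z = ∫ x in Set.Ioi (0:ℝ), φ x ∂Z := by
    intro Z
    rw [← integral_indicator measurableSet_Ioi]
    congr 1; ext x
    by_cases hx : 0 < x
    · rw [Set.indicator_of_mem (show x ∈ Set.Ioi (0:ℝ) from hx)]
    · rw [Set.indicator_of_notMem (show x ∉ Set.Ioi (0:ℝ) from hx), hz x (not_lt.1 hx)]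
  rw [ind, ind (m0 + m0 + Q.map a3), eq] at h1
  linarith

/-- integral of the collision density -/
noncomputable def Phi (K : ℝ → ℝ → ℝ) (ρ : ℝ → ℝ → ℝ) (t : ℝ) : ℝ := ∫ q, G K ρ q ∂(tss t)

lemma Phi_cont (L : RbkLim K F M CK R1 tl ε ρ) (T : ℝ) (hT : 0 ≤ T) : ContinuousOn (Phi K ρ) (Set.Icc 0 T) := by
  have hi : IntegrableOn (fun τ => ∫ p, G K ρ (τ, p) ∂(hl.prod hl)) (Set.Icc 0 T) := by
    rw [integrableOn_Icc_iff_integrableOn_Ioc]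
    exact (L.G_int hT).integral_prod_left
  refine (intervalIntegral.continuousOn_primitive hi).congr (fun t ht => ?_)
  exact integral_prod _ (L.G_int ht.1)

lemma tss_add {s t : ℝ} (hs : 0 ≤ s) (hst : s ≤ t) :
    tss t = tss s + (volume.restrict (Set.Ioc s t)).prod (hl.prod hl) := by
  unfold tss
  rw [← Measure.add_prod, ← Measure.restrict_union _ measurableSet_Ioc, Set.Ioc_union_Ioc_eq_Ioc hs hst]
  rw [Set.disjoint_left]
  intro x hx hy
  exact absurd hx.2 (not_le.2 hy.1)

lemma l1_step (L : RbkLim K F M CK R1 tl ε ρ) {s t : ℝ} (hs : 0 ≤ s) (hst : s ≤ t) :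
    ∫ x, |ρ t x - ρ s x| ∂hl ≤ 3 / 2 * (Phi K ρ t - Phi K ρ s) := by
  set φ : ℝ → ℝ := (Set.Ioi 0 ∩ {x | ρ s x ≤ ρ t x}).indicator 1 - (Set.Ioi 0 ∩ {x | ρ t x < ρ s x}).indicator 1 with hφ
  have s1 : MeasurableSet (Set.Ioi 0 ∩ {x | ρ s x ≤ ρ t x}) :=
    measurableSet_Ioi.inter (measurableSet_le (L.meas_t s) (L.meas_t t))
  have s2 : MeasurableSet (Set.Ioi 0 ∩ {x | ρ t x < ρ s x}) :=
    measurableSet_Ioi.inter (measurableSet_lt (L.meas_t t) (L.meas_t s))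
  have hm : Measurable φ := (measurable_one.indicator s1).sub (measurable_one.indicator s2)
  have val : ∀ x, φ x = if 0 < x then (if ρ s x ≤ ρ t x then 1 else -1) else 0 := by
    intro x
    rw [hφ]
    by_cases hx : 0 < x <;> by_cases h : ρ s x ≤ ρ t x <;> simp [Set.indicator, hx, h, not_lt.2, not_le.1]
  have hB : ∀ x, |φ x| ≤ 1 := by
    intro x; rw [val]; split_ifs <;> simp
  have hz : ∀ x, x ≤ 0 → φ x = 0 := by
    intro x hx; rw [val, if_neg (not_lt.2 hx)]
  have ht := hs.trans hst
  have w1 := L.weak_ind hm hB hz hs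
  have w2 := L.weak_ind hm hB hz ht
  set ν := (volume.restrict (Set.Ioc s t)).prod (hl.prod hl) with hν
  have ad := tss_add hs hst
  have Gi := L.G_int ht
  have Gs := L.G_int hs
  have Gn : Integrable (G K ρ) ν := by
    rw [ad] at Gi; exact Gi.right_of_add_measure
  have vb : ∀ q : ℝ × ℝ × ℝ, |vphi φ q.2.1 q.2.2| ≤ 3 := fun q => by
    have := vphi_bdd hB q.2.1 q.2.2; linarith
  have vm := vphi_meas hm
  have V : ∫ q, vphi φ q.2.1 q.2.2 * G K ρ q ∂(tss t) = ∫ q, vphi φ q.2.1 q.2.2 * G K ρ q ∂(tss s)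
      + ∫ q, vphi φ q.2.1 q.2.2 * G K ρ q ∂ν := by
    rw [ad]; exact integral_add_measure (integrable_bdd Gs vm vb) (integrable_bdd Gn vm vb)
  have P : Phi K ρ t = Phi K ρ s + ∫ q, G K ρ q ∂ν := by
    unfold Phi
    rw [ad]; exact integral_add_measure Gs Gn
  have e : ∫ x, |ρ t x - ρ s x| ∂hl = (∫ x, φ x * ρ t x ∂hl) - ∫ x, φ x * ρ s x ∂hl := by
    rw [← integral_sub (integrable_bdd (L.int1 t) hm hB) (integrable_bdd (L.int1 s) hm hB)]
    refine setIntegral_congr_fun measurableSet_Ioi (fun x hx => ?_)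
    rw [val, if_pos (show 0 < x from hx)]
    split_ifs with h
    · rw [abs_of_nonneg (by linarith)]; ring
    · rw [abs_of_neg (by linarith)]; ring
  have b : ∫ q, vphi φ q.2.1 q.2.2 * G K ρ q ∂ν ≤ 3 * ∫ q, G K ρ q ∂ν := by
    rw [← integral_const_mul]
    refine integral_mono (integrable_bdd Gn vm vb) (Gn.const_mul 3) (fun q => ?_)
    exact mul_le_mul_of_nonneg_right ((le_abs_self _).trans (vb q)) (L.G_nonneg q)
  rw [e, P]; linarith

lemma l1_cont (L : RbkLim K F M CK R1 tl ε ρ) {t : ℝ} (ht : 0 ≤ t) :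
    Filter.Tendsto (fun s : ℝ => ∫ x in Set.Ioi (0:ℝ), |ρ s x - ρ t x|) (nhdsWithin t (Set.Ici 0)) (nhds 0) := by
  have c : ContinuousWithinAt (Phi K ρ) (Set.Icc 0 (t+1)) t := L.Phi_cont (t+1) (by linarith) t ⟨ht, by linarith⟩
  have c2 : Filter.Tendsto (Phi K ρ) (nhdsWithin t (Set.Ici 0)) (nhds (Phi K ρ t)) := by
    refine c.mono_of_mem_nhdsWithin ?_
    have : Set.Iio (t+1) ∈ nhds t := Iio_mem_nhds (by linarith)
    filter_upwards [self_mem_nhdsWithin, mem_nhdsWithin_of_mem_nhds this] with s h1 h2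
    exact ⟨h1, le_of_lt h2⟩
  have c3 : Filter.Tendsto (fun s => 3 / 2 * |Phi K ρ s - Phi K ρ t|) (nhdsWithin t (Set.Ici 0)) (nhds 0) := by
    have := ((c2.sub_const (Phi K ρ t)).abs).const_mul (3/2)
    simpa using this
  refine squeeze_zero' (Filter.Eventually.of_forall (fun s => integral_nonneg (fun x => abs_nonneg _))) ?_ c3
  filter_upwards [self_mem_nhdsWithin] with s hs
  rcases le_total s t with h | h
  · have := L.l1_step hs h
    have e : ∫ x in Set.Ioi (0:ℝ), |ρ s x - ρ t x| = ∫ x, |ρ t x - ρ s x| ∂hl := by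
      simp only [abs_sub_comm]; rfl
    rw [e]
    refine this.trans (mul_le_mul_of_nonneg_left ?_ (by norm_num))
    rw [abs_sub_comm]; exact le_abs_self _
  · have := L.l1_step ht h
    exact this.trans (mul_le_mul_of_nonneg_left (le_abs_self _) (by norm_num))

end RbkLim
open MeasureTheory

lemma tss_diag (t : ℝ) : tss t {q | q.2.1 = q.2.2} = 0 := by
  have h : MeasurableSet {p : ℝ × ℝ | p.1 = p.2} := measurableSet_eq_fun measurable_fst measurable_snd
  have h0 : (hl.prod hl) {p : ℝ × ℝ | p.1 = p.2} = 0 := by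
    rw [Measure.measure_prod_null h]
    refine ae_of_all _ (fun x => ?_)
    have : Prod.mk x ⁻¹' {p : ℝ × ℝ | p.1 = p.2} = {x} := by
      ext y; simp [eq_comm]
    simp only [this, hl]
    exact le_antisymm ((Measure.restrict_apply_le _ _).trans (by simp)) bot_le
  have e : {q : ℝ × ℝ × ℝ | q.2.1 = q.2.2} = Set.univ ×ˢ {p : ℝ × ℝ | p.1 = p.2} := by
    ext q; simp
  unfold tss
  rw [e, Measure.prod_prod, h0, mul_zero]

/-- the frozen region -/
def regS (t : ℝ) : Set (ℝ × ℝ × ℝ) := {q : ℝ × ℝ × ℝ | 0 < q.1 ∧ q.1 < t ∧ 0 < q.2.2 ∧ q.2.2 < q.2.1}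

lemma tss_reg (t : ℝ) : (tss t).restrict {q | q.2.2 < q.2.1} = volume.restrict (regS t) := by
  have hD : MeasurableSet {q : ℝ × ℝ × ℝ | q.2.2 < q.2.1} := measurableSet_lt (by fun_prop) (by fun_prop)
  unfold tss hl
  rw [← Measure.restrict_congr_set (Ioo_ae_eq_Ioc (a := (0:ℝ)) (b := t)), Measure.prod_restrict, Measure.prod_restrict,
    Measure.restrict_restrict hD]
  congr 1
  ext q
  simp only [regS, Set.mem_inter_iff, Set.mem_setOf_eq, Set.mem_prod, Set.mem_Ioo, Set.mem_Ioi]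
  constructor
  · rintro ⟨h1, ⟨h2, h3⟩, h4, h5⟩; exact ⟨h2, h3, h5, h1⟩
  · rintro ⟨h1, h2, h3, h4⟩; exact ⟨h4, ⟨h1, h2⟩, h3.trans h4, h3⟩

lemma regS_meas (t : ℝ) : MeasurableSet (regS t) := by
  have h1 : MeasurableSet {q : ℝ × ℝ × ℝ | 0 < q.1} := measurableSet_lt (by fun_prop) (by fun_prop)
  have h2 : MeasurableSet {q : ℝ × ℝ × ℝ | q.1 < t} := measurableSet_lt (by fun_prop) (by fun_prop)
  have h3 : MeasurableSet {q : ℝ × ℝ × ℝ | 0 < q.2.2} := measurableSet_lt (by fun_prop) (by fun_prop)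
  have h4 : MeasurableSet {q : ℝ × ℝ × ℝ | q.2.2 < q.2.1} := measurableSet_lt (by fun_prop) (by fun_prop)
  exact h1.inter (h2.inter (h3.inter h4))

lemma tss_half {g : ℝ × ℝ × ℝ → ℝ} {t : ℝ} (hg : Integrable g (tss t)) (hs : ∀ τ x y, g (τ, x, y) = g (τ, y, x)) :
    (1/2) * ∫ q, g q ∂(tss t) = ∫ q in regS t, g q := by
  have hD : MeasurableSet {q : ℝ × ℝ × ℝ | q.2.2 < q.2.1} := measurableSet_lt (by fun_prop) (by fun_prop)
  have hD' : MeasurableSet {q : ℝ × ℝ × ℝ | q.2.1 < q.2.2} := measurableSet_lt (by fun_prop) (by fun_prop)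
  rw [← tss_reg]
  have s1 := integral_add_compl hD hg
  have s2 : ∫ q in {q : ℝ × ℝ × ℝ | q.2.2 < q.2.1}ᶜ, g q ∂(tss t) = ∫ q in {q : ℝ × ℝ × ℝ | q.2.1 < q.2.2}, g q ∂(tss t) := by
    refine setIntegral_congr_set ?_
    have : ∀ᵐ q ∂(tss t), ¬ (q.2.1 = q.2.2) := by
      rw [ae_iff]; simpa using tss_diag t
    filter_upwards [this] with q hq
    refine propext ?_
    show ¬ (q.2.2 < q.2.1) ↔ q.2.1 < q.2.2
    rw [not_lt]; exact ⟨fun h => lt_of_le_of_ne h hq, le_of_lt⟩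
  have mp : MeasurePreserving (Prod.map id Prod.swap : ℝ × ℝ × ℝ → ℝ × ℝ × ℝ) (tss t) (tss t) :=
    (MeasurePreserving.id _).prod Measure.measurePreserving_swap
  have em : MeasurableEmbedding (Prod.map id Prod.swap : ℝ × ℝ × ℝ → ℝ × ℝ × ℝ) :=
    ((MeasurableEquiv.refl ℝ).prodCongr (MeasurableEquiv.prodComm (α := ℝ) (β := ℝ))).measurableEmbedding
  have s3 := mp.setIntegral_preimage_emb em g {q : ℝ × ℝ × ℝ | q.2.2 < q.2.1}
  have s4 : ∫ q in {q : ℝ × ℝ × ℝ | q.2.1 < q.2.2}, g q ∂(tss t) = ∫ q in {q : ℝ × ℝ × ℝ | q.2.2 < q.2.1}, g q ∂(tss t) := by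
    rw [← s3]
    refine integral_congr_ae (ae_of_all _ (fun q => ?_))
    exact hs q.1 q.2.1 q.2.2
  linarith

namespace RbkLim
variable {K : ℝ → ℝ → ℝ} {F : ℝ → ℕ → ℝ → ℝ} {M CK R1 : ℝ} {tl : ℝ → ℝ} {ε : ℕ → ℝ} {ρ : ℝ → ℝ → ℝ}

lemma G_reg (L : RbkLim K F M CK R1 tl ε ρ) {t : ℝ} (ht : 0 ≤ t) : IntegrableOn (G K ρ) (regS t) := by
  unfold IntegrableOn
  rw [← tss_reg]
  exact (L.G_int ht).integrableOn

lemma G_val {t : ℝ} {q : ℝ × ℝ × ℝ} (h : q ∈ regS t) : G K ρ q = K q.2.1 q.2.2 * ρ q.1 q.2.1 * ρ q.1 q.2.2 := by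
  unfold G
  rw [K0_eq K (h.2.2.1.trans h.2.2.2) h.2.2.1]; ring

lemma final1 (L : RbkLim K F M CK R1 tl ε ρ) {t : ℝ} (ht : 0 ≤ t) :
    IntegrableOn (fun q : ℝ × ℝ × ℝ => K q.2.1 q.2.2 * ρ q.1 q.2.1 * ρ q.1 q.2.2) (regS t) :=
  (L.G_reg ht).congr_fun (fun _ hq => G_val hq) (regS_meas t)

lemma final2 (L : RbkLim K F M CK R1 tl ε ρ) {t : ℝ} (ht : 0 ≤ t) {φ : ℝ → ℝ} (hm : Measurable φ) {B : ℝ} (hB : ∀ x, |φ x| ≤ B) :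
    IntegrableOn (fun q : ℝ × ℝ × ℝ => (φ (q.2.1 - q.2.2) - φ q.2.1 - φ q.2.2) *
            K q.2.1 q.2.2 * ρ q.1 q.2.1 * ρ q.1 q.2.2) (regS t) := by
  have i := integrable_bdd (L.G_reg ht) (vphi_meas hm) (fun q => vphi_bdd hB q.2.1 q.2.2)
  refine IntegrableOn.congr_fun i (fun q hq => ?_) (regS_meas t)
  simp only [G_val hq, vphi]
  rw [abs_of_pos (sub_pos.2 hq.2.2.2)]; ring

lemma final3 (L : RbkLim K F M CK R1 tl ε ρ) {t : ℝ} (ht : 0 ≤ t) {φ : ℝ → ℝ} (hm : Measurable φ) {B : ℝ} (hB : ∀ x, |φ x| ≤ B) :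
    (∫ x, (ρ t x - ρ 0 x) * φ x ∂hl) = ∫ q in regS t, (φ (q.2.1 - q.2.2) - φ q.2.1 - φ q.2.2) *
            K q.2.1 q.2.2 * ρ q.1 q.2.1 * ρ q.1 q.2.2 := by
  set ψ : ℝ → ℝ := (Set.Ioi 0).indicator φ with hψ
  have pm : Measurable ψ := hm.indicator measurableSet_Ioi
  have p1 : ∀ x, 0 < x → ψ x = φ x := fun x hx => Set.indicator_of_mem (show x ∈ Set.Ioi (0:ℝ) from hx) _
  have p0 : ∀ x, x ≤ 0 → ψ x = 0 := fun x hx => Set.indicator_of_notMem (show x ∉ Set.Ioi (0:ℝ) from not_lt.2 hx) _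
  have B0 : 0 ≤ B := (abs_nonneg _).trans (hB 0)
  have pB : ∀ x, |ψ x| ≤ B := by
    intro x
    rcases lt_or_ge 0 x with h | h
    · rw [p1 x h]; exact hB x
    · rw [p0 x h]; simpa using B0
  have w := L.weak_ind pm pB p0 ht
  have i := integrable_bdd (L.G_int ht) (vphi_meas pm) (fun q => vphi_bdd pB q.2.1 q.2.2)
  rw [tss_half i] at w
  · rw [← integral_sub (integrable_bdd (L.int1 t) pm pB) (integrable_bdd (L.int1 0) pm pB)] at w
    calc _ = ∫ x, (ψ x * ρ t x - ψ x * ρ 0 x) ∂hl := by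
          refine setIntegral_congr_fun measurableSet_Ioi (fun x hx => ?_)
          simp only [p1 x hx]; ring
      _ = _ := w
      _ = _ := by
        refine setIntegral_congr_fun (regS_meas t) (fun q hq => ?_)
        have h1 := hq.2.2.1
        have h2 := hq.2.2.2
        simp only [G_val hq, vphi]
        rw [abs_of_pos (sub_pos.2 hq.2.2.2), p1 _ (sub_pos.2 h2), p1 _ h1, p1 _ (h1.trans h2)]; ring
  · intro τ x y
    simp only [vphi, G, L.fam.K0_symm x y, abs_sub_comm x y]; ring

lemma init_ae (L : RbkLim K F M CK R1 tl ε ρ) {fin : ℝ → ℝ} (hi : IntegrableOn fin (Set.Ioi 0))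
    (h : ∀ φ, IsTF φ → ∫ x, φ x * ρ 0 x ∂hl = ∫ x, φ x * fin x ∂hl) : ∀ᵐ x ∂hl, ρ 0 x = fin x := by
  have li : IntegrableOn (fun x => ρ 0 x - fin x) (Set.Ioi 0) := (L.int1 0).sub hi
  have := isOpen_Ioi.ae_eq_zero_of_integral_contDiff_smul_eq_zero (μ := volume) li.locallyIntegrableOn (fun g gc gs gt => ?_)
  · unfold hl
    rw [ae_restrict_iff' measurableSet_Ioi]
    filter_upwards [this] with x hx h
    exact sub_eq_zero.1 (hx h)
  · have gTF : IsTF g := by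
      refine ⟨gc.continuous, ?_⟩
      by_cases hne : (tsupport g).Nonempty
      · obtain ⟨a, ha, hamin⟩ := gs.isCompact.exists_isLeast hne
        obtain ⟨b, hb, hbmax⟩ := gs.isCompact.exists_isGreatest hne
        have a0 : 0 < a := gt ha
        refine ⟨a / 2, b + 1, by positivity, fun x hx => ?_, fun x hx => ?_⟩
        · by_contra hne
          have := hamin (subset_tsupport g hne)
          linarith
        · by_contra hne
          have := hbmax (subset_tsupport g hne)
          linarith
      · have z : ∀ x, g x = 0 := by
          intro x; by_contra hx; exact hne ⟨x, subset_tsupport g hx⟩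
        exact ⟨1, 1, one_pos, fun x _ => z x, fun x _ => z x⟩
    obtain ⟨B, _, hB⟩ := gTF.bdd
    have e := h g gTF
    have e1 := integral_sub (integrable_bdd (L.int1 0) gTF.1.measurable hB)
      (integrable_bdd (show Integrable fin hl from hi) gTF.1.measurable hB)
    have e2 : ∫ x, g x • (ρ 0 x - fin x) = ∫ x in Set.Ioi (0:ℝ), (g x * ρ 0 x - g x * fin x) := by
      rw [← integral_indicator measurableSet_Ioi]
      congr 1; ext x
      by_cases hx : 0 < x
      · rw [Set.indicator_of_mem (show x ∈ Set.Ioi (0:ℝ) from hx), smul_eq_mul]; ring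
      · rw [Set.indicator_of_notMem (show x ∉ Set.Ioi (0:ℝ) from hx)]
        have : g x = 0 := by
          by_contra hne
          exact hx (gt (subset_tsupport g hne))
        rw [this, zero_smul]
    rw [e2]
    refine e1.trans ?_
    rw [e, sub_self]

end RbkLim
open MeasureTheory

/-- cell integrals of the initial datum -/
noncomputable def cint (h : ℝ → ℝ) (ε : ℝ) (i : ℕ) : ℝ := if i = 0 then 0 else ∫ x in cell ε i, h x

lemma idx_set {ε : ℝ} (hε : 0 < ε) {i : ℕ} (hi : i ≠ 0) : idx ε ⁻¹' {i} ∩ Set.Ioi 0 = cell ε i := by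
  have hi' : (1:ℝ) ≤ i := by exact_mod_cast Nat.one_le_iff_ne_zero.2 hi
  ext x
  constructor
  · rintro ⟨h1, h2⟩
    exact (idx_iff hε h2 i).1 h1
  · intro h
    have hx : 0 < x := by
      have := h.1
      have : 0 < ((i:ℝ) - 1/2) * ε := mul_pos (by linarith) hε
      linarith [h.1]
    exact ⟨(idx_iff hε hx i).2 h, hx⟩

lemma cell_sum {ε : ℝ} (hε : 0 < ε) {h : ℝ → ℝ} {w : ℕ → ℝ} (w0 : w 0 = 0)
    (hi : IntegrableOn (fun x => w (idx ε x) * h x) (Set.Ioi 0)) :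
    HasSum (fun i => w i * cint h ε i) (∫ x in Set.Ioi (0:ℝ), w (idx ε x) * h x) := by
  set S : ℕ → Set ℝ := fun i => idx ε ⁻¹' {i} ∩ Set.Ioi 0 with hS
  have Sm : ∀ i, MeasurableSet (S i) := fun i => ((idx_meas ε) (by simp)).inter measurableSet_Ioi
  have Sd : Pairwise (Function.onFun Disjoint S) := by
    intro i j hij
    rw [Function.onFun, Set.disjoint_left]
    rintro x ⟨h1, _⟩ ⟨h2, _⟩
    exact hij (h1.symm.trans h2)
  have SU : ⋃ i, S i = Set.Ioi 0 := by
    ext x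
    simp only [hS, Set.mem_iUnion, Set.mem_inter_iff]
    exact ⟨fun ⟨_, h⟩ => h.2, fun h => ⟨idx ε x, rfl, h⟩⟩
  have k := hasSum_integral_iUnion Sm Sd (f := fun x => w (idx ε x) * h x) (μ := volume) (by rw [SU]; exact hi)
  rw [SU] at k
  refine k.congr_fun (fun i => ?_)
  have e : ∫ x in S i, w (idx ε x) * h x = ∫ x in S i, w i * h x := by
    refine setIntegral_congr_fun (Sm i) (fun x hx => ?_)
    have : idx ε x = i := hx.1
    simp only [this]
  rw [e, integral_const_mul]
  unfold cint
  by_cases h0 : i = 0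
  · rw [h0, w0, zero_mul, zero_mul]
  · rw [if_neg h0, hS]; simp only; rw [idx_set hε h0]

lemma tsum_shift {g : ℕ → ℝ} (m : ℕ) (h : ∀ i, i < m → g i = 0) : ∑' j, g (m + j) = ∑' j, g j := by
  refine (add_right_injective m).tsum_eq (f := g) (fun i hi => ?_)
  have : ¬ i < m := fun hlt => hi (h i hlt)
  exact ⟨i - m, by simp only; omega⟩

lemma tsum_shift1 {g : ℕ → ℝ} (h : g 0 = 0) : ∑' j, g (j + 1) = ∑' j, g j := by
  rw [← tsum_shift (g := g) 1 (fun i hi => by rw [Nat.lt_one_iff.1 hi, h])]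
  simp only [add_comm 1]

/-- extension of the discrete solution to all times and index `0` -/
noncomputable def Fd (f : ℝ → ℕ → ℝ → ℝ) (ε : ℝ) (i : ℕ) (t : ℝ) : ℝ := if i = 0 then 0 else f ε i (max t 0)

lemma Fd_zero (f : ℝ → ℕ → ℝ → ℝ) (ε t : ℝ) : Fd f ε 0 t = 0 := by simp [Fd]
lemma Fd_succ (f : ℝ → ℕ → ℝ → ℝ) (ε : ℝ) {i : ℕ} (hi : i ≠ 0) (t : ℝ) : Fd f ε i t = f ε i (max t 0) := by simp [Fd, hi]
lemma Fd_max (f : ℝ → ℕ → ℝ → ℝ) (ε : ℝ) (i : ℕ) (t : ℝ) : Fd f ε i (max t 0) = Fd f ε i t := by simp [Fd]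

section
variable {K : ℝ → ℝ → ℝ} {fin : ℝ → ℝ} {f : ℝ → ℕ → ℝ → ℝ}

/-- one discrete solution -/
abbrev Sol (K : ℝ → ℝ → ℝ) (fin : ℝ → ℝ) (f : ℝ → ℕ → ℝ → ℝ) (ε : ℝ) : Prop :=
  IsDRBKSol (fun i j => ε * K (ε * i) (ε * j)) (fun i => ε⁻¹ * ∫ x in cell ε i, fin x) (f ε)

variable {ε : ℝ}

lemma Sol.nonneg (h : Sol K fin f ε) (i : ℕ) (t : ℝ) : 0 ≤ Fd f ε i t := by
  by_cases hi : i = 0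
  · rw [hi, Fd_zero]
  · rw [Fd_succ f ε hi]; exact h.1 i (Nat.one_le_iff_ne_zero.2 hi) _ (le_max_right _ _)

lemma Sol.init (h : Sol K fin f ε) (i : ℕ) : Fd f ε i 0 = ε⁻¹ * cint fin ε i := by
  by_cases hi : i = 0
  · rw [hi, Fd_zero]; simp [cint]
  · rw [Fd_succ f ε hi, max_self, h.2.1 i (Nat.one_le_iff_ne_zero.2 hi), cint, if_neg hi]

lemma Sol.deriv (h : Sol K fin f ε) {i : ℕ} (hi : 1 ≤ i) {t : ℝ} (ht : 0 ≤ t) :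
    HasDerivWithinAt (Fd f ε i)
      ((∑' j : ℕ, ε * K (ε * ((i + j : ℕ) : ℝ)) (ε * (j : ℝ)) * Fd f ε (i + j) t * Fd f ε j t) -
        ∑' j : ℕ, ε * K (ε * (i : ℝ)) (ε * (j : ℝ)) * Fd f ε i t * Fd f ε j t) (Set.Ici 0) t := by
  have d := (h.2.2.1 i hi t ht).2.2
  have i0 : i ≠ 0 := by omega
  rw [← tsum_shift1 (g := fun j : ℕ => ε * K (ε * ((i + j : ℕ) : ℝ)) (ε * (j : ℝ)) * Fd f ε (i + j) t * Fd f ε j t)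
    (by simp [Fd_zero]), ← tsum_shift1 (g := fun j : ℕ => ε * K (ε * (i : ℝ)) (ε * (j : ℝ)) * Fd f ε i t * Fd f ε j t)
    (by simp [Fd_zero])]
  have e : ∀ j : ℕ, j ≠ 0 → Fd f ε j t = f ε j t := fun j hj => by rw [Fd_succ f ε hj, max_eq_left ht]
  have e1 : ∀ j : ℕ, Fd f ε (j + 1) t = f ε (j+1) t := fun j => e _ (by omega)
  have e2 : ∀ j : ℕ, Fd f ε (i + (j + 1)) t = f ε (i + (j+1)) t := fun j => e _ (by omega)
  simp only [e1, e2, e i i0]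
  refine d.congr (fun s hs => ?_) (e i i0)
  rw [Fd_succ f ε i0, max_eq_left hs]

lemma Sol.cont (h : Sol K fin f ε) (i : ℕ) : Continuous (Fd f ε i) := by
  by_cases hi : i = 0
  · have : Fd f ε i = fun _ => 0 := by rw [hi]; exact funext (fun t => Fd_zero f ε t)
    rw [this]; exact continuous_const
  · have : Fd f ε i = fun t => f ε i (max t 0) := funext (fun t => Fd_succ f ε hi t)
    rw [this]
    have c : ContinuousOn (f ε i) (Set.Ici 0) := fun t ht =>
      (h.2.2.1 i (Nat.one_le_iff_ne_zero.2 hi) t ht).2.2.continuousWithinAt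
    exact c.comp_continuous (by fun_prop) (fun t => Set.mem_Ici.2 (le_max_right t 0))

lemma Sol.sum1 (h : Sol K fin f ε) (t : ℝ) : Summable (fun i : ℕ => (i:ℝ) * Fd f ε i t) := by
  rw [← summable_nat_add_iff 1]
  refine (h.2.2.2.2.1 (max t 0) (le_max_right _ _)).congr (fun i => ?_)
  rw [Fd_succ f ε (by omega)]; push_cast; ring

lemma Sol.sum0 (h : Sol K fin f ε) (t : ℝ) : Summable (fun i : ℕ => Fd f ε i t) := by
  refine Summable.of_nonneg_of_le (fun i => h.nonneg i t) (fun i => ?_) (h.sum1 t)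
  by_cases hi : i = 0
  · rw [hi, Fd_zero, mul_zero]
  · have : (1:ℝ) ≤ i := by exact_mod_cast Nat.one_le_iff_ne_zero.2 hi
    nlinarith [h.nonneg i t]

lemma Sol.mass1 (h : Sol K fin f ε) (t : ℝ) : ∑' i : ℕ, (i:ℝ) * Fd f ε i t ≤ ∑' i : ℕ, (i:ℝ) * Fd f ε i 0 := by
  rw [← tsum_shift1 (by simp), ← tsum_shift1 (g := fun i : ℕ => (i:ℝ) * Fd f ε i 0) (by simp)]
  have := h.2.2.2.2.2.1 (max t 0) (le_max_right _ _)
  refine le_of_eq_of_le ?_ (this.trans_eq ?_)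
  · refine tsum_congr (fun i => ?_)
    rw [Fd_succ f ε (by omega)]; push_cast; ring
  · refine tsum_congr (fun i => ?_)
    rw [h.init, cint, if_neg (by omega)]; push_cast; ring

lemma Sol.mass0 (h : Sol K fin f ε) (t : ℝ) : ∑' i : ℕ, Fd f ε i t ≤ ∑' i : ℕ, Fd f ε i 0 := by
  rw [← tsum_shift1 (Fd_zero f ε t), ← tsum_shift1 (g := fun i : ℕ => Fd f ε i 0) (Fd_zero f ε 0)]
  have := h.2.2.2.2.2.2.1 (max t 0) (le_max_right _ _)
  refine le_of_eq_of_le ?_ (this.trans_eq ?_)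
  · refine tsum_congr (fun i => ?_)
    rw [Fd_succ f ε (by omega)]
  · refine tsum_congr (fun i => ?_)
    rw [h.init, cint, if_neg (by omega)]

lemma Sol.tail (h : Sol K fin f ε) (m : ℕ) (t : ℝ) :
    ∑' i : ℕ, (if m < i then (i:ℝ) * Fd f ε i t else 0) ≤ ∑' i : ℕ, (if m < i then (i:ℝ) * Fd f ε i 0 else 0) := by
  rw [← tsum_shift (g := fun i : ℕ => (if m < i then (i:ℝ) * Fd f ε i t else 0)) (m+1) (fun i hi => if_neg (by omega)),
    ← tsum_shift (g := fun i : ℕ => (if m < i then (i:ℝ) * Fd f ε i 0 else 0)) (m+1) (fun i hi => if_neg (by omega))]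
  have := h.2.2.2.2.2.2.2 m 0 (max t 0) le_rfl (le_max_right _ _)
  refine le_of_eq_of_le ?_ (this.trans_eq ?_)
  · refine tsum_congr (fun i => ?_)
    rw [Fd_succ f ε (by omega), if_pos (by omega)]
  · refine tsum_congr (fun i => ?_)
    rw [Fd_succ f ε (by omega), if_pos (by omega), max_self]

end
open MeasureTheory

section
variable {K : ℝ → ℝ → ℝ} {fin : ℝ → ℝ} {f : ℝ → ℕ → ℝ → ℝ}

lemma fin_int (h : IntegrableOn (fun x => (1 + x) * fin x) (Set.Ioi 0)) : IntegrableOn fin (Set.Ioi 0) := by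
  have m : Measurable (fun x : ℝ => (1 + x)⁻¹) := by fun_prop
  have k : Integrable (fun x => (1 + x)⁻¹ * ((1 + x) * fin x)) (volume.restrict (Set.Ioi 0)) := by
    refine Integrable.bdd_mul (c := 1) h m.aestronglyMeasurable ?_
    refine ae_restrict_of_forall_mem measurableSet_Ioi (fun x hx => ?_)
    have : 0 < x := hx
    rw [norm_inv, Real.norm_eq_abs, abs_of_pos (by linarith)]
    exact inv_le_one_of_one_le₀ (by linarith)
  refine IntegrableOn.congr_fun k (fun x hx => ?_) measurableSet_Ioi
  have : 0 < x := hx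
  rw [← mul_assoc, inv_mul_cancel₀ (by linarith), one_mul]

lemma w_int (h : IntegrableOn (fun x => (1 + x) * fin x) (Set.Ioi 0)) (hn : ∀ x : ℝ, 0 < x → 0 ≤ fin x)
    {ε c : ℝ} {w : ℕ → ℝ} (hw : ∀ x, 0 < x → |w (idx ε x)| ≤ c * (1 + x)) :
    IntegrableOn (fun x => w (idx ε x) * fin x) (Set.Ioi 0) := by
  refine Integrable.mono' (h.const_mul c) ?_ ?_
  · exact ((measurable_from_nat (f := w)).comp (idx_meas ε)).aestronglyMeasurable.mul (fin_int h).aestronglyMeasurable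
  · refine ae_restrict_of_forall_mem measurableSet_Ioi (fun x hx => ?_)
    rw [norm_mul, Real.norm_eq_abs, Real.norm_eq_abs, abs_of_nonneg (hn x hx), ← mul_assoc]
    exact mul_le_mul_of_nonneg_right (hw x hx) (hn x hx)

lemma idx_two {ε x : ℝ} (hε : 0 < ε) (hx : 0 < x) : ε * (idx ε x : ℝ) ≤ 2 * x := by
  have c := abs_le.1 (idx_close hε hx)
  by_cases h : idx ε x = 0
  · rw [h]; simp; exact hx.le
  · have h1 : (1:ℝ) ≤ idx ε x := by exact_mod_cast Nat.one_le_iff_ne_zero.2 h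
    nlinarith

lemma Sol.F0 {ε : ℝ} (hε : 0 < ε) (h : Sol K fin f ε) (i : ℕ) : ε * Fd f ε i 0 = cint fin ε i := by
  rw [h.init, ← mul_assoc, mul_inv_cancel₀ hε.ne', one_mul]

lemma Sol.w_sum {ε : ℝ} (hε : 0 < ε) (hs : Sol K fin f ε) (h : IntegrableOn (fun x => (1 + x) * fin x) (Set.Ioi 0))
    (hn : ∀ x : ℝ, 0 < x → 0 ≤ fin x) {c : ℝ} {w : ℕ → ℝ} (w0 : w 0 = 0)
    (hw : ∀ x, 0 < x → |w (idx ε x)| ≤ c * (1 + x)) :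
    HasSum (fun i => ε * (w i * Fd f ε i 0)) (∫ x in Set.Ioi (0:ℝ), w (idx ε x) * fin x) := by
  refine (cell_sum hε w0 (w_int h hn hw)).congr_fun (fun i => ?_)
  rw [← hs.F0 hε]; ring

/-- mass constant -/
noncomputable def Mc (fin : ℝ → ℝ) : ℝ := 2 * ∫ x in Set.Ioi (0:ℝ), (1 + x) * fin x

/-- tail function -/
noncomputable def tlc (fin : ℝ → ℝ) (R : ℝ) : ℝ :=
  4 * ∫ x in Set.Ioi (0:ℝ), (Set.Ioi (R / 2)).indicator (fun x => (1 + x) * fin x) x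

lemma tlc_lim (h : IntegrableOn (fun x => (1 + x) * fin x) (Set.Ioi 0)) : Filter.Tendsto (tlc fin) Filter.atTop (nhds 0) := by
  have : Filter.Tendsto (fun R : ℝ => ∫ x in Set.Ioi (0:ℝ), (Set.Ioi (R / 2)).indicator (fun x => (1 + x) * fin x) x)
      Filter.atTop (nhds (∫ x in Set.Ioi (0:ℝ), (0:ℝ))) := by
    refine tendsto_integral_filter_of_dominated_convergence (fun x => ‖(1 + x) * fin x‖)
      (Filter.Eventually.of_forall (fun R => (h.aestronglyMeasurable.indicator measurableSet_Ioi)))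
      (Filter.Eventually.of_forall (fun R => ae_of_all _ (fun x => norm_indicator_le_norm_self _ _))) h.norm
      (ae_of_all _ (fun x => ?_))
    refine tendsto_const_nhds.congr' ?_
    filter_upwards [Filter.eventually_ge_atTop (2 * x)] with R hR
    rw [Set.indicator_of_notMem]
    rw [Set.mem_Ioi, not_lt]; linarith
  have := this.const_mul 4
  rw [integral_zero, mul_zero] at this
  exact this

lemma Sol.mass {ε : ℝ} (hε : 0 < ε) (hs : Sol K fin f ε) (h : IntegrableOn (fun x => (1 + x) * fin x) (Set.Ioi 0))
    (hn : ∀ x : ℝ, 0 < x → 0 ≤ fin x) (t : ℝ) : Summable (fun i : ℕ => (1 + ε * (i : ℝ)) * Fd f ε i t) ∧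
    ε * ∑' i : ℕ, (1 + ε * (i : ℝ)) * Fd f ε i t ≤ Mc fin := by
  have e : ∀ t, HasSum (fun i : ℕ => (1 + ε * (i : ℝ)) * Fd f ε i t) (∑' i, Fd f ε i t + ε * ∑' i : ℕ, (i:ℝ) * Fd f ε i t) := by
    intro t
    refine ((hs.sum0 t).hasSum.add ((hs.sum1 t).hasSum.mul_left ε)).congr_fun (fun i => ?_)
    ring
  refine ⟨(e t).summable, ?_⟩
  have le : ∑' i : ℕ, (1 + ε * (i : ℝ)) * Fd f ε i t ≤ ∑' i : ℕ, (1 + ε * (i : ℝ)) * Fd f ε i 0 := by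
    rw [(e t).tsum_eq, (e 0).tsum_eq]
    exact add_le_add (hs.mass0 t) (mul_le_mul_of_nonneg_left (hs.mass1 t) hε.le)
  refine (mul_le_mul_of_nonneg_left le hε.le).trans ?_
  set w : ℕ → ℝ := fun i => if i = 0 then 0 else 1 + ε * i with hw
  have wv : ∀ x, 0 < x → 0 ≤ w (idx ε x) ∧ w (idx ε x) ≤ 2 * (1 + x) := by
    intro x hx
    have := idx_two hε hx
    rw [hw]; simp only
    split_ifs
    · exact ⟨le_rfl, by linarith⟩
    · exact ⟨by positivity, by linarith⟩
  have wb : ∀ x, 0 < x → |w (idx ε x)| ≤ 2 * (1 + x) := fun x hx => by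
    rw [abs_of_nonneg (wv x hx).1]; exact (wv x hx).2
  have s := hs.w_sum hε h hn (by rw [hw]; simp) wb
  have e2 : ε * ∑' i : ℕ, (1 + ε * (i : ℝ)) * Fd f ε i 0 = ∑' i, ε * (w i * Fd f ε i 0) := by
    rw [← tsum_mul_left]
    refine tsum_congr (fun i => ?_)
    by_cases hi : i = 0
    · rw [hi, Fd_zero]; simp
    · rw [hw]; simp only; rw [if_neg hi]
  rw [e2, s.tsum_eq, Mc, ← integral_const_mul]
  refine setIntegral_mono_on (w_int h hn wb) (h.const_mul 2) measurableSet_Ioi (fun x hx => ?_)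
  rw [← mul_assoc]
  exact mul_le_mul_of_nonneg_right (wv x hx).2 (hn x hx)

lemma Sol.tailR {ε : ℝ} (hε : 0 < ε) (hs : Sol K fin f ε) (h : IntegrableOn (fun x => (1 + x) * fin x) (Set.Ioi 0))
    (hn : ∀ x : ℝ, 0 < x → 0 ≤ fin x) (t R : ℝ) (hR : 1 ≤ R) :
    ε * ∑' i : ℕ, (if R < ε * (i : ℝ) then (1 + ε * (i : ℝ)) * Fd f ε i t else 0) ≤ tlc fin R := by
  set m := ⌊R / ε⌋₊ with hm
  have iff : ∀ i : ℕ, R < ε * (i:ℝ) ↔ m < i := by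
    intro i
    rw [hm, Nat.floor_lt (by positivity), div_lt_iff₀ hε, mul_comm]
  have sm : ∀ t, Summable (fun i : ℕ => if m < i then (i:ℝ) * Fd f ε i t else 0) := by
    intro t
    refine Summable.of_nonneg_of_le (fun i => ?_) (fun i => ?_) (hs.sum1 t)
    · have := hs.nonneg i t
      split_ifs <;> positivity
    · have := hs.nonneg i t
      split_ifs
      · exact le_rfl
      · positivity
  have key : ∀ i : ℕ, (if R < ε * (i : ℝ) then (1 + ε * (i : ℝ)) * Fd f ε i t else 0) ≤
      (2 * ε) * (if m < i then (i:ℝ) * Fd f ε i t else 0) := by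
    intro i
    have := hs.nonneg i t
    by_cases hi : R < ε * (i:ℝ)
    · rw [if_pos hi, if_pos ((iff i).1 hi)]
      have : (1 + ε * (i:ℝ)) ≤ 2 * ε * i := by linarith
      nlinarith
    · rw [if_neg hi, if_neg (fun h => hi ((iff i).2 h)), mul_zero]
  have s1 : Summable (fun i : ℕ => if R < ε * (i : ℝ) then (1 + ε * (i : ℝ)) * Fd f ε i t else 0) := by
    refine Summable.of_nonneg_of_le (fun i => ?_) key ((sm t).mul_left _)
    have := hs.nonneg i t
    split_ifs <;> positivity
  have b1 := Summable.tsum_le_tsum key s1 ((sm t).mul_left _)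
  rw [tsum_mul_left] at b1
  have b2 : ε * ∑' i : ℕ, (if R < ε * (i : ℝ) then (1 + ε * (i : ℝ)) * Fd f ε i t else 0) ≤
      ε * (2 * ε * ∑' i : ℕ, (if m < i then (i:ℝ) * Fd f ε i 0 else 0)) :=
    mul_le_mul_of_nonneg_left (b1.trans (mul_le_mul_of_nonneg_left (hs.tail m t) (by positivity))) hε.le
  refine b2.trans ?_
  set w : ℕ → ℝ := fun i => if m < i then ε * i else 0 with hw
  have wv : ∀ x, 0 < x → 0 ≤ w (idx ε x) ∧ w (idx ε x) ≤ 2 * (if R / 2 < x then 1 + x else 0) := by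
    intro x hx
    have t2 := idx_two hε hx
    rw [hw]; simp only
    by_cases hi : m < idx ε x
    · rw [if_pos hi]
      have := (iff _).2 hi
      rw [if_pos (by linarith)]
      exact ⟨by positivity, by linarith⟩
    · rw [if_neg hi]
      exact ⟨le_rfl, by split_ifs <;> positivity⟩
  have wb : ∀ x, 0 < x → |w (idx ε x)| ≤ 2 * (1 + x) := fun x hx => by
    rw [abs_of_nonneg (wv x hx).1]
    refine (wv x hx).2.trans ?_
    split_ifs
    · exact le_rfl
    · linarith
  have s := hs.w_sum hε h hn (by rw [hw]; simp) wb
  have e2 : ε * (2 * ε * ∑' i : ℕ, (if m < i then (i:ℝ) * Fd f ε i 0 else 0)) = 2 * ∑' i, ε * (w i * Fd f ε i 0) := by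
    rw [← tsum_mul_left, ← tsum_mul_left, ← tsum_mul_left]
    refine tsum_congr (fun i => ?_)
    rw [hw]; simp only
    split_ifs <;> ring
  rw [e2, s.tsum_eq, tlc]
  have : ∫ x in Set.Ioi (0:ℝ), w (idx ε x) * fin x ≤
      ∫ x in Set.Ioi (0:ℝ), 2 * (Set.Ioi (R / 2)).indicator (fun x => (1 + x) * fin x) x := by
    refine setIntegral_mono_on (w_int h hn wb) ((h.indicator measurableSet_Ioi).const_mul 2) measurableSet_Ioi (fun x hx => ?_)
    have := mul_le_mul_of_nonneg_right (wv x hx).2 (hn x hx)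
    refine this.trans_eq ?_
    by_cases hx2 : R / 2 < x
    · rw [if_pos hx2, Set.indicator_of_mem (show x ∈ Set.Ioi (R/2) from hx2)]; ring
    · rw [if_neg hx2, Set.indicator_of_notMem (show x ∉ Set.Ioi (R/2) from hx2)]; ring
  rw [integral_const_mul] at this
  linarith

lemma fin_UI (h : IntegrableOn fin (Set.Ioi 0)) (hn : ∀ x : ℝ, 0 < x → 0 ≤ fin x) {κ : ℝ} (hκ : 0 < κ) :
    ∃ L, 0 < L ∧ ∫ x in Set.Ioi (0:ℝ), max (fin x - L) 0 ≤ κ := by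
  have : Filter.Tendsto (fun L : ℝ => ∫ x in Set.Ioi (0:ℝ), max (fin x - L) 0) Filter.atTop
      (nhds (∫ x in Set.Ioi (0:ℝ), (0:ℝ))) := by
    refine tendsto_integral_filter_of_dominated_convergence fin
      (Filter.Eventually.of_forall (fun R => ((h.aestronglyMeasurable.sub aestronglyMeasurable_const).sup aestronglyMeasurable_const)))
      ?_ h (ae_of_all _ (fun x => ?_))
    · filter_upwards [Filter.eventually_ge_atTop 0] with L hL
      refine ae_restrict_of_forall_mem measurableSet_Ioi (fun x hx => ?_)
      rw [Real.norm_eq_abs, abs_of_nonneg (le_max_right _ _)]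
      exact max_le (by linarith) (hn x hx)
    · refine tendsto_const_nhds.congr' ?_
      filter_upwards [Filter.eventually_ge_atTop (fin x)] with R hR
      rw [max_eq_right (by linarith)]
  rw [integral_zero] at this
  obtain ⟨L, h1, h2⟩ := ((this.eventually (gt_mem_nhds hκ)).and (Filter.eventually_gt_atTop 0)).exists
  exact ⟨L, h2, h1.le⟩

lemma Sol.UI {ε : ℝ} (hε : 0 < ε) (hs : Sol K fin f ε) (h : IntegrableOn fin (Set.Ioi 0))
    (hn : ∀ x : ℝ, 0 < x → 0 ≤ fin x) {L : ℝ} (hL : 0 < L) (m : ℕ) :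
    ∑ i ∈ Finset.range m, ε * max (Fd f ε i 0 - L) 0 ≤ ∫ x in Set.Ioi (0:ℝ), max (fin x - L) 0 := by
  have i1 : IntegrableOn (fun x => max (fin x - L) 0) (Set.Ioi 0) := by
    refine Integrable.mono' h ((h.aestronglyMeasurable.sub aestronglyMeasurable_const).sup aestronglyMeasurable_const) ?_
    refine ae_restrict_of_forall_mem measurableSet_Ioi (fun x hx => ?_)
    rw [Real.norm_eq_abs]
    have : max (fin x - L) 0 ≤ fin x := max_le (by linarith) (hn x hx)
    rwa [abs_of_nonneg (le_max_right _ _)]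
  set w : ℕ → ℝ := fun i => if i = 0 then 0 else 1 with hw
  have wv : ∀ i, 0 ≤ w i ∧ w i ≤ 1 := by
    intro i; rw [hw]; simp only; split_ifs <;> norm_num
  have i2 : IntegrableOn (fun x => w (idx ε x) * max (fin x - L) 0) (Set.Ioi 0) := by
    refine Integrable.bdd_mul (c := 1) i1 ((measurable_from_nat (f := w)).comp (idx_meas ε)).aestronglyMeasurable (ae_of_all _ (fun x => ?_))
    rw [Real.norm_eq_abs, abs_of_nonneg (wv _).1]; exact (wv _).2
  have s := cell_sum hε (h := fun x => max (fin x - L) 0) (w := w) (by rw [hw]; simp) i2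
  have cn : ∀ i, 0 ≤ cint (fun x => max (fin x - L) 0) ε i := by
    intro i; unfold cint; split_ifs
    · exact le_rfl
    · exact integral_nonneg (fun x => le_max_right _ _)
  have key : ∀ i, ε * max (Fd f ε i 0 - L) 0 ≤ w i * cint (fun x => max (fin x - L) 0) ε i := by
    intro i
    by_cases hi : i = 0
    · rw [hi, Fd_zero, max_eq_right (by linarith)]
      simp [cint]
    · have hc : cell ε i ⊆ Set.Ioi 0 := by rw [← idx_set hε hi]; exact Set.inter_subset_right
      have hv : volume.real (cell ε i) = ε := by
        unfold cell
        rw [Real.volume_real_Ico_of_le (by nlinarith)]; ring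
      have fv : volume (cell ε i) ≠ ⊤ := by unfold cell; simp
      have j1 := h.mono_set hc
      have j2 : IntegrableOn (fun _ => L) (cell ε i) := integrableOn_const (by exact fv)
      have e1 : ε * (Fd f ε i 0 - L) = ∫ x in cell ε i, (fin x - L) := by
        rw [integral_sub j1 j2, setIntegral_const, hv, mul_sub, hs.F0 hε, cint, if_neg hi, smul_eq_mul]
      rw [mul_max_of_nonneg _ _ hε.le, e1, mul_zero]
      rw [hw]; simp only; rw [if_neg hi, one_mul, cint, if_neg hi]
      refine max_le ?_ (integral_nonneg (fun x => le_max_right _ _))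
      exact integral_mono (j1.sub j2) (i1.mono_set hc) (fun x => le_max_left _ _)
  refine (Finset.sum_le_sum (fun i _ => key i)).trans ?_
  refine (sum_le_hasSum _ (fun i _ => mul_nonneg (wv i).1 (cn i)) s).trans ?_
  refine setIntegral_mono_on i2 i1 measurableSet_Ioi (fun x hx => ?_)
  exact mul_le_of_le_one_left (le_max_right _ _) (wv _).2

lemma Lam_init {ε : ℕ → ℝ} (e0 : ∀ n, 0 < ε n) (el : Filter.Tendsto ε Filter.atTop (nhds 0))
    (hs : ∀ n, Sol K fin f (ε n)) (h : IntegrableOn (fun x => (1 + x) * fin x) (Set.Ioi 0))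
    (hn : ∀ x : ℝ, 0 < x → 0 ≤ fin x) {φ : ℝ → ℝ} (hφ : IsTF φ) :
    Filter.Tendsto (fun n => Lam (Fd f) (ε n) φ 0) Filter.atTop (nhds (∫ x in Set.Ioi (0:ℝ), φ x * fin x)) := by
  obtain ⟨B, hB0, hB⟩ := hφ.bdd
  have wb : ∀ n, ∀ x, 0 < x → |(fun i : ℕ => φ (ε n * (i:ℝ))) (idx (ε n) x)| ≤ B * (1 + x) := by
    intro n x hx
    refine (hB _).trans ?_
    nlinarith
  have e : ∀ n, Lam (Fd f) (ε n) φ 0 = ∫ x in Set.Ioi (0:ℝ), φ (ε n * (idx (ε n) x : ℝ)) * fin x := by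
    intro n
    have s := (hs n).w_sum (e0 n) h hn (w := fun i : ℕ => φ (ε n * (i:ℝ))) (by simp [hφ.zero]) (wb n)
    unfold Lam
    rw [← s.tsum_eq]
    exact tsum_congr (fun i => by ring)
  simp_rw [e]
  have fi := fin_int h
  refine tendsto_integral_of_dominated_convergence (fun x => B * fin x) (fun n => (w_int h hn (w := fun i : ℕ => φ (ε n * (i:ℝ))) (wb n)).aestronglyMeasurable)
    (fi.const_mul B) (fun n => ?_) ?_
  · refine ae_restrict_of_forall_mem measurableSet_Ioi (fun x hx => ?_)
    rw [norm_mul, Real.norm_eq_abs, Real.norm_eq_abs, abs_of_nonneg (hn x hx)]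
    exact mul_le_mul_of_nonneg_right (hB _) (hn x hx)
  · refine ae_restrict_of_forall_mem measurableSet_Ioi (fun x hx => ?_)
    have t1 : Filter.Tendsto (fun n => ε n * (idx (ε n) x : ℝ)) Filter.atTop (nhds x) := by
      rw [tendsto_iff_norm_sub_tendsto_zero]
      refine squeeze_zero (fun n => norm_nonneg _) (fun n => idx_close (e0 n) hx) ?_
      simpa using el.div_const 2
    exact ((hφ.1.tendsto x).comp t1).mul_const _

end
open MeasureTheory

lemma K_big_of {K : ℝ → ℝ → ℝ} {r : ℝ → ℝ} {α : ℝ → ℝ → ℝ} {A : ℝ} (hA : 0 < A)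
    (hK_symm : ∀ x y : ℝ, 0 < x → 0 < y → K x y = K y x)
    (hr_nonneg : ∀ x : ℝ, 0 < x → 0 ≤ r x)
    (hK_form : ∀ x y : ℝ, 0 < x → 0 < y → K x y = r x * r y + α x y)
    (hα_bound : ∀ x y : ℝ, 1 ≤ x → 1 ≤ y → α x y ≤ A * r x * r y)
    {ω : ℝ → ℝ → ℝ}
    (hω_bound : ∀ R : ℝ, 1 ≤ R → ∀ y : ℝ, 0 < y → ∀ x : ℝ, 0 < x → x ≤ R → K x y / y ≤ ω R y)
    (hω_lim : ∀ R : ℝ, 1 ≤ R → Filter.Tendsto (ω R) Filter.atTop (nhds 0))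
    {Ω : ℝ → ℝ}
    (hΩ_bound : ∀ R : ℝ, 1 ≤ R → ∀ x : ℝ, R ≤ x → r x / x ≤ Ω R) :
    ∃ CK R1 : ℝ, 0 ≤ CK ∧ 1 ≤ R1 ∧
      ∀ x y : ℝ, 0 < x → 0 < y → R1 ≤ x → K x y ≤ CK * ((1 + x) * (1 + y)) := by
  obtain ⟨R0, hR0⟩ := Filter.eventually_atTop.1
    ((hω_lim 1 le_rfl).eventually (gt_mem_nhds (zero_lt_one (α := ℝ))))
  have Wr : ∀ x, 1 ≤ x → r x ≤ Ω 1 * x := by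
    intro x hx
    have := hΩ_bound 1 le_rfl x hx
    rwa [div_le_iff₀ (by linarith)] at this
  have W0 : 0 ≤ Ω 1 := by
    have a := Wr 1 le_rfl
    have b := hr_nonneg 1 one_pos
    linarith
  refine ⟨(1 + A) * Ω 1 ^ 2 + 1, max R0 1, by positivity, le_max_right _ _, fun x y hx hy hR => ?_⟩
  have hx1 : 1 ≤ x := (le_max_right _ _).trans hR
  have hx0 : R0 ≤ x := (le_max_left _ _).trans hR
  have hxy : x ≤ (1 + x) * (1 + y) := by nlinarith
  have hxy2 : x * y ≤ (1 + x) * (1 + y) := by nlinarith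
  have hp : 0 ≤ (1 + x) * (1 + y) := by positivity
  rcases le_or_gt 1 y with h | h
  · have a := hα_bound x y hx1 h
    have b : r x * r y ≤ (Ω 1 * x) * (Ω 1 * y) :=
      mul_le_mul (Wr x hx1) (Wr y h) (hr_nonneg y hy) (by positivity)
    have c : K x y ≤ (1 + A) * (r x * r y) := by rw [hK_form x y hx hy]; nlinarith
    have d : (1 + A) * (r x * r y) ≤ (1 + A) * ((Ω 1 * x) * (Ω 1 * y)) :=
      mul_le_mul_of_nonneg_left b (by linarith)
    have e : (1 + A) * Ω 1 ^ 2 * (x * y) ≤ (1 + A) * Ω 1 ^ 2 * ((1 + x) * (1 + y)) :=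
      mul_le_mul_of_nonneg_left hxy2 (by positivity)
    nlinarith
  · have a := hω_bound 1 le_rfl x hx y hy h.le
    have b := hR0 x hx0
    rw [div_le_iff₀ hx] at a
    rw [hK_symm x y hx hy]
    have c : ω 1 x * x ≤ 1 * x := mul_le_mul_of_nonneg_right b.le hx.le
    have e : 0 ≤ (1 + A) * Ω 1 ^ 2 * ((1 + x) * (1 + y)) := by positivity
    nlinarith

lemma fam_of {K : ℝ → ℝ → ℝ} {fin : ℝ → ℝ} {f : ℝ → ℕ → ℝ → ℝ} {CK R1 : ℝ}
    (hK_cont : ContinuousOn (fun p : ℝ × ℝ => K p.1 p.2) (Set.Ioi 0 ×ˢ Set.Ioi 0))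
    (hK_symm : ∀ x y : ℝ, 0 < x → 0 < y → K x y = K y x)
    (hK_nonneg : ∀ x y : ℝ, 0 < x → 0 < y → 0 ≤ K x y)
    (c0 : 0 ≤ CK) (r1 : 1 ≤ R1)
    (big : ∀ x y : ℝ, 0 < x → 0 < y → R1 ≤ x → K x y ≤ CK * ((1 + x) * (1 + y)))
    (hn : ∀ x : ℝ, 0 < x → 0 ≤ fin x)
    (h : IntegrableOn (fun x => (1 + x) * fin x) (Set.Ioi 0))
    (hs : ∀ ε : ℝ, 0 < ε → ε < 1 → Sol K fin f ε) :
    RbkFam K (Fd f) (Mc fin) CK R1 (tlc fin) where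
  K_cont := hK_cont
  K_symm := hK_symm
  K_nonneg := hK_nonneg
  CK_nonneg := c0
  R1_one := r1
  K_big := big
  F_zero ε t := Fd_zero f ε t
  F_nonneg ε h0 h1 i t := Sol.nonneg (hs ε h0 h1) i t
  F_cont ε h0 h1 i := Sol.cont (hs ε h0 h1) i
  F_deriv ε h0 h1 i hi t ht := Sol.deriv (hs ε h0 h1) hi ht
  F_sum ε h0 h1 t := (Sol.mass h0 (hs ε h0 h1) h hn t).1
  F_mass ε h0 h1 t := (Sol.mass h0 (hs ε h0 h1) h hn t).2
  F_tail ε h0 h1 t R hR := Sol.tailR h0 (hs ε h0 h1) h hn t R hR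
  tl_lim := tlc_lim h
  init_UI κ hκ := by
    obtain ⟨L, hL, hi⟩ := fin_UI (fin_int h) hn hκ
    exact ⟨L, hL, fun ε h0 h1 m => (Sol.UI h0 (hs ε h0 h1) (fin_int h) hn hL m).trans hi⟩

lemma lim_of {K : ℝ → ℝ → ℝ} {F : ℝ → ℕ → ℝ → ℝ} {M CK R1 : ℝ} {tl : ℝ → ℝ}
    (H : RbkFam K F M CK R1 tl) : ∃ (ε : ℕ → ℝ) (ρ : ℝ → ℝ → ℝ), RbkLim K F M CK R1 tl ε ρ ∧
      ∀ T, 0 < T → ∀ φ : ℝ → ℝ, Measurable φ → (∃ B, ∀ x, |φ x| ≤ B) → ∀ δ, 0 < δ →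
        ∃ N : ℕ, ∀ n, N ≤ n → ∀ t, 0 ≤ t → t ≤ T →
          |(∫ x in Set.Ioi (0:ℝ), φ x * F (ε n) (idx (ε n) x) t) - ∫ x in Set.Ioi (0:ℝ), φ x * ρ t x| ≤ δ := by
  obtain ⟨ε, e0, e1, el, hC⟩ := H.exists_limit
  obtain ⟨ρ, m, nn, rm, hi, ms, el2⟩ := (H.uFam e0 e1 el).limit hC
  refine ⟨ε, ρ, ⟨H, e0, e1, el, m, nn, rm, hi, ms, ?_⟩, ?_⟩
  · intro φ hφ t ht
    obtain ⟨B, _, hB⟩ := hφ.bdd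
    have a := UFam.ell_tendsto hC hφ.1.measurable hB ht
    rw [el2 φ B hφ.1.measurable hB t ht]
    have z : Filter.Tendsto (fun n => (∫ x in Set.Ioi (0:ℝ), φ x * uFn F ε n t x) - Lam F (ε n) φ t)
        Filter.atTop (nhds 0) := by
      rw [Metric.tendsto_atTop]
      intro κ hκ
      obtain ⟨d, hd, hL⟩ := H.Lam_close hφ (half_pos hκ)
      obtain ⟨N, hN⟩ := Filter.eventually_atTop.1 (el.eventually (gt_mem_nhds hd))
      refine ⟨N, fun n hn => ?_⟩
      rw [Real.dist_eq, sub_zero]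
      exact lt_of_le_of_lt (hL (ε n) (e0 n) (e1 n) (hN n hn) t) (half_lt_self hκ)
    have := a.sub z
    simpa using this
  · rintro T hT φ hm ⟨B, hB⟩ δ hδ
    obtain ⟨N, hN⟩ := UFam.ell_unif hC hm hB hT.le hδ
    refine ⟨N, fun n hn t h0 hT => ?_⟩
    rw [el2 φ B hm hB t h0]
    exact hN n hn t h0 hT

/-- main convergence theorem. Along a sequence `ε_n → 0`, the step functions
associated with solutions of the discrete RBK system converge in `C([0,T]; w-L¹(0,∞))` for
every `T > 0` to a nonnegative `f ∈ C([0,T]; L¹(0,∞)) ∩ L^∞(0,T; X_{0,1})` which is a weak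
solution of the continuous RBK coagulation equation with initial datum `f^in`, all
integrals in the weak formulation being absolutely convergent. -/
theorem stmt16
    (K : ℝ → ℝ → ℝ) (r : ℝ → ℝ) (α : ℝ → ℝ → ℝ) (A : ℝ) (hA : 0 < A)
    (hK_cont : ContinuousOn (fun p : ℝ × ℝ => K p.1 p.2) (Set.Ioi 0 ×ˢ Set.Ioi 0))
    (hK_symm : ∀ x y : ℝ, 0 < x → 0 < y → K x y = K y x)
    (hK_nonneg : ∀ x y : ℝ, 0 < x → 0 < y → 0 ≤ K x y)
    (hr_cont : ContinuousOn r (Set.Ioi 0))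
    (hr_nonneg : ∀ x : ℝ, 0 < x → 0 ≤ r x)
    (hα_cont : ContinuousOn (fun p : ℝ × ℝ => α p.1 p.2) (Set.Ioi 0 ×ˢ Set.Ioi 0))
    (hα_nonneg : ∀ x y : ℝ, 0 < x → 0 < y → 0 ≤ α x y)
    (hα_symm : ∀ x y : ℝ, 0 < x → 0 < y → α x y = α y x)
    (hK_form : ∀ x y : ℝ, 0 < x → 0 < y → K x y = r x * r y + α x y)
    (hα_bound : ∀ x y : ℝ, 1 ≤ x → 1 ≤ y → α x y ≤ A * r x * r y)
    (ω : ℝ → ℝ → ℝ)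
    (hω_bound : ∀ R : ℝ, 1 ≤ R → ∀ y : ℝ, 0 < y → ∀ x : ℝ, 0 < x → x ≤ R → K x y / y ≤ ω R y)
    (hω_lim : ∀ R : ℝ, 1 ≤ R → Filter.Tendsto (ω R) Filter.atTop (nhds 0))
    (Ω : ℝ → ℝ)
    (hΩ_bound : ∀ R : ℝ, 1 ≤ R → ∀ x : ℝ, R ≤ x → r x / x ≤ Ω R)
    (hΩ_lim : Filter.Tendsto Ω Filter.atTop (nhds 0))
    (fin : ℝ → ℝ)
    (hfin_nonneg : ∀ x : ℝ, 0 < x → 0 ≤ fin x)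
    (hfin_int : IntegrableOn (fun x => (1 + x) * fin x) (Set.Ioi 0))
    (f : ℝ → ℕ → ℝ → ℝ)
    (hsol : ∀ ε : ℝ, 0 < ε → ε < 1 →
      IsDRBKSol (fun i j => ε * K (ε * i) (ε * j))
        (fun i => ε⁻¹ * ∫ x in cell ε i, fin x) (f ε)) :
    ∃ seq : ℕ → ℝ, ∃ flim : ℝ → ℝ → ℝ,
      (∀ n : ℕ, seq n ∈ Set.Ioo (0:ℝ) 1) ∧
      Filter.Tendsto seq Filter.atTop (nhds 0) ∧
      -- nonnegativity
      (∀ t : ℝ, 0 ≤ t → ∀ x : ℝ, 0 < x → 0 ≤ flim x t) ∧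
      -- flim(·,t) ∈ X_{0,1} for every t ≥ 0
      (∀ t : ℝ, 0 ≤ t → IntegrableOn (fun x => (1 + x) * flim x t) (Set.Ioi 0)) ∧
      -- flim ∈ L^∞(0,T; X_{0,1}) for every T > 0
      (∀ T : ℝ, 0 < T → ∃ M : ℝ, ∀ t ∈ Set.Icc (0:ℝ) T,
        (∫ x in Set.Ioi (0:ℝ), (1 + x) * |flim x t|) ≤ M) ∧
      -- flim ∈ C([0,∞); L¹(0,∞))
      (∀ t : ℝ, 0 ≤ t →
        Filter.Tendsto (fun s : ℝ => ∫ x in Set.Ioi (0:ℝ), |flim x s - flim x t|)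
          (nhdsWithin t (Set.Ici 0)) (nhds 0)) ∧
      -- (i) f_{ε_n} → flim in C([0,T]; w-L¹(0,∞)) for every T > 0
      (∀ T : ℝ, 0 < T → ∀ φ : ℝ → ℝ, Measurable φ → (∃ M : ℝ, ∀ x : ℝ, |φ x| ≤ M) →
        ∀ δ : ℝ, 0 < δ → ∃ N : ℕ, ∀ n : ℕ, N ≤ n → ∀ t ∈ Set.Icc (0:ℝ) T,
          |∫ x in Set.Ioi (0:ℝ),
              (stepFn (seq n) (fun i => f (seq n) i t) x - flim x t) * φ x| ≤ δ) ∧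
      -- (ii) flim is a weak solution of the continuous RBK equation
      (∀ t : ℝ, 0 ≤ t → ∀ φ : ℝ → ℝ, Measurable φ → (∃ M : ℝ, ∀ x : ℝ, |φ x| ≤ M) →
        IntegrableOn
          (fun q : ℝ × ℝ × ℝ => K q.2.1 q.2.2 * flim q.2.1 q.1 * flim q.2.2 q.1)
          {q : ℝ × ℝ × ℝ | 0 < q.1 ∧ q.1 < t ∧ 0 < q.2.2 ∧ q.2.2 < q.2.1} ∧
        IntegrableOn
          (fun q : ℝ × ℝ × ℝ => (φ (q.2.1 - q.2.2) - φ q.2.1 - φ q.2.2) *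
            K q.2.1 q.2.2 * flim q.2.1 q.1 * flim q.2.2 q.1)
          {q : ℝ × ℝ × ℝ | 0 < q.1 ∧ q.1 < t ∧ 0 < q.2.2 ∧ q.2.2 < q.2.1} ∧
        (∫ x in Set.Ioi (0:ℝ), (flim x t - fin x) * φ x) =
          ∫ q in {q : ℝ × ℝ × ℝ | 0 < q.1 ∧ q.1 < t ∧ 0 < q.2.2 ∧ q.2.2 < q.2.1},
            (φ (q.2.1 - q.2.2) - φ q.2.1 - φ q.2.2) *
              K q.2.1 q.2.2 * flim q.2.1 q.1 * flim q.2.2 q.1) := by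
  obtain ⟨CK, R1, c0, r1, big⟩ := K_big_of hA hK_symm hr_nonneg hK_form hα_bound hω_bound hω_lim hΩ_bound
  have H := fam_of hK_cont hK_symm hK_nonneg c0 r1 big hfin_nonneg hfin_int hsol
  obtain ⟨ε, ρ, L, hunif⟩ := lim_of H
  have hae : ∀ᵐ x ∂hl, ρ 0 x = fin x := by
    refine L.init_ae (fin_int hfin_int) (fun φ hφ => ?_)
    exact tendsto_nhds_unique (L.conv φ hφ 0 le_rfl)
      (Lam_init L.e0 L.el (fun n => hsol _ (L.e0 n) (L.e1 n)) hfin_int hfin_nonneg hφ)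
  refine ⟨ε, fun x t => ρ t x, fun n => ⟨L.e0 n, L.e1 n⟩, L.el, fun t _ x _ => L.nonneg t x,
    fun t _ => L.int t, fun T _ => ⟨2 * Mc fin, fun t _ => ?_⟩, fun t ht => L.l1_cont ht, ?_, ?_⟩
  · simp only [abs_of_nonneg (L.nonneg t _)]
    exact L.mass t
  · intro T hT φ hm hB δ hδ
    obtain ⟨N, hN⟩ := hunif T hT φ hm hB δ hδ
    obtain ⟨B, hB⟩ := hB
    refine ⟨N, fun n hn t ht => ?_⟩
    have i1 : Integrable (fun x => φ x * Fd f (ε n) (idx (ε n) x) t) (volume.restrict (Set.Ioi 0)) :=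
      integrable_bdd (H.u_one (L.e0 n) (L.e1 n) t).1 hm hB
    have i2 : Integrable (fun x => φ x * ρ t x) (volume.restrict (Set.Ioi 0)) :=
      integrable_bdd (L.int1 t) hm hB
    have e : (∫ x in Set.Ioi (0:ℝ), (stepFn (ε n) (fun i => f (ε n) i t) x - ρ t x) * φ x) =
        (∫ x in Set.Ioi (0:ℝ), φ x * Fd f (ε n) (idx (ε n) x) t) - ∫ x in Set.Ioi (0:ℝ), φ x * ρ t x := by
      rw [← integral_sub i1 i2]
      refine setIntegral_congr_fun measurableSet_Ioi (fun x hx => ?_)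
      simp only [stepFn_eq (L.e0 n) hx, Fd, max_eq_left ht.1]
      ring
    rw [e]
    exact hN n hn t ht.1 ht.2
  · rintro t ht φ hm ⟨B, hB⟩
    refine ⟨L.final1 ht, L.final2 ht hm hB, Eq.trans ?_ (L.final3 ht hm hB)⟩
    refine integral_congr_ae ?_
    change ∀ᵐ x ∂hl, _
    filter_upwards [hae] with x hx
    simp only [hx]
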